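/- arXiv:1709.03571 — 4 statements merged into one kernel-verified Lean document; each statement's English description precedes it below -/
import Mathlib

section
/- Let n ≥ 1 be an integer, M > 1, K > 1, and let f ∈ H^n(−1,1) with ‖f‖_{H^n(−1,1)} ≤ M and supp f ⊂ (−1,1). Let u be the wave field generated by f and set ε = (∫_0^K ω² (|u(−1,ω)|² + |u(1,ω)|²) dω)^{1/2}. If 0 < ε < e^{−1}, then there is a constant C > 0 depending only on c₁ and c₂ (independent of n, K, M and f) such that ‖f‖²_{L²(−1,1)} ≤ C ( ε² + M² / ( K^{2/3} |ln ε|^{1/4} / (6n−3)³ )^{2n−1} ). -/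
open MeasureTheory Real Set

/-- The Green function of the two-layered one-dimensional Helmholtz equation,
with wave speeds `c₁` (for `x > 0`) and `c₂` (for `x < 0`) and frequency `ω`,
so that `κ₁ = c₁ ω` and `κ₂ = c₂ ω`. -/
noncomputable def greenFn (c₁ c₂ ω x y : ℝ) : ℂ :=
  let κ₁ : ℂ := (c₁ : ℂ) * (ω : ℂ)
  let κ₂ : ℂ := (c₂ : ℂ) * (ω : ℂ)
  if 0 < y then
    if 0 < x then
      Complex.I * (κ₁ - κ₂) / (2 * κ₁ * (κ₁ + κ₂)) * Complex.exp (Complex.I * κ₁ * ((x : ℂ) + (y : ℂ)))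
        + Complex.I / (2 * κ₁) * Complex.exp (Complex.I * κ₁ * ((|x - y| : ℝ) : ℂ))
    else
      Complex.I / (κ₁ + κ₂) * Complex.exp (Complex.I * (κ₁ * (y : ℂ) - κ₂ * (x : ℂ)))
  else
    if x < 0 then
      Complex.I * (κ₂ - κ₁) / (2 * κ₂ * (κ₁ + κ₂)) * Complex.exp (-Complex.I * κ₂ * ((x : ℂ) + (y : ℂ)))
        + Complex.I / (2 * κ₂) * Complex.exp (Complex.I * κ₂ * ((|x - y| : ℝ) : ℂ))
    else
      Complex.I / (κ₁ + κ₂) * Complex.exp (Complex.I * (-κ₂ * (y : ℂ) + κ₁ * (x : ℂ)))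

/-- The wave field generated by a source `f` supported in `(-1, 1)`:
`u(x, ω) = ∫_{-1}^{1} g(x, y) f(y) dy`. -/
noncomputable def waveField (c₁ c₂ : ℝ) (f : ℝ → ℂ) (x ω : ℝ) : ℂ :=
  ∫ y in (-1:ℝ)..1, greenFn c₁ c₂ ω x y * f y

/-- The squared Sobolev norm `‖f‖²_{H^n(a,b)} = ∑_{k=0}^{n} ‖f^{(k)}‖²_{L²(a,b)}`. -/
noncomputable def sobolevNormSq (n : ℕ) (a b : ℝ) (f : ℝ → ℂ) : ℝ :=
  ∑ k ∈ Finset.range (n + 1), ∫ y in a..b, ‖iteratedDeriv k f y‖ ^ 2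

/-- Plancherel's identity for a square integrable function on a bounded interval. -/
lemma lintegral_sq_norm_fourierIntegral {b : ℝ} (hb : 0 < b) {h F : ℝ → ℂ}
    (hh : MemLp h 2 (volume.restrict (Ioc (-b) b)))
    (hF : ∀ ω : ℝ, F ω = ∫ τ in (-b)..b, h τ * Complex.exp (-(Complex.I * ω * τ)))
    (hc : Continuous F) :
    ∫⁻ ω : ℝ, ENNReal.ofReal (‖F ω‖ ^ 2)
      = ENNReal.ofReal (2 * π * ∫ τ in (-b)..b, ‖h τ‖ ^ 2) := by
  have hab : -b < b := by linarith
  set p : ℝ := π / b with hp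
  have hp0 : 0 < p := by positivity
  have hcoeff : ∀ (θ : ℝ) (n : ℤ),
      ‖F (θ + n • p)‖ ^ 2 = (2 * b) ^ 2 *
        ‖fourierCoeffOn hab (fun τ => h τ * Complex.exp (-(Complex.I * θ * τ))) n‖ ^ 2 := by
    intro θ n
    rw [fourierCoeffOn_eq_integral, norm_smul, mul_pow ‖(1 / (b - -b) : ℝ)‖, hF]
    have e : ‖(1 / (b - -b) : ℝ)‖ ^ 2 = ((2 * b) ^ 2)⁻¹ := by
      rw [Real.norm_eq_abs, sq_abs]; field_simp; ring
    rw [e, mul_inv_cancel_left₀ (by positivity)]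
    congr 2
    refine intervalIntegral.integral_congr fun τ _ => ?_
    simp only [fourier_coe_apply, smul_eq_mul, zsmul_eq_mul, hp]
    rw [mul_left_comm, ← Complex.exp_add]
    congr 2
    have : (b : ℂ) ≠ 0 := by exact_mod_cast hb.ne'
    push_cast
    field_simp
    ring
  have hmem : ∀ θ : ℝ, MemLp (fun τ => h τ * Complex.exp (-(Complex.I * θ * τ))) 2
      (volume.restrict (Ioc (-b) b)) := by
    intro θ
    refine hh.congr_norm ?_ ?_
    · exact hh.1.mul (by fun_prop)
    · refine Filter.Eventually.of_forall fun τ => ?_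
      have : -(Complex.I * θ * τ) = ((-(θ * τ) : ℝ) : ℂ) * Complex.I := by push_cast; ring
      rw [norm_mul, this, Complex.norm_exp_ofReal_mul_I, mul_one]
  have hsum : ∀ θ : ℝ, ∑' n : ℤ, ENNReal.ofReal (‖F (θ + n • p)‖ ^ 2)
      = ENNReal.ofReal (2 * b * ∫ τ in (-b)..b, ‖h τ‖ ^ 2) := by
    intro θ
    have hs := (hasSum_sq_fourierCoeffOn hab (hmem θ)).mul_left ((2 * b) ^ 2)
    simp_rw [← hcoeff] at hs
    rw [← ENNReal.ofReal_tsum_of_nonneg (fun _ => by positivity) hs.summable, hs.tsum_eq]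
    congr 1
    have : ∀ τ : ℝ, ‖h τ * Complex.exp (-(Complex.I * θ * τ))‖ = ‖h τ‖ := by
      intro τ
      have : -(Complex.I * θ * τ) = ((-(θ * τ) : ℝ) : ℂ) * Complex.I := by push_cast; ring
      rw [norm_mul, this, Complex.norm_exp_ofReal_mul_I, mul_one]
    simp_rw [this, smul_eq_mul]
    field_simp
    ring
  have hcover : ∫⁻ ω : ℝ, ENNReal.ofReal (‖F ω‖ ^ 2)
      = ∑' n : ℤ, ∫⁻ ω in Ioc (0 + n • p) (0 + (n + 1) • p), ENNReal.ofReal (‖F ω‖ ^ 2) := by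
    rw [← lintegral_iUnion (fun _ => measurableSet_Ioc) (pairwise_disjoint_Ioc_add_zsmul 0 p),
      iUnion_Ioc_add_zsmul hp0, setLIntegral_univ]
  have hshift : ∀ n : ℤ, ∫⁻ ω in Ioc (0 + n • p) (0 + (n + 1) • p), ENNReal.ofReal (‖F ω‖ ^ 2)
      = ∫⁻ θ in Ioc 0 p, ENNReal.ofReal (‖F (θ + n • p)‖ ^ 2) := by
    intro n
    rw [← (measurePreserving_add_right volume (n • p)).setLIntegral_comp_preimage
      measurableSet_Ioc (by fun_prop)]
    congr 2
    ext x
    simp [add_smul]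
  rw [hcover]
  simp_rw [hshift]
  rw [← lintegral_tsum (fun n => by fun_prop)]
  simp_rw [hsum]
  rw [setLIntegral_const, Real.volume_Ioc, ← ENNReal.ofReal_mul (mul_nonneg (by positivity)
    (intervalIntegral.integral_nonneg hab.le fun _ _ => by positivity))]
  congr 1
  rw [hp]
  field_simp
  ring

/-- The cosine transform on `(0, b)`, at a complex frequency. -/
noncomputable def cosTransform (b : ℝ) (φ : ℝ → ℂ) (z : ℂ) : ℂ :=
  ∫ τ in (0 : ℝ)..b, φ τ * Complex.cos (z * τ)

/-- The sine transform on `(0, b)`, at a complex frequency. -/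
noncomputable def sinTransform (b : ℝ) (φ : ℝ → ℂ) (z : ℂ) : ℂ :=
  ∫ τ in (0 : ℝ)..b, φ τ * Complex.sin (z * τ)

lemma norm_cos_le_exp_norm (z : ℂ) : ‖Complex.cos z‖ ≤ Real.exp ‖z‖ := by
  rw [Complex.cos, norm_div, Complex.norm_ofNat, div_le_iff₀ two_pos]
  have h1 := Complex.norm_exp_le_exp_norm (z * Complex.I)
  have h2 := Complex.norm_exp_le_exp_norm (-z * Complex.I)
  simp only [norm_mul, norm_neg, Complex.norm_I, mul_one] at h1 h2
  linarith [norm_add_le (Complex.exp (z * Complex.I)) (Complex.exp (-z * Complex.I))]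

lemma norm_sin_le_exp_norm (z : ℂ) : ‖Complex.sin z‖ ≤ Real.exp ‖z‖ := by
  rw [Complex.sin, norm_div, Complex.norm_ofNat, div_le_iff₀ two_pos, norm_mul, Complex.norm_I,
    mul_one]
  have h1 := Complex.norm_exp_le_exp_norm (z * Complex.I)
  have h2 := Complex.norm_exp_le_exp_norm (-z * Complex.I)
  simp only [norm_mul, norm_neg, Complex.norm_I, mul_one] at h1 h2
  linarith [norm_sub_le (Complex.exp (-z * Complex.I)) (Complex.exp (z * Complex.I))]

/-- Parametric integrals of `φ τ * g (z * τ)` with entire `g` are entire in `z`. -/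
lemma differentiable_integral_mul_comp {b : ℝ} {φ : ℝ → ℂ} (hφ : Continuous φ) {g g' : ℂ → ℂ}
    (hg : ∀ z, HasDerivAt g (g' z) z) (hg' : Continuous g') :
    Differentiable ℂ fun z : ℂ => ∫ τ in (0 : ℝ)..b, φ τ * g (z * τ) := by
  intro z₀
  have hgc : Continuous g := continuous_iff_continuousAt.2 fun z => (hg z).continuousAt
  have hcont : Continuous fun q : ℂ × ℝ => φ q.2 * (g' (q.1 * q.2) * q.2) := by fun_prop
  obtain ⟨B, hB⟩ := ((isCompact_closedBall z₀ 1).prod (isCompact_uIcc (a := (0 : ℝ)) (b := b))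
    ).exists_bound_of_continuousOn hcont.continuousOn
  refine (intervalIntegral.hasDerivAt_integral_of_dominated_loc_of_deriv_le
    (F := fun z τ => φ τ * g (z * τ)) (F' := fun z τ => φ τ * (g' (z * τ) * τ))
    (bound := fun _ => B) (s := Metric.closedBall z₀ 1)
    (Metric.closedBall_mem_nhds z₀ one_pos) (Filter.Eventually.of_forall fun z => ?_) ?_ ?_ ?_ ?_
    ?_).2.differentiableAt
  · exact Continuous.aestronglyMeasurable (by fun_prop)
  · exact Continuous.intervalIntegrable (by fun_prop) _ _
  · exact Continuous.aestronglyMeasurable (by fun_prop)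
  · exact Filter.Eventually.of_forall fun τ hτ z hz => hB (z, τ) ⟨hz, uIoc_subset_uIcc hτ⟩
  · exact intervalIntegrable_const
  · refine Filter.Eventually.of_forall fun τ _ z _ => ?_
    have := ((hg (z * τ)).comp z ((hasDerivAt_id z).mul_const (τ : ℂ))).const_mul (φ τ)
    simpa using this

lemma differentiable_cosTransform (b : ℝ) {φ : ℝ → ℂ} (hφ : Continuous φ) :
    Differentiable ℂ (cosTransform b φ) :=
  differentiable_integral_mul_comp hφ (fun z => Complex.hasDerivAt_cos z)
    Complex.continuous_sin.neg

lemma differentiable_sinTransform (b : ℝ) {φ : ℝ → ℂ} (hφ : Continuous φ) :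
    Differentiable ℂ (sinTransform b φ) :=
  differentiable_integral_mul_comp hφ (fun z => Complex.hasDerivAt_sin z) Complex.continuous_cos

lemma norm_integral_mul_comp_le {b : ℝ} (hb : 0 ≤ b) {φ : ℝ → ℂ} (hφ : Continuous φ) {g : ℂ → ℂ}
    (hg : ∀ z, ‖g z‖ ≤ Real.exp ‖z‖) (z : ℂ) :
    ‖∫ τ in (0 : ℝ)..b, φ τ * g (z * τ)‖
      ≤ (∫ τ in (0 : ℝ)..b, ‖φ τ‖) * Real.exp (b * ‖z‖) := by
  rw [← intervalIntegral.integral_mul_const]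
  refine intervalIntegral.norm_integral_le_of_norm_le hb
    (Filter.Eventually.of_forall fun τ hτ => ?_) (Continuous.intervalIntegrable (by fun_prop) _ _)
  rw [norm_mul]
  gcongr
  refine (hg _).trans (Real.exp_le_exp.2 ?_)
  rw [norm_mul, Complex.norm_real, Real.norm_of_nonneg hτ.1.le, mul_comm]
  gcongr
  exact hτ.2

lemma conj_cosTransform (b : ℝ) (φ : ℝ → ℂ) (x : ℝ) :
    (starRingEnd ℂ) (cosTransform b φ x) = cosTransform b (fun τ => (starRingEnd ℂ) (φ τ)) x := by
  rw [cosTransform, cosTransform, intervalIntegral.intervalIntegral_eq_integral_uIoc,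
    intervalIntegral.intervalIntegral_eq_integral_uIoc, Complex.real_smul, map_mul, Complex.conj_ofReal,
    ← Complex.real_smul, ← integral_conj]
  congr 2 with τ
  simp [← Complex.cos_conj]

lemma conj_sinTransform (b : ℝ) (φ : ℝ → ℂ) (x : ℝ) :
    (starRingEnd ℂ) (sinTransform b φ x) = sinTransform b (fun τ => (starRingEnd ℂ) (φ τ)) x := by
  rw [sinTransform, sinTransform, intervalIntegral.intervalIntegral_eq_integral_uIoc,
    intervalIntegral.intervalIntegral_eq_integral_uIoc, Complex.real_smul, map_mul, Complex.conj_ofReal,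
    ← Complex.real_smul, ← integral_conj]
  congr 2 with τ
  simp [← Complex.sin_conj]

/-- Plancherel's identity for the even (`σ = 1`) or odd (`σ = -1`) extension of a function on
`(0, b)`. -/
lemma integral_sq_norm_reflected_fourierIntegral {b : ℝ} (hb : 0 < b) {φ F : ℝ → ℂ}
    (hφ : Continuous φ) {σ : ℂ} (hσ : ‖σ‖ = 1)
    (hF : ∀ ω : ℝ, F ω = ∫ τ in (0 : ℝ)..b, φ τ *
      (Complex.exp (-(Complex.I * ω * τ)) + σ * Complex.exp (Complex.I * ω * τ)))
    (hc : Continuous F) :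
    Integrable (fun ω => ‖F ω‖ ^ 2) ∧
      ∫ ω : ℝ, ‖F ω‖ ^ 2 = 4 * π * ∫ τ in (0 : ℝ)..b, ‖φ τ‖ ^ 2 := by
  set h : ℝ → ℂ := fun τ => if 0 < τ then φ τ else σ * φ (-τ) with hh
  have hneg : ∀ τ ∈ Ioc 0 b, h (-τ) = σ * φ τ := fun τ hτ => by
    simp [hh, hτ.1.le]
  have hpos : ∀ τ ∈ Ioc 0 b, h τ = φ τ := fun τ hτ => by simp [hh, hτ.1]
  have hnorm : ∀ τ, ‖h τ‖ = ‖φ |τ|‖ := fun τ => by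
    by_cases hτ : 0 < τ
    · simp [hh, hτ, abs_of_pos hτ]
    · simp [hh, hτ, hσ, abs_of_nonpos (not_lt.1 hτ)]
  have hmeas : Measurable h :=
    Measurable.ite measurableSet_Ioi hφ.measurable (by fun_prop)
  have hmem : MemLp h 2 (volume.restrict (Ioc (-b) b)) := by
    obtain ⟨B, hB⟩ := (isCompact_Icc (a := -b) (b := b)).exists_bound_of_continuousOn
      (show ContinuousOn (fun τ => φ |τ|) _ by fun_prop)
    refine MemLp.of_bound hmeas.aestronglyMeasurable B ?_
    filter_upwards [ae_restrict_mem measurableSet_Ioc] with τ hτ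
    exact (hnorm τ).trans_le (hB τ (Ioc_subset_Icc_self hτ))
  have hint : IntervalIntegrable h volume (-b) b :=
    (intervalIntegrable_iff_integrableOn_Ioc_of_le (by linarith)).2
      (hmem.integrable one_le_two)
  have split : ∀ {E : Type} [NormedAddCommGroup E] [NormedSpace ℝ E] (G : ℝ → E),
      IntervalIntegrable G volume (-b) b →
      ∫ τ in (-b)..b, G τ = ∫ τ in (0 : ℝ)..b, (G τ + G (-τ)) := by
    intro E _ _ G hG
    have h0 : (0 : ℝ) ∈ uIcc (-b) b := by rw [uIcc_of_le (by linarith)]; constructor <;> linarith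
    have h1 : IntervalIntegrable G volume (-b) 0 :=
      hG.mono_set (uIcc_subset_uIcc left_mem_uIcc h0)
    have h2 : IntervalIntegrable G volume 0 b :=
      hG.mono_set (uIcc_subset_uIcc h0 right_mem_uIcc)
    have h3 : IntervalIntegrable (fun τ => G (-τ)) volume 0 b := by
      simpa using (h1.comp_sub_left 0).symm
    rw [← intervalIntegral.integral_add_adjacent_intervals h1 h2,
      intervalIntegral.integral_add h2 h3, intervalIntegral.integral_comp_neg, neg_zero, add_comm]
  have hF' : ∀ ω : ℝ, F ω = ∫ τ in (-b)..b, h τ * Complex.exp (-(Complex.I * ω * τ)) := by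
    intro ω
    rw [hF, split _ (hint.mul_continuousOn (by fun_prop))]
    refine intervalIntegral.integral_congr_ae (Filter.Eventually.of_forall fun τ hτ => ?_)
    rw [uIoc_of_le hb.le] at hτ
    simp only [hpos τ hτ, hneg τ hτ]
    push_cast
    rw [mul_neg, neg_neg]
    ring
  have hsq : ∫ τ in (-b)..b, ‖h τ‖ ^ 2 = 2 * ∫ τ in (0 : ℝ)..b, ‖φ τ‖ ^ 2 := by
    simp_rw [hnorm]
    rw [split _ (Continuous.intervalIntegrable (by fun_prop) _ _),
      ← intervalIntegral.integral_const_mul]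
    refine intervalIntegral.integral_congr_ae (Filter.Eventually.of_forall fun τ hτ => ?_)
    rw [uIoc_of_le hb.le] at hτ
    simp only [abs_neg, abs_of_pos hτ.1]
    ring
  have key := lintegral_sq_norm_fourierIntegral hb hmem hF' hc
  rw [hsq] at key
  have hcF : Continuous fun ω => ‖F ω‖ ^ 2 := by fun_prop
  have hnn : 0 ≤ ∫ τ in (0 : ℝ)..b, ‖φ τ‖ ^ 2 :=
    intervalIntegral.integral_nonneg hb.le fun _ _ => by positivity
  refine ⟨⟨hcF.aestronglyMeasurable, ?_⟩, ?_⟩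
  · rw [hasFiniteIntegral_iff_ofReal (Filter.Eventually.of_forall fun _ => by positivity), key]
    exact ENNReal.ofReal_lt_top
  · rw [integral_eq_lintegral_of_nonneg_ae (Filter.Eventually.of_forall fun _ => by positivity)
      hcF.aestronglyMeasurable, key, ENNReal.toReal_ofReal (by positivity)]
    ring

lemma integrable_sq_norm_cosTransform {b : ℝ} (hb : 0 < b) {φ : ℝ → ℂ} (hφ : Continuous φ) :
    Integrable (fun ω : ℝ => ‖cosTransform b φ ω‖ ^ 2) ∧
      ∫ ω : ℝ, ‖cosTransform b φ ω‖ ^ 2 = π * ∫ τ in (0 : ℝ)..b, ‖φ τ‖ ^ 2 := by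
  have hc : Continuous fun ω : ℝ => 2 * cosTransform b φ ω :=
    continuous_const.mul ((differentiable_cosTransform b hφ).continuous.comp
      Complex.continuous_ofReal)
  obtain ⟨h1, h2⟩ := integral_sq_norm_reflected_fourierIntegral (σ := 1) hb hφ (by simp)
    (F := fun ω : ℝ => 2 * cosTransform b φ ω) (fun ω => by
      simp only [cosTransform]
      rw [← intervalIntegral.integral_const_mul]
      refine intervalIntegral.integral_congr fun τ _ => ?_
      simp only [Complex.cos]
      rw [show -((ω : ℂ) * τ) * Complex.I = -(Complex.I * ω * τ) by ring,
        show (ω : ℂ) * τ * Complex.I = Complex.I * ω * τ by ring]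
      ring) hc
  simp only [norm_mul, mul_pow, Complex.norm_ofNat] at h1 h2
  rw [integral_const_mul] at h2
  refine ⟨?_, by linarith⟩
  exact (h1.const_mul (1 / 2 ^ 2)).congr (Filter.Eventually.of_forall fun ω => by ring)

lemma integrable_sq_norm_sinTransform {b : ℝ} (hb : 0 < b) {φ : ℝ → ℂ} (hφ : Continuous φ) :
    Integrable (fun ω : ℝ => ‖sinTransform b φ ω‖ ^ 2) ∧
      ∫ ω : ℝ, ‖sinTransform b φ ω‖ ^ 2 = π * ∫ τ in (0 : ℝ)..b, ‖φ τ‖ ^ 2 := by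
  have hc : Continuous fun ω : ℝ => -2 * Complex.I * sinTransform b φ ω :=
    continuous_const.mul ((differentiable_sinTransform b hφ).continuous.comp
      Complex.continuous_ofReal)
  obtain ⟨h1, h2⟩ := integral_sq_norm_reflected_fourierIntegral (σ := -1) hb hφ (by simp)
    (F := fun ω : ℝ => -2 * Complex.I * sinTransform b φ ω) (fun ω => by
      simp only [sinTransform]
      rw [← intervalIntegral.integral_const_mul]
      refine intervalIntegral.integral_congr fun τ _ => ?_
      simp only [Complex.sin]
      rw [show -((ω : ℂ) * τ) * Complex.I = -(Complex.I * ω * τ) by ring,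
        show (ω : ℂ) * τ * Complex.I = Complex.I * ω * τ by ring]
      linear_combination (-(φ τ) * (Complex.exp (-(Complex.I * ω * τ)) -
        Complex.exp (Complex.I * ω * τ))) * Complex.I_mul_I) hc
  simp only [norm_mul, norm_neg, mul_pow, Complex.norm_ofNat, Complex.norm_I,
    mul_one] at h1 h2
  rw [integral_const_mul] at h2
  refine ⟨?_, by linarith⟩
  exact (h1.const_mul (1 / 2 ^ 2)).congr (Filter.Eventually.of_forall fun ω => by ring)

lemma cosTransform_neg (b : ℝ) (φ : ℝ → ℂ) (z : ℂ) :
    cosTransform b φ (-z) = cosTransform b φ z := by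
  simp [cosTransform]

lemma sinTransform_neg (b : ℝ) (φ : ℝ → ℂ) (z : ℂ) :
    sinTransform b φ (-z) = -sinTransform b φ z := by
  simp [sinTransform]

lemma integral_eq_low_add_high {G : ℝ → ℝ} (hG : Integrable G) (heven : ∀ ω, G (-ω) = G ω) {L : ℝ}
    (hL : 0 ≤ L) :
    ∫ ω, G ω = 2 * (∫ ω in (0 : ℝ)..L, G ω) + 2 * ∫ ω in Ioi L, G ω := by
  have h1 : ∫ ω, G ω = 2 * ∫ ω in Ioi 0, G ω := by
    rw [← integral_comp_abs]
    congr with ω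
    rcases abs_choice ω with h | h <;> rw [h]
    exact (heven ω).symm
  rw [h1, ← mul_add, intervalIntegral.integral_of_le hL, ← setIntegral_union
    (Ioc_disjoint_Ioi le_rfl) measurableSet_Ioi hG.integrableOn hG.integrableOn,
    Ioc_union_Ioi_eq_Ioi hL]

lemma cosTransform_by_parts {b : ℝ} {φ φ' : ℝ → ℂ} (hφ : ∀ τ, HasDerivAt φ (φ' τ) τ)
    (hφ' : Continuous φ') (hφb : φ b = 0) (z : ℂ) :
    z * cosTransform b φ z = -sinTransform b φ' z := by
  have h := intervalIntegral.integral_mul_deriv_eq_deriv_mul (a := 0) (b := b) (u := φ) (u' := φ')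
    (v := fun τ : ℝ => Complex.sin (z * τ)) (v' := fun τ : ℝ => z * Complex.cos (z * τ))
    (fun τ _ => hφ τ) (fun τ _ => by
      have h1 : HasDerivAt (fun τ : ℝ => z * (τ : ℂ)) z τ := by
        simpa using (Complex.ofRealCLM.hasDerivAt (x := τ)).const_mul z
      exact ((Complex.hasDerivAt_sin (z * τ)).comp τ h1).congr_deriv (mul_comm _ _))
    (hφ'.intervalIntegrable _ _) (Continuous.intervalIntegrable (by fun_prop) _ _)
  simp only [hφb, zero_mul, Complex.ofReal_zero, mul_zero, Complex.sin_zero, sub_zero,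
    zero_sub] at h
  rw [cosTransform, sinTransform, ← h, ← intervalIntegral.integral_const_mul]
  congr with τ
  ring

lemma sinTransform_by_parts {b : ℝ} {φ φ' : ℝ → ℂ} (hφ : ∀ τ, HasDerivAt φ (φ' τ) τ)
    (hφ' : Continuous φ') (hφb : φ b = 0) (z : ℂ) :
    z * sinTransform b φ z = φ 0 + cosTransform b φ' z := by
  have h := intervalIntegral.integral_mul_deriv_eq_deriv_mul (a := 0) (b := b) (u := φ) (u' := φ')
    (v := fun τ : ℝ => -Complex.cos (z * τ)) (v' := fun τ : ℝ => z * Complex.sin (z * τ))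
    (fun τ _ => hφ τ) (fun τ _ => by
      have h1 : HasDerivAt (fun τ : ℝ => z * (τ : ℂ)) z τ := by
        simpa using (Complex.ofRealCLM.hasDerivAt (x := τ)).const_mul z
      have h2 := ((Complex.hasDerivAt_cos (z * τ)).comp τ h1).neg
      rw [neg_mul, neg_neg, mul_comm] at h2
      exact h2)
    (hφ'.intervalIntegrable _ _) (Continuous.intervalIntegrable (by fun_prop) _ _)
  simp only [hφb, zero_mul, Complex.ofReal_zero, mul_zero, Complex.cos_zero, mul_neg, mul_one,
    intervalIntegral.integral_neg, sub_neg_eq_add, neg_zero, zero_add] at h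
  rw [cosTransform, sinTransform, ← h, ← intervalIntegral.integral_const_mul]
  congr with τ
  ring

lemma integral_sq_norm_le_cosTransform {b L : ℝ} (hb : 0 < b) (hL : 0 < L) {φ φ' : ℝ → ℂ}
    (hφ : ∀ τ, HasDerivAt φ (φ' τ) τ) (hφ' : Continuous φ') (hφb : φ b = 0) :
    π * ∫ τ in (0 : ℝ)..b, ‖φ τ‖ ^ 2 ≤
      2 * (∫ ω in (0 : ℝ)..L, ‖cosTransform b φ ω‖ ^ 2)
        + 2 * π / L ^ 2 * ∫ τ in (0 : ℝ)..b, ‖φ' τ‖ ^ 2 := by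
  have hφc : Continuous φ := continuous_iff_continuousAt.2 fun τ => (hφ τ).continuousAt
  obtain ⟨h1, h2⟩ := integrable_sq_norm_cosTransform hb hφc
  obtain ⟨h3, h4⟩ := integrable_sq_norm_sinTransform hb hφ'
  rw [← h2, integral_eq_low_add_high h1 (fun ω => by simp [cosTransform_neg]) hL.le]
  have : ∫ ω in Ioi L, ‖cosTransform b φ ω‖ ^ 2 ≤
      ∫ ω in Ioi L, 1 / L ^ 2 * ‖sinTransform b φ' ω‖ ^ 2 := by
    refine setIntegral_mono_on h1.integrableOn (h3.const_mul _).integrableOn measurableSet_Ioi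
      fun ω hω => ?_
    have hω' : L < ω := hω
    have := congrArg norm (cosTransform_by_parts hφ hφ' hφb ω)
    rw [norm_mul, norm_neg, Complex.norm_real, Real.norm_of_nonneg (by linarith)] at this
    rw [← this, mul_pow, ← mul_assoc]
    refine le_mul_of_one_le_left (by positivity) ?_
    rw [one_div, inv_mul_eq_div, one_le_div (by positivity)]
    gcongr
  have h5 : ∫ ω in Ioi L, ‖sinTransform b φ' ω‖ ^ 2 ≤ π * ∫ τ in (0 : ℝ)..b, ‖φ' τ‖ ^ 2 := by
    rw [← h4]
    exact setIntegral_le_integral h3 (Filter.Eventually.of_forall fun _ => by positivity)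
  rw [integral_const_mul] at this
  have h6 := mul_le_mul_of_nonneg_left h5 (show 0 ≤ 1 / L ^ 2 by positivity)
  have h7 : 2 * π / L ^ 2 * (∫ τ in (0 : ℝ)..b, ‖φ' τ‖ ^ 2)
      = 2 * (1 / L ^ 2 * (π * ∫ τ in (0 : ℝ)..b, ‖φ' τ‖ ^ 2)) := by ring
  rw [h7]
  linarith

lemma integral_sq_norm_le_sinTransform {b L : ℝ} (hb : 0 < b) (hL : 0 < L) {φ φ' : ℝ → ℂ}
    (hφ : ∀ τ, HasDerivAt φ (φ' τ) τ) (hφ' : Continuous φ') (hφb : φ b = 0) :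
    π * ∫ τ in (0 : ℝ)..b, ‖φ τ‖ ^ 2 ≤
      2 * (∫ ω in (0 : ℝ)..L, ‖sinTransform b φ ω‖ ^ 2) + 4 * ‖φ 0‖ ^ 2 / L
        + 4 * π / L ^ 2 * ∫ τ in (0 : ℝ)..b, ‖φ' τ‖ ^ 2 := by
  have hφc : Continuous φ := continuous_iff_continuousAt.2 fun τ => (hφ τ).continuousAt
  obtain ⟨h1, h2⟩ := integrable_sq_norm_sinTransform hb hφc
  obtain ⟨h3, h4⟩ := integrable_sq_norm_cosTransform hb hφ'
  rw [← h2, integral_eq_low_add_high h1 (fun ω => by simp [sinTransform_neg]) hL.le]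
  have hI : IntegrableOn (fun ω : ℝ => 2 * ‖φ 0‖ ^ 2 * ω ^ (-2 : ℝ)) (Ioi L) :=
    (integrableOn_Ioi_rpow_of_lt (by norm_num) hL).const_mul _
  have : ∫ ω in Ioi L, ‖sinTransform b φ ω‖ ^ 2 ≤
      ∫ ω in Ioi L, (2 * ‖φ 0‖ ^ 2 * ω ^ (-2 : ℝ) + 2 / L ^ 2 * ‖cosTransform b φ' ω‖ ^ 2) := by
    refine setIntegral_mono_on h1.integrableOn (hI.add (h3.const_mul _).integrableOn)
      measurableSet_Ioi fun ω hω => ?_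
    have hω' : L < ω := hω
    have hω0 : 0 < ω := hL.trans hω'
    have := congrArg norm (sinTransform_by_parts hφ hφ' hφb ω)
    rw [norm_mul, Complex.norm_real, Real.norm_of_nonneg hω0.le] at this
    have h5 : (ω * ‖sinTransform b φ ω‖) ^ 2
        ≤ 2 * ‖φ 0‖ ^ 2 + 2 * ‖cosTransform b φ' ω‖ ^ 2 := by
      have := pow_le_pow_left₀ (by positivity) (this.le.trans (norm_add_le _ _)) 2
      nlinarith [sq_nonneg (‖φ 0‖ - ‖cosTransform b φ' ω‖)]
    have h6 : ‖sinTransform b φ ω‖ ^ 2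
        ≤ 2 * ‖φ 0‖ ^ 2 / ω ^ 2 + 2 / ω ^ 2 * ‖cosTransform b φ' ω‖ ^ 2 := by
      rw [mul_pow] at h5
      have : 2 * ‖φ 0‖ ^ 2 / ω ^ 2 + 2 / ω ^ 2 * ‖cosTransform b φ' ω‖ ^ 2
        = (2 * ‖φ 0‖ ^ 2 + 2 * ‖cosTransform b φ' ω‖ ^ 2) / ω ^ 2 := by ring
      rw [this, le_div_iff₀ (by positivity)]
      linarith
    have h7 : ω ^ (-2 : ℝ) = (ω ^ 2)⁻¹ := by
      rw [Real.rpow_neg hω0.le]; norm_num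
    rw [h7, ← div_eq_mul_inv]
    refine h6.trans ?_
    gcongr
  rw [integral_add hI (h3.const_mul _).integrableOn, integral_const_mul, integral_const_mul,
    integral_Ioi_rpow_of_lt (by norm_num) hL] at this
  have h5 : ∫ ω in Ioi L, ‖cosTransform b φ' ω‖ ^ 2 ≤ π * ∫ τ in (0 : ℝ)..b, ‖φ' τ‖ ^ 2 := by
    rw [← h4]
    exact setIntegral_le_integral h3 (Filter.Eventually.of_forall fun _ => by positivity)
  have h6 := mul_le_mul_of_nonneg_left h5 (show 0 ≤ 2 / L ^ 2 by positivity)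
  have h7 : 4 * π / L ^ 2 * (∫ τ in (0 : ℝ)..b, ‖φ' τ‖ ^ 2)
      = 2 * (2 / L ^ 2 * (π * ∫ τ in (0 : ℝ)..b, ‖φ' τ‖ ^ 2)) := by ring
  have h8 : -L ^ ((-2 : ℝ) + 1) / (-2 + 1) = 1 / L := by
    rw [show (-2 : ℝ) + 1 = -1 by norm_num, Real.rpow_neg_one]; ring
  rw [h8] at this
  have h9 : 4 * ‖φ 0‖ ^ 2 / L = 2 * (2 * ‖φ 0‖ ^ 2 * (1 / L)) := by ring
  rw [h7, h9]
  linarith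

lemma norm_cosh_le (w : ℂ) : ‖Complex.cosh w‖ ≤ Real.cosh w.re := by
  rw [Complex.cosh, Real.cosh_eq, norm_div, Complex.norm_ofNat]
  gcongr
  refine (norm_add_le _ _).trans ?_
  rw [Complex.norm_exp, Complex.norm_exp, Complex.neg_re]

/-- Quantitative analytic continuation along the real axis: an entire function of exponential type
which is nonnegative on the real line and has a small integral over `(0, K)` has a controlled
integral over `(0, L)`. This is the three lines theorem for the primitive, in the coordinate
`K * cosh w ^ 2`. -/
lemma integral_le_of_entire {h : ℂ → ℂ} (hh : Differentiable ℂ h) {G : ℝ → ℝ}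
    (hG : ∀ x : ℝ, h x = G x) (hG0 : ∀ x, 0 ≤ G x) {Q a K L η : ℝ} (hK : 0 < K) (hKL : K < L)
    (ha : 0 ≤ a) (hQ : ∀ z, ‖h z‖ ≤ Q * Real.exp (a * ‖z‖))
    (hη : ∫ x in (0 : ℝ)..K, G x ≤ η) :
    ∫ x in (0 : ℝ)..L, G x ≤
      √η * √(4 * L ^ 2 / K * (Q * Real.exp (a * (4 * L ^ 2 / K)))) := by
  have hL : 0 < L := hK.trans hKL
  set R : ℝ := 4 * L ^ 2 / K with hR
  have hQ0 : 0 ≤ Q := by simpa using (norm_nonneg _).trans (hQ 0)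
  have hLR : L ≤ R := by
    rw [hR, le_div_iff₀ hK]; nlinarith
  have hGc : Continuous G := by
    have : G = fun x : ℝ => (h x).re := by ext x; rw [hG, Complex.ofReal_re]
    rw [this]
    exact Complex.continuous_re.comp (hh.continuous.comp Complex.continuous_ofReal)
  obtain ⟨J, hJ0, hJ⟩ := ((hh.differentiableOn (s := Metric.ball (0 : ℂ) (R + 1))
    ).isExactOn_ball).with_val_at 0 0
  have hmem : ∀ z : ℂ, ‖z‖ ≤ R → z ∈ Metric.ball (0 : ℂ) (R + 1) := fun z hz => by
    rw [mem_ball_zero_iff]; linarith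
  have hR0 : 0 ≤ R := by positivity
  have hJb : ∀ z : ℂ, ‖z‖ ≤ R → ‖J z‖ ≤ R * (Q * Real.exp (a * R)) := by
    intro z hz
    have := (convex_closedBall (0 : ℂ) R).norm_image_sub_le_of_norm_hasDerivWithin_le
      (f := J) (f' := h) (C := Q * Real.exp (a * R)) (x := 0) (y := z)
      (fun x hx => (hJ x (hmem x (by simpa using hx))).hasDerivWithinAt)
      (fun x hx => (hQ x).trans (by
        have : ‖x‖ ≤ R := by simpa using hx
        gcongr)) (by simpa using hR0) (by simpa using hz)
    rw [hJ0, sub_zero, sub_zero] at this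
    refine this.trans ?_
    rw [mul_comm]
    gcongr
  have hJx : ∀ x : ℝ, 0 ≤ x → x ≤ L → J x = (∫ t in (0 : ℝ)..x, G t : ℝ) := by
    intro x hx hxL
    rw [← intervalIntegral.integral_ofReal]
    simp_rw [← hG]
    rw [intervalIntegral.integral_eq_sub_of_hasDerivAt (f := fun t : ℝ => J t)
      (f' := fun t : ℝ => h t) (fun t ht => ?_) (Continuous.intervalIntegrable
        (hh.continuous.comp Complex.continuous_ofReal) _ _)]
    · simp [hJ0]
    · rw [uIcc_of_le hx] at ht
      refine (hJ t (hmem _ ?_)).comp_ofReal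
      rw [Complex.norm_real, Real.norm_of_nonneg ht.1]
      linarith [ht.2]
  obtain ⟨s, hs0, hs⟩ : ∃ s : ℝ, 0 < s ∧ Real.cosh s ^ 2 = L / K := by
    have h1 : 1 < √(L / K) := by
      rw [Real.lt_sqrt zero_le_one, one_pow, one_lt_div hK]; exact hKL
    refine ⟨Real.arcosh √(L / K), Real.arcosh_pos h1, ?_⟩
    rw [Real.cosh_arcosh h1.le, Real.sq_sqrt (by positivity)]
  set ψ : ℂ → ℂ := fun w => K * Complex.cosh w ^ 2 with hψ
  have hψR : ∀ w ∈ Complex.HadamardThreeLines.verticalClosedStrip 0 (2 * s), ‖ψ w‖ ≤ R := by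
    intro w hw
    have h1 : 0 ≤ w.re ∧ w.re ≤ 2 * s := hw
    have h2 : Real.cosh w.re ≤ Real.cosh (2 * s) := by
      rw [Real.cosh_le_cosh, abs_of_nonneg h1.1, abs_of_pos (by positivity)]; exact h1.2
    have h3 : Real.cosh (2 * s) ≤ 2 * (L / K) := by
      rw [← hs, Real.cosh_two_mul, Real.sinh_sq]; linarith
    have h4 : ‖Complex.cosh w‖ ≤ 2 * (L / K) := ((norm_cosh_le w).trans h2).trans h3
    rw [hψ, norm_mul, norm_pow, Complex.norm_real, Real.norm_of_nonneg hK.le]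
    calc K * ‖Complex.cosh w‖ ^ 2 ≤ K * (2 * (L / K)) ^ 2 := by gcongr
      _ = R := by rw [hR]; field_simp; ring
  have hclos : closure (Complex.HadamardThreeLines.verticalStrip 0 (2 * s)) ⊆
      Complex.HadamardThreeLines.verticalClosedStrip 0 (2 * s) :=
    closure_minimal (preimage_mono Ioo_subset_Icc_self)
      (isClosed_Icc.preimage Complex.continuous_re)
  have hdiff : DiffContOnCl ℂ (J ∘ ψ) (Complex.HadamardThreeLines.verticalStrip 0 (2 * s)) := by
    refine DifferentiableOn.diffContOnCl fun w hw => ?_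
    refine DifferentiableAt.differentiableWithinAt ?_
    refine (hJ (ψ w) (hmem _ (hψR w (hclos hw)))).differentiableAt.comp w ?_
    exact (Complex.differentiable_cosh.pow 2).const_mul _ w
  have key := Complex.HadamardThreeLines.norm_le_interp_of_mem_verticalClosedStrip'
    (f := J ∘ ψ) (z := (s : ℂ)) (a := η) (b := R * (Q * Real.exp (a * R))) (l := 0) (u := 2 * s)
    (by positivity)
    (by constructor <;> simp <;> linarith) hdiff
    (by
      refine ⟨R * (Q * Real.exp (a * R)), ?_⟩
      rintro _ ⟨w, hw, rfl⟩
      exact hJb _ (hψR w hw))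
    (by
      intro w hw
      have hw' : w = (w.im : ℂ) * Complex.I := by
        apply Complex.ext <;> simp
        exact hw
      have h1 : ψ w = ((K * Real.cos w.im ^ 2 : ℝ) : ℂ) := by
        have : Complex.cosh w = Complex.cos w.im := by
          conv_lhs => rw [hw', Complex.cosh_mul_I]
        simp only [hψ, this]
        push_cast
        rfl
      have h2 : K * Real.cos w.im ^ 2 ≤ K := by
        nlinarith [Real.cos_sq_le_one w.im]
      have h3 : 0 ≤ K * Real.cos w.im ^ 2 := by positivity
      rw [Function.comp, h1, hJx _ h3 (by linarith), Complex.norm_real, Real.norm_of_nonneg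
        (intervalIntegral.integral_nonneg h3 fun _ _ => hG0 _)]
      refine le_trans ?_ hη
      exact intervalIntegral.integral_mono_interval le_rfl h3 h2
        (Filter.Eventually.of_forall hG0) (hGc.intervalIntegrable _ _))
    (by
      intro w hw
      refine hJb _ (hψR w ?_)
      have : w.re = 2 * s := hw
      constructor <;> rw [this]
      positivity)
  have h1 : ψ s = ((L : ℝ) : ℂ) := by
    simp only [hψ]
    rw [← Complex.ofReal_cosh, ← Complex.ofReal_pow, ← Complex.ofReal_mul, hs]
    congr 1
    field_simp
  have h2 : (1 : ℝ) - 1 / 2 = 1 / 2 := by norm_num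
  have h3 : (s - 0) / (2 * s - 0) = 1 / 2 := by field_simp; ring
  rw [Function.comp, h1, hJx _ hL.le le_rfl, Complex.norm_real, Real.norm_of_nonneg
    (intervalIntegral.integral_nonneg hL.le fun _ _ => hG0 _), Complex.ofReal_re, h3, h2,
    ← Real.sqrt_eq_rpow, ← Real.sqrt_eq_rpow] at key
  exact key


lemma pow_le_exp_mul_pow_self {x : ℝ} (hx : 0 ≤ x) (m : ℕ) : x ^ m ≤ Real.exp x * (m : ℝ) ^ m := by
  have h1 := Real.pow_div_factorial_le_exp x hx m
  rw [div_le_iff₀ (by positivity)] at h1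
  refine h1.trans ?_
  gcongr
  exact_mod_cast Nat.factorial_le_pow m

set_option maxHeartbeats 1000000 in
/-- A bound for a low-frequency integral `I`, up to a power-law tail, turns into the increasing
stability estimate after choosing the cut-off frequency. -/
lemma exists_const_of_cutoff_bounds {b B D C₁ C₂ : ℝ} (hb : 0 < b) (hB : 1 ≤ B) (hD : 0 < D)
    (hC₁ : 0 ≤ C₁) (hC₂ : 0 ≤ C₂) :
    ∃ C : ℝ, 0 < C ∧ ∀ (n : ℕ) (M K ε X : ℝ) (I : ℝ → ℝ), 1 ≤ n → 1 < M → 1 < K → 0 < ε →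
      ε < Real.exp (-1) →
      (∀ L, 0 < L → X ≤ D * I L + B ^ (2 * n) * M ^ 2 / L ^ (2 * n)) →
      I K ≤ C₁ * ε ^ 2 →
      (∀ L, K < L → I L ≤ √(C₁ * ε ^ 2) *
        √(4 * L ^ 2 / K * (C₂ * M ^ 2 * Real.exp (2 * b * (4 * L ^ 2 / K))))) →
      X ≤ C * (ε ^ 2 +
        M ^ 2 / ((K ^ ((2:ℝ)/3) * |Real.log ε| ^ ((1:ℝ)/4)) / ((6 * n - 3 : ℝ)) ^ 3)
          ^ (2 * n - 1)) := by
  obtain ⟨δ, hδ0, hδ1, hδb⟩ : ∃ δ : ℝ, 0 < δ ∧ δ ≤ 1 ∧ 4 * (b + 1) * δ ≤ 1 / 2 := by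
    refine ⟨1 / (8 * (b + 1)), by positivity, ?_, ?_⟩
    · rw [div_le_one (by positivity)]; linarith
    · apply le_of_eq; field_simp; norm_num
  set A : ℝ := B / δ with hA
  have hA1 : 1 ≤ A := by rw [hA, one_le_div hδ0]; linarith
  have hS : 0 ≤ √(C₁ * C₂) := Real.sqrt_nonneg _
  refine ⟨D * C₁ + D * √(C₁ * C₂) + Real.exp (A ^ 2), by positivity, ?_⟩
  intro n M K ε X I hn hM hK hε hε1 hX hIK hIL
  obtain ⟨m, rfl⟩ : ∃ m, n = m + 1 := ⟨n - 1, by omega⟩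
  set E : ℝ := |Real.log ε| with hE
  have hlog : Real.log ε < -1 := by rwa [Real.log_lt_iff_lt_exp hε]
  have hElog : E = -Real.log ε := by rw [hE, abs_of_neg (by linarith)]
  have hE1 : 1 ≤ E := by linarith
  have hεE : ε = Real.exp (-E) := by rw [hElog, neg_neg, Real.exp_log hε]
  set k : ℝ := K ^ ((1:ℝ)/3) with hk
  set e : ℝ := E ^ ((1:ℝ)/4) with he
  have hk1 : 1 ≤ k := Real.one_le_rpow hK.le (by norm_num)
  have he1 : 1 ≤ e := Real.one_le_rpow hE1 (by norm_num)
  have hk3 : k ^ 3 = K := by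
    rw [hk, ← Real.rpow_natCast, ← Real.rpow_mul (by linarith)]; norm_num
  have he4 : e ^ 4 = E := by
    rw [he, ← Real.rpow_natCast, ← Real.rpow_mul (by linarith)]; norm_num
  have hk2 : K ^ ((2:ℝ)/3) = k ^ 2 := by
    rw [hk, ← Real.rpow_natCast, ← Real.rpow_mul (by linarith)]; norm_num
  rw [hk2]
  set Y : ℝ := k ^ 2 * e with hY
  have hY1 : 1 ≤ Y := one_le_mul_of_one_le_of_one_le (one_le_pow₀ hk1) he1
  have hm : 2 * (m + 1) - 1 = 2 * m + 1 := by omega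
  rw [hm]
  set N : ℝ := 6 * ((m + 1 : ℕ) : ℝ) - 3 with hN
  have hNm : N = 3 * ((2 * m + 1 : ℕ) : ℝ) := by rw [hN]; push_cast; ring
  set p : ℕ := 2 * m + 1 with hp
  have hp1 : (1 : ℝ) ≤ p := by rw [hp]; push_cast; nlinarith [(Nat.cast_nonneg m : (0:ℝ) ≤ m)]
  have hN1 : 1 ≤ N := by rw [hNm]; linarith
  set T : ℝ := M ^ 2 / (Y / N ^ 3) ^ p with hT
  have hY0 : 0 < Y := by linarith
  have hN0 : 0 < N := by linarith
  have hT0 : 0 ≤ T := by positivity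
  have hTeq : T = M ^ 2 * (N ^ 3) ^ p / Y ^ p := by rw [hT, div_pow]; field_simp
  have hNp : ∀ x : ℝ, 0 ≤ x → x ≤ N → x ^ p ≤ (N ^ 3) ^ p := fun x hx hxN => by
    have : x ≤ N ^ 3 := hxN.trans (le_self_pow₀ hN1 (by norm_num))
    gcongr
  have htail : ∀ L, 1 ≤ L → δ * Y ≤ L →
      B ^ (2 * (m + 1)) * M ^ 2 / L ^ (2 * (m + 1)) ≤ Real.exp (A ^ 2) * T := by
    intro L hL1 hL
    have h1 : (δ * Y) ^ p ≤ L ^ (2 * (m + 1)) := by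
      calc (δ * Y) ^ p ≤ L ^ p := by gcongr
        _ ≤ L ^ (2 * (m + 1)) := pow_le_pow_right₀ hL1 (by omega)
    have h2 : B ^ (2 * (m + 1)) ≤ δ ^ p * (Real.exp (A ^ 2) * (N ^ 3) ^ p) := by
      have h3 : B ^ (2 * (m + 1)) = δ ^ (2 * (m + 1)) * A ^ (2 * (m + 1)) := by
        rw [← mul_pow, hA]; congr 1; field_simp
      have h4 : A ^ (2 * (m + 1)) ≤ Real.exp (A ^ 2) * (N ^ 3) ^ p := by
        calc A ^ (2 * (m + 1)) ≤ A ^ (2 * p) := pow_le_pow_right₀ hA1 (by omega)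
          _ = (A ^ 2) ^ p := pow_mul _ _ _
          _ ≤ Real.exp (A ^ 2) * (p : ℝ) ^ p := pow_le_exp_mul_pow_self (by positivity) p
          _ ≤ _ := by
            have := hNp p (by positivity) (by rw [hNm]; linarith)
            gcongr
      rw [h3]
      have h5 : δ ^ (2 * (m + 1)) ≤ δ ^ p := pow_le_pow_of_le_one hδ0.le hδ1 (by omega)
      gcongr
    calc B ^ (2 * (m + 1)) * M ^ 2 / L ^ (2 * (m + 1))
        ≤ δ ^ p * (Real.exp (A ^ 2) * (N ^ 3) ^ p) * M ^ 2 / (δ * Y) ^ p := by gcongr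
      _ = Real.exp (A ^ 2) * T := by rw [hTeq, mul_pow]; field_simp
  rcases le_or_gt (δ * Y) K with hcase | hcase
  · have h1 := hX K (by linarith)
    have h2 := htail K hK.le hcase
    have h3 : D * I K ≤ D * C₁ * ε ^ 2 := by rw [mul_assoc]; gcongr
    have h4 : 0 ≤ (D * √(C₁ * C₂) + Real.exp (A ^ 2)) * ε ^ 2 := by positivity
    have h5 : 0 ≤ (D * C₁ + D * √(C₁ * C₂)) * T := by positivity
    linarith
  · set L : ℝ := δ * Y with hL
    have h1 := hX L (by linarith)
    have h2 := htail L (by linarith) le_rfl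
    have hk0 : 0 < k := by linarith
    have hke : k ≤ δ * e := by
      have : k ^ 2 * k ≤ k ^ 2 * (δ * e) := by rw [← pow_succ, hk3]; nlinarith
      exact le_of_mul_le_mul_left this (by positivity)
    have hR : 4 * L ^ 2 / K = 4 * δ ^ 2 * k * e ^ 2 := by
      rw [hL, hY, ← hk3]; field_simp
    set R : ℝ := 4 * L ^ 2 / K with hRdef
    have hR0 : 0 ≤ R := by rw [hR]; positivity
    have hbR : (b + 1) * R ≤ E / 2 := by
      have h3 : R ≤ 4 * δ * E := by
        have hδ2 : δ ^ 2 ≤ 1 := pow_le_one₀ hδ0.le hδ1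
        calc R ≤ 4 * δ ^ 2 * (δ * e) * e ^ 2 := by rw [hR]; gcongr
          _ = 4 * δ * (δ ^ 2 * e ^ 3) := by ring
          _ ≤ 4 * δ * (1 * e ^ 4) := by
            gcongr
            norm_num
          _ = 4 * δ * E := by rw [he4]; ring
      calc (b + 1) * R ≤ (b + 1) * (4 * δ * E) := by gcongr
        _ = 4 * (b + 1) * δ * E := by ring
        _ ≤ 1 / 2 * E := by gcongr
        _ = E / 2 := by ring
    have hlow : I L ≤ √(C₁ * C₂) * M ^ 2 * Real.exp (-(E / 2)) := by
      refine (hIL L hcase).trans ?_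
      rw [← Real.sqrt_mul (by positivity)]
      have h3 : C₁ * ε ^ 2 * (R * (C₂ * M ^ 2 * Real.exp (2 * b * R))) ≤
          (C₁ * C₂) * (M * (ε * Real.exp ((b + 1) * R))) ^ 2 := by
        have h4 : R ≤ Real.exp (2 * R) := by linarith [Real.add_one_le_exp (2 * R)]
        calc C₁ * ε ^ 2 * (R * (C₂ * M ^ 2 * Real.exp (2 * b * R)))
            ≤ C₁ * ε ^ 2 * (Real.exp (2 * R) * (C₂ * M ^ 2 * Real.exp (2 * b * R))) := by gcongr
          _ = (C₁ * C₂) * (M * ε) ^ 2 * (Real.exp (2 * R) * Real.exp (2 * b * R)) := by ring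
          _ = (C₁ * C₂) * (M * (ε * Real.exp ((b + 1) * R))) ^ 2 := by
            rw [← Real.exp_add, mul_pow, mul_pow, mul_pow, ← Real.exp_nat_mul ((b + 1) * R)]
            ring_nf
      refine (Real.sqrt_le_sqrt h3).trans ?_
      rw [Real.sqrt_mul (by positivity), Real.sqrt_sq (by positivity), mul_assoc]
      have h5 : ε * Real.exp ((b + 1) * R) ≤ Real.exp (-(E / 2)) := by
        rw [hεE, ← Real.exp_add, Real.exp_le_exp]; linarith
      have h6 : M ≤ M ^ 2 := le_self_pow₀ hM.le (by norm_num)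
      gcongr
    have hYE : Y ≤ E := by
      have h3 : k ≤ e := hke.trans (by nlinarith)
      calc Y ≤ e ^ 2 * e := by rw [hY]; gcongr
        _ = e ^ 3 := by ring
        _ ≤ e ^ 4 := pow_le_pow_right₀ he1 (by norm_num)
        _ = E := he4
    have hexp : M ^ 2 * Real.exp (-(E / 2)) ≤ T := by
      rw [hTeq, le_div_iff₀ (by positivity), mul_assoc]
      gcongr
      calc Real.exp (-(E / 2)) * Y ^ p ≤ Real.exp (-(E / 2)) * E ^ p := by gcongr
        _ = Real.exp (-(E / 2)) * (2 ^ p * (E / 2) ^ p) := by rw [← mul_pow]; ring_nf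
        _ ≤ Real.exp (-(E / 2)) * (2 ^ p * (Real.exp (E / 2) * (p : ℝ) ^ p)) := by
          have := pow_le_exp_mul_pow_self (x := E / 2) (by positivity) p
          gcongr
        _ = (Real.exp (-(E / 2)) * Real.exp (E / 2)) * (2 * (p : ℝ)) ^ p := by
          rw [mul_pow]; ring
        _ = (2 * (p : ℝ)) ^ p := by rw [← Real.exp_add, neg_add_cancel, Real.exp_zero, one_mul]
        _ ≤ (N ^ 3) ^ p := hNp _ (by positivity) (by rw [hNm]; linarith)
    have h3 : D * I L ≤ D * √(C₁ * C₂) * T := by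
      rw [mul_assoc]
      gcongr
      refine hlow.trans ?_
      rw [mul_assoc]
      gcongr
    have h4 : 0 ≤ (D * C₁ + D * √(C₁ * C₂) + Real.exp (A ^ 2)) * ε ^ 2 := by positivity
    have h5 : 0 ≤ D * C₁ * T := by positivity
    linarith

lemma sq_integral_mul_le {f g : ℝ → ℝ} (hf : Continuous f) (hg : Continuous g) {a b : ℝ}
    (hab : a ≤ b) :
    (∫ x in a..b, f x * g x) ^ 2 ≤ (∫ x in a..b, f x ^ 2) * ∫ x in a..b, g x ^ 2 := by
  have h : ∀ t : ℝ, 0 ≤ (∫ x in a..b, f x ^ 2) * (t * t) + (2 * ∫ x in a..b, f x * g x) * t +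
      ∫ x in a..b, g x ^ 2 := by
    intro t
    have : ∫ x in a..b, (t * f x + g x) ^ 2 = (∫ x in a..b, f x ^ 2) * (t * t) +
        (2 * ∫ x in a..b, f x * g x) * t + ∫ x in a..b, g x ^ 2 := by
      rw [← intervalIntegral.integral_mul_const, ← intervalIntegral.integral_const_mul,
        ← intervalIntegral.integral_mul_const, ← intervalIntegral.integral_add,
        ← intervalIntegral.integral_add]
      · congr 1; ext x; ring
      all_goals exact Continuous.intervalIntegrable (by fun_prop) _ _
    rw [← this]
    exact intervalIntegral.integral_nonneg hab fun _ _ => sq_nonneg _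
  have := discrim_le_zero h
  rw [discrim] at this
  linarith

lemma sq_integral_sq_norm_deriv_le {u u' u'' : ℝ → ℂ} (hu : ∀ x, HasDerivAt u (u' x) x)
    (hu' : ∀ x, HasDerivAt u' (u'' x) x) (hc : Continuous u'') {a b : ℝ} (hab : a ≤ b)
    (ha : u a = 0) (hb : u b = 0) :
    (∫ x in a..b, ‖u' x‖ ^ 2) ^ 2 ≤ (∫ x in a..b, ‖u x‖ ^ 2) * ∫ x in a..b, ‖u'' x‖ ^ 2 := by
  have hcu : Continuous u := continuous_iff_continuousAt.2 fun x => (hu x).continuousAt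
  have hcu' : Continuous u' := continuous_iff_continuousAt.2 fun x => (hu' x).continuousAt
  have h1 : ((∫ x in a..b, ‖u' x‖ ^ 2 : ℝ) : ℂ) = -∫ x in a..b, starRingEnd ℂ (u x) * u'' x := by
    rw [intervalIntegral.integral_mul_deriv_eq_deriv_mul (u := fun x => starRingEnd ℂ (u x))
      (u' := fun x => starRingEnd ℂ (u' x)) (v := u')
      (fun x _ => (hu x).star) (fun x _ => hu' x)
      ((Complex.continuous_conj.comp hcu').intervalIntegrable _ _) (hc.intervalIntegrable _ _),
      ha, hb, ← intervalIntegral.integral_ofReal]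
    simp [Complex.conj_mul']
  have h2 : ∫ x in a..b, ‖u' x‖ ^ 2 ≤ ∫ x in a..b, ‖u x‖ * ‖u'' x‖ := by
    calc ∫ x in a..b, ‖u' x‖ ^ 2 ≤ ‖((∫ x in a..b, ‖u' x‖ ^ 2 : ℝ) : ℂ)‖ := by
          rw [Complex.norm_real]; exact Real.le_norm_self _
      _ ≤ _ := by
          rw [h1, norm_neg]
          refine (intervalIntegral.norm_integral_le_integral_norm hab).trans_eq ?_
          simp
  calc _ ≤ (∫ x in a..b, ‖u x‖ * ‖u'' x‖) ^ 2 := by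
        have : 0 ≤ ∫ x in a..b, ‖u' x‖ ^ 2 :=
          intervalIntegral.integral_nonneg hab fun _ _ => by positivity
        gcongr
    _ ≤ _ := sq_integral_mul_le hcu.norm hc.norm hab

lemma pow_le_of_log_convex {X : ℕ → ℝ} (h0 : ∀ k, 0 ≤ X k) (n : ℕ)
    (h : ∀ k, k + 2 ≤ n + 1 → X (k + 1) ^ 2 ≤ X k * X (k + 2)) :
    X 1 ^ (n + 1) ≤ X 0 ^ n * X (n + 1) := by
  have h1 : ∀ k, k ≤ n → X 1 * X k ≤ X 0 * X (k + 1) := by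
    intro k
    induction k with
    | zero => intro _; rw [zero_add, mul_comm]
    | succ k ih =>
      intro hk
      have h2 := h k (by omega)
      rcases (h0 k).eq_or_lt with h3 | h3
      · have : X (k + 1) = 0 := by
          rw [← h3, zero_mul] at h2
          exact pow_eq_zero_iff two_ne_zero |>.1 (le_antisymm h2 (sq_nonneg _))
        rw [this, mul_zero]
        exact mul_nonneg (h0 _) (h0 _)
      · refine le_of_mul_le_mul_left ?_ h3
        calc X k * (X 1 * X (k + 1)) = (X 1 * X k) * X (k + 1) := by ring
          _ ≤ (X 0 * X (k + 1)) * X (k + 1) :=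
            mul_le_mul_of_nonneg_right (ih (by omega)) (h0 _)
          _ = X 0 * X (k + 1) ^ 2 := by ring
          _ ≤ X 0 * (X k * X (k + 2)) := mul_le_mul_of_nonneg_left h2 (h0 _)
          _ = X k * (X 0 * X (k + 1 + 1)) := by ring
  suffices ∀ k, k ≤ n → X 1 ^ (k + 1) ≤ X 0 ^ k * X (k + 1) from this n le_rfl
  intro k
  induction k with
  | zero => intro _; simp
  | succ k ih =>
    intro hk
    calc X 1 ^ (k + 1 + 1) = X 1 ^ (k + 1) * X 1 := pow_succ _ _
      _ ≤ X 0 ^ k * X (k + 1) * X 1 := mul_le_mul_of_nonneg_right (ih (by omega)) (h0 _)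
      _ = X 0 ^ k * (X 1 * X (k + 1)) := by ring
      _ ≤ X 0 ^ k * (X 0 * X (k + 1 + 1)) :=
        mul_le_mul_of_nonneg_left (h1 _ hk) (pow_nonneg (h0 _) _)
      _ = X 0 ^ (k + 1) * X (k + 1 + 1) := by ring

lemma iteratedDeriv_eq_zero_of_notMem_tsupport {f : ℝ → ℂ} {x : ℝ} (hx : x ∉ tsupport f) (k : ℕ) :
    iteratedDeriv k f x = 0 := by
  have h : f =ᶠ[nhds x] fun _ => 0 := by
    filter_upwards [(isClosed_tsupport f).isOpen_compl.mem_nhds hx] with y hy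
    exact image_eq_zero_of_notMem_tsupport hy
  rw [h.iteratedDeriv_eq]
  simp

/-- Interpolation between `L²` and `Hⁿ` for compactly supported functions. -/
lemma integral_sq_norm_deriv_pow_le {f : ℝ → ℂ} {n : ℕ} {a b : ℝ} (hab : a ≤ b)
    (hf : ContDiff ℝ (n + 1 : ℕ) f) (hs : tsupport f ⊆ Ioo a b) :
    (∫ y in a..b, ‖deriv f y‖ ^ 2) ^ (n + 1) ≤
      (∫ y in a..b, ‖f y‖ ^ 2) ^ n * ∫ y in a..b, ‖iteratedDeriv (n + 1) f y‖ ^ 2 := by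
  have h := pow_le_of_log_convex (X := fun k => ∫ y in a..b, ‖iteratedDeriv k f y‖ ^ 2)
    (fun k => intervalIntegral.integral_nonneg hab fun _ _ => by positivity) n ?_
  · simpa [iteratedDeriv_one, iteratedDeriv_zero] using h
  intro k hk
  have hd : ∀ j, j < n + 1 → ∀ x,
      HasDerivAt (iteratedDeriv j f) (iteratedDeriv (j + 1) f x) x := by
    intro j hj x
    rw [iteratedDeriv_succ]
    exact (hf.differentiable_iteratedDeriv j (by exact_mod_cast hj) x).hasDerivAt
  exact sq_integral_sq_norm_deriv_le (hd k (by omega)) (hd (k + 1) (by omega))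
    (hf.continuous_iteratedDeriv _ (by exact_mod_cast hk)) hab
    (iteratedDeriv_eq_zero_of_notMem_tsupport (fun h => by simpa using hs h) k)
    (iteratedDeriv_eq_zero_of_notMem_tsupport (fun h => by simpa using hs h) k)

lemma sq_norm_le_sqrt_integral {f f' : ℝ → ℂ} (hf : ∀ x, HasDerivAt f (f' x) x)
    (hf' : Continuous f') {a b x : ℝ} (hax : a ≤ x) (hxb : x ≤ b) (ha : f a = 0) :
    ‖f x‖ ^ 2 ≤ 2 * √((∫ y in a..b, ‖f y‖ ^ 2) * ∫ y in a..b, ‖f' y‖ ^ 2) := by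
  have hc : Continuous f := continuous_iff_continuousAt.2 fun x => (hf x).continuousAt
  have h1 : ((‖f x‖ ^ 2 : ℝ) : ℂ) =
      ∫ y in a..x, (starRingEnd ℂ (f' y) * f y + starRingEnd ℂ (f y) * f' y) := by
    rw [intervalIntegral.integral_deriv_mul_eq_sub (u := fun x => starRingEnd ℂ (f x))
      (u' := fun x => starRingEnd ℂ (f' x)) (v := f)
      (fun x _ => (hf x).star) (fun x _ => hf x)
      ((Complex.continuous_conj.comp hf').intervalIntegrable _ _) (hf'.intervalIntegrable _ _), ha]
    simp [Complex.conj_mul']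
  have h2 : ‖f x‖ ^ 2 ≤ ∫ y in a..x, 2 * (‖f y‖ * ‖f' y‖) := by
    calc ‖f x‖ ^ 2 ≤ ‖((‖f x‖ ^ 2 : ℝ) : ℂ)‖ := by
          rw [Complex.norm_real]; exact Real.le_norm_self _
      _ ≤ _ := by
          rw [h1]
          refine intervalIntegral.norm_integral_le_of_norm_le hax
            (Filter.Eventually.of_forall fun y _ => ?_)
            (Continuous.intervalIntegrable (by fun_prop) _ _)
          refine (norm_add_le _ _).trans_eq ?_
          simp only [norm_mul, RCLike.norm_conj]
          ring
  have h3 : ∫ y in a..x, 2 * (‖f y‖ * ‖f' y‖) ≤ ∫ y in a..b, 2 * (‖f y‖ * ‖f' y‖) :=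
    intervalIntegral.integral_mono_interval le_rfl hax hxb
      (Filter.Eventually.of_forall fun _ => by positivity)
      (Continuous.intervalIntegrable (by fun_prop) _ _)
  refine h2.trans (h3.trans ?_)
  rw [intervalIntegral.integral_const_mul]
  gcongr
  exact Real.le_sqrt_of_sq_le (sq_integral_mul_le hc.norm hf'.norm (hax.trans hxb))

lemma le_add_of_tail_bound {X₀ X₁ I D L M : ℝ} {n : ℕ} (hX₀ : 0 ≤ X₀) (hX₁ : 0 ≤ X₁)
    (hI : 0 ≤ I) (hL : 0 < L) (hD : 1 ≤ D)
    (h : X₀ ≤ D * (I + X₁ / L ^ 2 + √(X₀ * X₁) / L))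
    (hn : X₁ ^ (n + 1) ≤ X₀ ^ n * M ^ 2) :
    X₀ ≤ 2 * D * I + (4 * D) ^ (2 * (n + 1)) * M ^ 2 / L ^ (2 * (n + 1)) := by
  have hD0 : 0 < D := by linarith
  rcases le_or_gt (X₁ / L ^ 2) (X₀ / (4 * D) ^ 2) with hc | hc
  · have h1 : X₁ / L ^ 2 ≤ X₀ / (4 * D) := hc.trans (by
      gcongr
      exact le_self_pow₀ (by linarith) two_ne_zero)
    have h2 : √(X₀ * X₁) / L ≤ X₀ / (4 * D) := by
      rw [← Real.sqrt_sq hL.le, ← Real.sqrt_div (by positivity)]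
      refine Real.sqrt_le_iff.2 ⟨by positivity, ?_⟩
      calc X₀ * X₁ / L ^ 2 = X₀ * (X₁ / L ^ 2) := by ring
        _ ≤ X₀ * (X₀ / (4 * D) ^ 2) := by gcongr
        _ = (X₀ / (4 * D)) ^ 2 := by rw [div_pow]; ring
    have h3 : D * (X₀ / (4 * D)) = X₀ / 4 := by field_simp
    have h4 : D * (I + X₁ / L ^ 2 + √(X₀ * X₁) / L) ≤
        D * (I + X₀ / (4 * D) + X₀ / (4 * D)) := by gcongr
    have h5 : 0 ≤ (4 * D) ^ (2 * (n + 1)) * M ^ 2 / L ^ (2 * (n + 1)) := by positivity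
    linarith
  · suffices X₀ ≤ (4 * D) ^ (2 * (n + 1)) * M ^ 2 / L ^ (2 * (n + 1)) by
      have : 0 ≤ 2 * D * I := by positivity
      linarith
    rcases hX₀.eq_or_lt with h0 | h0
    · rw [← h0]; positivity
    · have h1 : X₀ ≤ (4 * D) ^ 2 * (X₁ / L ^ 2) := by
        rw [div_lt_iff₀ (by positivity)] at hc; linarith
      have h2 : X₀ ^ n * X₀ ≤
          X₀ ^ n * ((4 * D) ^ (2 * (n + 1)) * M ^ 2 / L ^ (2 * (n + 1))) := by
        calc X₀ ^ n * X₀ = X₀ ^ (n + 1) := (pow_succ _ _).symm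
          _ ≤ ((4 * D) ^ 2 * (X₁ / L ^ 2)) ^ (n + 1) := by gcongr
          _ = (4 * D) ^ (2 * (n + 1)) / L ^ (2 * (n + 1)) * X₁ ^ (n + 1) := by
            rw [mul_pow, div_pow, ← pow_mul, ← pow_mul]; ring
          _ ≤ (4 * D) ^ (2 * (n + 1)) / L ^ (2 * (n + 1)) * (X₀ ^ n * M ^ 2) := by gcongr
          _ = _ := by ring
      exact le_of_mul_le_mul_left h2 (by positivity)

lemma integral_comp_div_eq {E : Type*} [NormedAddCommGroup E] [NormedSpace ℝ E] {φ : ℝ → E}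
    (hφ : Continuous φ) (h1 : ∀ y, 1 ≤ y → φ y = 0) {b c : ℝ} (hc : 0 < c) (hcb : c ≤ b) :
    ∫ τ in (0 : ℝ)..b, φ (τ / c) = c • ∫ y in (0 : ℝ)..1, φ y := by
  rw [intervalIntegral.integral_comp_div _ hc.ne', zero_div,
    ← intervalIntegral.integral_add_adjacent_intervals (b := 1) (hφ.intervalIntegrable _ _)
      (hφ.intervalIntegrable _ _)]
  have h2 : ∫ y in (1 : ℝ)..b / c, φ y = 0 := by
    refine intervalIntegral.integral_zero_ae (Filter.Eventually.of_forall fun y hy => h1 y ?_)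
    rw [uIoc_of_le (by rwa [one_le_div hc])] at hy
    exact hy.1.le
  rw [h2, add_zero]

lemma integral_comp_neg_div_eq {E : Type*} [NormedAddCommGroup E] [NormedSpace ℝ E] {φ : ℝ → E}
    (hφ : Continuous φ) (h1 : ∀ y, y ≤ -1 → φ y = 0) {b c : ℝ} (hc : 0 < c) (hcb : c ≤ b) :
    ∫ τ in (0 : ℝ)..b, φ (-τ / c) = c • ∫ y in (-1 : ℝ)..0, φ y := by
  have := integral_comp_div_eq (φ := fun y => φ (-y)) (hφ.comp continuous_neg)
    (fun y hy => h1 _ (by linarith)) hc hcb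
  simp only [neg_div]
  rw [this, intervalIntegral.integral_comp_neg, neg_zero]

/-- Folding a function on the line along the travel time from the interface. -/
noncomputable def fold (c₁ c₂ p q : ℝ) (f : ℝ → ℂ) (τ : ℝ) : ℂ :=
  p * f (τ / c₁) + q * f (-τ / c₂)

section fold

variable {c₁ c₂ b : ℝ} {f f' : ℝ → ℂ}

lemma continuous_fold (p q : ℝ) (hf : Continuous f) : Continuous (fold c₁ c₂ p q f) := by
  unfold fold
  fun_prop

lemma hasDerivAt_fold (p q : ℝ) (hf : ∀ x, HasDerivAt f (f' x) x) (τ : ℝ) :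
    HasDerivAt (fold c₁ c₂ p q f) (fold c₁ c₂ (p / c₁) (-q / c₂) f' τ) τ := by
  have h1 : HasDerivAt (fun τ : ℝ => τ / c₁) (1 / c₁) τ := (hasDerivAt_id τ).div_const c₁
  have h2 : HasDerivAt (fun τ : ℝ => -τ / c₂) (-1 / c₂) τ := (hasDerivAt_neg τ).div_const c₂
  have h3 := (((hf (τ / c₁)).scomp τ h1).const_mul (p : ℂ)).add
    (((hf (-τ / c₂)).scomp τ h2).const_mul (q : ℂ))
  refine HasDerivAt.congr_deriv h3 ?_
  simp only [fold, Complex.real_smul]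
  push_cast
  ring

lemma fold_eq_zero (p q : ℝ) (hf : ∀ y, 1 ≤ |y| → f y = 0) (hc₁ : 0 < c₁) (hc₂ : 0 < c₂)
    (h₁ : c₁ ≤ b) (h₂ : c₂ ≤ b) : fold c₁ c₂ p q f b = 0 := by
  have hb : 0 ≤ b := by linarith
  rw [fold, hf, hf, mul_zero, mul_zero, add_zero]
  · rwa [neg_div, abs_neg, abs_of_nonneg (by positivity), one_le_div hc₂]
  · rwa [abs_of_nonneg (by positivity), one_le_div hc₁]

lemma integral_fold_mul (p q : ℝ) (hfc : Continuous f) (hf : ∀ y, 1 ≤ |y| → f y = 0)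
    (hc₁ : 0 < c₁) (hc₂ : 0 < c₂) (h₁ : c₁ ≤ b) (h₂ : c₂ ≤ b) {g : ℂ → ℂ} (hg : Continuous g)
    (z : ℂ) :
    ∫ τ in (0 : ℝ)..b, fold c₁ c₂ p q f τ * g (z * τ) =
      p * c₁ * (∫ y in (0 : ℝ)..1, f y * g (z * (c₁ * y))) +
        q * c₂ * ∫ y in (-1 : ℝ)..0, f y * g (-(z * (c₂ * y))) := by
  have e₁ := integral_comp_div_eq (φ := fun y : ℝ => f y * g (z * (c₁ * y))) (by fun_prop)
    (fun y hy => by rw [hf y (hy.trans (le_abs_self y)), zero_mul]) hc₁ h₁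
  have e₂ := integral_comp_neg_div_eq (φ := fun y : ℝ => f y * g (-(z * (c₂ * y)))) (by fun_prop)
    (fun y hy => by rw [hf y ((le_neg_of_le_neg hy).trans (neg_le_abs y)), zero_mul]) hc₂ h₂
  rw [Complex.real_smul] at e₁ e₂
  rw [mul_assoc, mul_assoc, ← e₁, ← e₂, ← intervalIntegral.integral_const_mul,
    ← intervalIntegral.integral_const_mul, ← intervalIntegral.integral_add]
  · congr 1
    ext τ
    have hc₁' : (c₁ : ℂ) ≠ 0 := by exact_mod_cast hc₁.ne'
    have hc₂' : (c₂ : ℂ) ≠ 0 := by exact_mod_cast hc₂.ne'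
    have a₁ : z * (c₁ * ((τ / c₁ : ℝ) : ℂ)) = z * τ := by push_cast; field_simp
    have a₂ : -(z * (c₂ * ((-τ / c₂ : ℝ) : ℂ))) = z * τ := by push_cast; field_simp
    rw [a₁, a₂, fold]
    ring
  all_goals exact Continuous.intervalIntegrable (by fun_prop) _ _

lemma integral_sq_norm_split (hfc : Continuous f) :
    ∫ y in (-1 : ℝ)..1, ‖f y‖ ^ 2 =
      (∫ y in (0 : ℝ)..1, ‖f y‖ ^ 2) + ∫ y in (-1 : ℝ)..0, ‖f y‖ ^ 2 := by
  rw [add_comm]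
  exact (intervalIntegral.integral_add_adjacent_intervals
    (Continuous.intervalIntegrable (by fun_prop) _ _)
    (Continuous.intervalIntegrable (by fun_prop) _ _)).symm

lemma integral_sq_norm_comp_div (hfc : Continuous f) (hf : ∀ y, 1 ≤ |y| → f y = 0)
    (hc₁ : 0 < c₁) (hc₂ : 0 < c₂) (h₁ : c₁ ≤ b) (h₂ : c₂ ≤ b) :
    (∫ τ in (0 : ℝ)..b, ‖f (τ / c₁)‖ ^ 2) = c₁ * (∫ y in (0 : ℝ)..1, ‖f y‖ ^ 2) ∧
      (∫ τ in (0 : ℝ)..b, ‖f (-τ / c₂)‖ ^ 2) = c₂ * ∫ y in (-1 : ℝ)..0, ‖f y‖ ^ 2 := by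
  constructor
  · exact integral_comp_div_eq (φ := fun y : ℝ => ‖f y‖ ^ 2) (by fun_prop)
      (fun y hy => by simp [hf y (hy.trans (le_abs_self y))]) hc₁ h₁
  · exact integral_comp_neg_div_eq (φ := fun y : ℝ => ‖f y‖ ^ 2) (by fun_prop)
      (fun y hy => by simp [hf y ((le_neg_of_le_neg hy).trans (neg_le_abs y))]) hc₂ h₂

lemma sq_norm_add_le (z w : ℂ) : ‖z + w‖ ^ 2 ≤ 2 * (‖z‖ ^ 2 + ‖w‖ ^ 2) := by
  have h : ‖z + w‖ ^ 2 ≤ (‖z‖ + ‖w‖) ^ 2 := by gcongr; exact norm_add_le z w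
  nlinarith [sq_nonneg (‖z‖ - ‖w‖)]

lemma integral_sq_norm_fold_le (p q : ℝ) (hfc : Continuous f) (hf : ∀ y, 1 ≤ |y| → f y = 0)
    (hc₁ : 0 < c₁) (hc₂ : 0 < c₂) (h₁ : c₁ ≤ b) (h₂ : c₂ ≤ b) :
    ∫ τ in (0 : ℝ)..b, ‖fold c₁ c₂ p q f τ‖ ^ 2 ≤
      2 * (p ^ 2 * c₁ + q ^ 2 * c₂) * ∫ y in (-1 : ℝ)..1, ‖f y‖ ^ 2 := by
  obtain ⟨e₁, e₂⟩ := integral_sq_norm_comp_div hfc hf hc₁ hc₂ h₁ h₂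
  have hF := continuous_fold (c₁ := c₁) (c₂ := c₂) p q hfc
  calc ∫ τ in (0 : ℝ)..b, ‖fold c₁ c₂ p q f τ‖ ^ 2
      ≤ ∫ τ in (0 : ℝ)..b, (2 * p ^ 2 * ‖f (τ / c₁)‖ ^ 2 + 2 * q ^ 2 * ‖f (-τ / c₂)‖ ^ 2) := by
        refine intervalIntegral.integral_mono_on (by linarith)
          (Continuous.intervalIntegrable (by fun_prop) _ _)
          (Continuous.intervalIntegrable (by fun_prop) _ _) fun τ _ => ?_
        refine (sq_norm_add_le _ _).trans_eq ?_
        rw [norm_mul, norm_mul, Complex.norm_real, Complex.norm_real, mul_pow, mul_pow,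
          Real.norm_eq_abs, Real.norm_eq_abs, sq_abs, sq_abs]
        ring
    _ = 2 * (p ^ 2 * c₁) * (∫ y in (0 : ℝ)..1, ‖f y‖ ^ 2) +
          2 * (q ^ 2 * c₂) * ∫ y in (-1 : ℝ)..0, ‖f y‖ ^ 2 := by
        rw [intervalIntegral.integral_add, intervalIntegral.integral_const_mul,
          intervalIntegral.integral_const_mul, e₁, e₂]
        · ring
        all_goals exact Continuous.intervalIntegrable (by fun_prop) _ _
    _ ≤ _ := by
        rw [integral_sq_norm_split hfc]
        have i₁ : 0 ≤ ∫ y in (0 : ℝ)..1, ‖f y‖ ^ 2 :=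
          intervalIntegral.integral_nonneg (by norm_num) fun _ _ => by positivity
        have i₂ : 0 ≤ ∫ y in (-1 : ℝ)..0, ‖f y‖ ^ 2 :=
          intervalIntegral.integral_nonneg (by norm_num) fun _ _ => by positivity
        have j₁ : 0 ≤ p ^ 2 * c₁ * ∫ y in (-1 : ℝ)..0, ‖f y‖ ^ 2 := by positivity
        have j₂ : 0 ≤ q ^ 2 * c₂ * ∫ y in (0 : ℝ)..1, ‖f y‖ ^ 2 := by positivity
        linarith

/-- The folding of a source whose cosine transform is determined by the boundary data. -/
noncomputable def evenFold (c₁ c₂ : ℝ) : (ℝ → ℂ) → ℝ → ℂ := fold c₁ c₂ (1 / c₁) (1 / c₂)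

/-- The folding of a source whose sine transform is determined by the boundary data. -/
noncomputable def oddFold (c₁ c₂ : ℝ) : (ℝ → ℂ) → ℝ → ℂ :=
  fold c₁ c₂ (1 / c₁ ^ 2) (-(1 / c₂ ^ 2))

lemma integral_sq_norm_le_fold (hfc : Continuous f) (hf : ∀ y, 1 ≤ |y| → f y = 0)
    (hc₁ : 0 < c₁) (hc₂ : 0 < c₂) (h₁ : c₁ ≤ b) (h₂ : c₂ ≤ b) :
    ∫ y in (-1 : ℝ)..1, ‖f y‖ ^ 2 ≤
      2 * (c₁ + c₂) * (∫ τ in (0 : ℝ)..b, ‖evenFold c₁ c₂ f τ‖ ^ 2) +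
        2 * (c₁ * c₂ * (c₁ + c₂)) * ∫ τ in (0 : ℝ)..b, ‖oddFold c₁ c₂ f τ‖ ^ 2 := by
  obtain ⟨e₁, e₂⟩ := integral_sq_norm_comp_div hfc hf hc₁ hc₂ h₁ h₂
  have hE : Continuous (evenFold c₁ c₂ f) := continuous_fold _ _ hfc
  have hO : Continuous (oddFold c₁ c₂ f) := continuous_fold _ _ hfc
  have hc₁' : (c₁ : ℂ) ≠ 0 := by exact_mod_cast hc₁.ne'
  have hc₂' : (c₂ : ℂ) ≠ 0 := by exact_mod_cast hc₂.ne'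
  have hs : (c₁ : ℂ) + c₂ ≠ 0 := by exact_mod_cast (by positivity : c₁ + c₂ ≠ 0)
  have k₁ : ∀ τ, f (τ / c₁) = ((c₁ ^ 2 / (c₁ + c₂) : ℝ) : ℂ) * evenFold c₁ c₂ f τ +
      ((c₁ ^ 2 * c₂ / (c₁ + c₂) : ℝ) : ℂ) * oddFold c₁ c₂ f τ := fun τ => by
    simp only [evenFold, oddFold, fold]
    push_cast
    field_simp
    ring
  have k₂ : ∀ τ, f (-τ / c₂) = ((c₂ ^ 2 / (c₁ + c₂) : ℝ) : ℂ) * evenFold c₁ c₂ f τ +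
      ((-(c₂ ^ 2 * c₁ / (c₁ + c₂)) : ℝ) : ℂ) * oddFold c₁ c₂ f τ := fun τ => by
    simp only [evenFold, oddFold, fold]
    push_cast
    field_simp
    ring
  have key : ∀ τ, ‖f (τ / c₁)‖ ^ 2 / c₁ + ‖f (-τ / c₂)‖ ^ 2 / c₂ ≤
      2 * (c₁ + c₂) * ‖evenFold c₁ c₂ f τ‖ ^ 2 +
        2 * (c₁ * c₂ * (c₁ + c₂)) * ‖oddFold c₁ c₂ f τ‖ ^ 2 := fun τ => by
    have m₁ := sq_norm_add_le (((c₁ ^ 2 / (c₁ + c₂) : ℝ) : ℂ) * evenFold c₁ c₂ f τ)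
      (((c₁ ^ 2 * c₂ / (c₁ + c₂) : ℝ) : ℂ) * oddFold c₁ c₂ f τ)
    have m₂ := sq_norm_add_le (((c₂ ^ 2 / (c₁ + c₂) : ℝ) : ℂ) * evenFold c₁ c₂ f τ)
      (((-(c₂ ^ 2 * c₁ / (c₁ + c₂)) : ℝ) : ℂ) * oddFold c₁ c₂ f τ)
    rw [← k₁, norm_mul, norm_mul, Complex.norm_real, Complex.norm_real, mul_pow, mul_pow,
      Real.norm_eq_abs, Real.norm_eq_abs, sq_abs, sq_abs] at m₁
    rw [← k₂, norm_mul, norm_mul, Complex.norm_real, Complex.norm_real, mul_pow, mul_pow,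
      Real.norm_eq_abs, Real.norm_eq_abs, sq_abs, sq_abs] at m₂
    set x := ‖evenFold c₁ c₂ f τ‖ ^ 2
    set y := ‖oddFold c₁ c₂ f τ‖ ^ 2
    have hx : 0 ≤ x := by positivity
    have hy : 0 ≤ y := by positivity
    calc _ ≤ 2 * ((c₁ ^ 2 / (c₁ + c₂)) ^ 2 * x + (c₁ ^ 2 * c₂ / (c₁ + c₂)) ^ 2 * y) / c₁ +
          2 * ((c₂ ^ 2 / (c₁ + c₂)) ^ 2 * x + (-(c₂ ^ 2 * c₁ / (c₁ + c₂))) ^ 2 * y) / c₂ := by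
          gcongr
      _ = 2 * ((c₁ ^ 3 + c₂ ^ 3) / (c₁ + c₂) ^ 2) * x +
          2 * (c₁ ^ 2 * c₂ ^ 2 / (c₁ + c₂)) * y := by
          field_simp
          ring
      _ ≤ _ := by
          gcongr
          · rw [div_le_iff₀ (by positivity), ← pow_succ']
            have : 0 ≤ 3 * c₁ * c₂ * (c₁ + c₂) := by positivity
            linear_combination this
          · rw [div_le_iff₀ (by positivity)]
            have := mul_pos hc₁ hc₂
            nlinarith [mul_pos this this, mul_pos this (mul_pos hc₁ hc₁), mul_pos this (mul_pos hc₂ hc₂)]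
  calc ∫ y in (-1 : ℝ)..1, ‖f y‖ ^ 2
      = ∫ τ in (0 : ℝ)..b, (‖f (τ / c₁)‖ ^ 2 / c₁ + ‖f (-τ / c₂)‖ ^ 2 / c₂) := by
        rw [intervalIntegral.integral_add, intervalIntegral.integral_div,
          intervalIntegral.integral_div, e₁, e₂, integral_sq_norm_split hfc]
        · field_simp
        all_goals exact Continuous.intervalIntegrable (by fun_prop) _ _
    _ ≤ ∫ τ in (0 : ℝ)..b, (2 * (c₁ + c₂) * ‖evenFold c₁ c₂ f τ‖ ^ 2 +
        2 * (c₁ * c₂ * (c₁ + c₂)) * ‖oddFold c₁ c₂ f τ‖ ^ 2) :=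
        intervalIntegral.integral_mono_on (by linarith)
          (Continuous.intervalIntegrable (by fun_prop) _ _)
          (Continuous.intervalIntegrable (by fun_prop) _ _) fun τ _ => key τ
    _ = _ := by
        rw [intervalIntegral.integral_add, intervalIntegral.integral_const_mul,
          intervalIntegral.integral_const_mul]
        all_goals exact Continuous.intervalIntegrable (by fun_prop) _ _

end fold

section waveField

variable {c₁ c₂ b ω : ℝ} {f : ℝ → ℂ}

lemma waveField_eq_add {x : ℝ} {F₁ F₂ : ℝ → ℂ} (hF₁ : Continuous F₁) (hF₂ : Continuous F₂)
    (h₁ : ∀ y, 0 < y → y ≤ 1 → greenFn c₁ c₂ ω x y * f y = F₁ y)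
    (h₂ : ∀ y, -1 < y → y ≤ 0 → greenFn c₁ c₂ ω x y * f y = F₂ y) :
    waveField c₁ c₂ f x ω = (∫ y in (0 : ℝ)..1, F₁ y) + ∫ y in (-1 : ℝ)..0, F₂ y := by
  have e₁ : ∀ y ∈ uIoc (0 : ℝ) 1, F₁ y = greenFn c₁ c₂ ω x y * f y := fun y hy => by
    rw [uIoc_of_le zero_le_one] at hy
    exact (h₁ y hy.1 hy.2).symm
  have e₂ : ∀ y ∈ uIoc (-1 : ℝ) 0, F₂ y = greenFn c₁ c₂ ω x y * f y := fun y hy => by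
    rw [uIoc_of_le (by norm_num)] at hy
    exact (h₂ y hy.1 hy.2).symm
  rw [waveField, ← intervalIntegral.integral_add_adjacent_intervals (b := 0)
    ((hF₂.intervalIntegrable _ _).congr e₂) ((hF₁.intervalIntegrable _ _).congr e₁), add_comm,
    intervalIntegral.integral_congr_ae (g := F₁) (Filter.Eventually.of_forall fun y hy =>
      (e₁ y hy).symm),
    intervalIntegral.integral_congr_ae (g := F₂) (Filter.Eventually.of_forall fun y hy =>
      (e₂ y hy).symm)]

lemma cosTransform_evenFold (hfc : Continuous f) (hf : ∀ y, 1 ≤ |y| → f y = 0)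
    (hc₁ : 0 < c₁) (hc₂ : 0 < c₂) (h₁ : c₁ ≤ b) (h₂ : c₂ ≤ b) (z : ℂ) :
    cosTransform b (evenFold c₁ c₂ f) z =
      (∫ y in (0 : ℝ)..1, f y * Complex.cos (z * (c₁ * y))) +
        ∫ y in (-1 : ℝ)..0, f y * Complex.cos (z * (c₂ * y)) := by
  have hc₁' : (c₁ : ℂ) ≠ 0 := by exact_mod_cast hc₁.ne'
  have hc₂' : (c₂ : ℂ) ≠ 0 := by exact_mod_cast hc₂.ne'
  rw [cosTransform, evenFold, integral_fold_mul _ _ hfc hf hc₁ hc₂ h₁ h₂ Complex.continuous_cos]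
  simp only [Complex.cos_neg]
  push_cast
  field_simp

lemma sinTransform_oddFold (hfc : Continuous f) (hf : ∀ y, 1 ≤ |y| → f y = 0)
    (hc₁ : 0 < c₁) (hc₂ : 0 < c₂) (h₁ : c₁ ≤ b) (h₂ : c₂ ≤ b) (z : ℂ) :
    sinTransform b (oddFold c₁ c₂ f) z =
      1 / c₁ * (∫ y in (0 : ℝ)..1, f y * Complex.sin (z * (c₁ * y))) +
        1 / c₂ * ∫ y in (-1 : ℝ)..0, f y * Complex.sin (z * (c₂ * y)) := by
  have hc₁' : (c₁ : ℂ) ≠ 0 := by exact_mod_cast hc₁.ne'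
  have hc₂' : (c₂ : ℂ) ≠ 0 := by exact_mod_cast hc₂.ne'
  rw [sinTransform, oddFold, integral_fold_mul _ _ hfc hf hc₁ hc₂ h₁ h₂ Complex.continuous_sin]
  simp only [Complex.sin_neg, mul_neg, intervalIntegral.integral_neg]
  push_cast
  field_simp

lemma mul_waveField_of_integrands {x : ℝ} {s t₁ t₂ : ℂ} (hfc : Continuous f)
    (h₁ : ∀ y : ℝ, 0 < y → y ≤ 1 → greenFn c₁ c₂ ω x y * ω =
      s * (Complex.cos (ω * (c₁ * y)) + t₁ * Complex.sin (ω * (c₁ * y))))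
    (h₂ : ∀ y : ℝ, -1 < y → y ≤ 0 → greenFn c₁ c₂ ω x y * ω =
      s * (Complex.cos (ω * (c₂ * y)) + t₂ * Complex.sin (ω * (c₂ * y)))) :
    ω * waveField c₁ c₂ f x ω = s * (
      ((∫ y in (0 : ℝ)..1, f y * Complex.cos (ω * (c₁ * y))) +
        ∫ y in (-1 : ℝ)..0, f y * Complex.cos (ω * (c₂ * y))) +
      (t₁ * (∫ y in (0 : ℝ)..1, f y * Complex.sin (ω * (c₁ * y))) +
        t₂ * ∫ y in (-1 : ℝ)..0, f y * Complex.sin (ω * (c₂ * y)))) := by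
  have h0 : ω * waveField c₁ c₂ f x ω = waveField c₁ c₂ (fun y => ω * f y) x ω := by
    rw [waveField, waveField, ← intervalIntegral.integral_const_mul]
    congr 1
    ext y
    ring
  rw [h0, waveField_eq_add (f := fun y => ω * f y)
    (F₁ := fun y : ℝ => s * (f y * Complex.cos (ω * (c₁ * y)) +
      t₁ * (f y * Complex.sin (ω * (c₁ * y)))))
    (F₂ := fun y : ℝ => s * (f y * Complex.cos (ω * (c₂ * y)) +
      t₂ * (f y * Complex.sin (ω * (c₂ * y))))) (by fun_prop) (by fun_prop)
    (fun y hy hy' => by rw [← mul_assoc, h₁ y hy hy']; ring)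
    (fun y hy hy' => by rw [← mul_assoc, h₂ y hy hy']; ring)]
  simp only [intervalIntegral.integral_const_mul]
  rw [intervalIntegral.integral_add, intervalIntegral.integral_add,
    intervalIntegral.integral_const_mul, intervalIntegral.integral_const_mul]
  · ring
  all_goals exact Continuous.intervalIntegrable (by fun_prop) _ _

lemma mul_waveField_one (hfc : Continuous f) (hf : ∀ y, 1 ≤ |y| → f y = 0)
    (hc₁ : 0 < c₁) (hc₂ : 0 < c₂) (h₁ : c₁ ≤ b) (h₂ : c₂ ≤ b) (hω : 0 < ω) :
    ω * waveField c₁ c₂ f 1 ω = Complex.I * Complex.exp ((c₁ * ω : ℝ) * Complex.I) / (c₁ + c₂) *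
      (cosTransform b (evenFold c₁ c₂ f) ω -
        Complex.I * c₂ * sinTransform b (oddFold c₁ c₂ f) ω) := by
  have hc₁' : (c₁ : ℂ) ≠ 0 := by exact_mod_cast hc₁.ne'
  have hc₂' : (c₂ : ℂ) ≠ 0 := by exact_mod_cast hc₂.ne'
  have hω' : (ω : ℂ) ≠ 0 := by exact_mod_cast hω.ne'
  have hs : (c₁ : ℂ) + c₂ ≠ 0 := by exact_mod_cast (by positivity : c₁ + c₂ ≠ 0)
  have hsω : (c₁ : ℂ) * ω + c₂ * ω ≠ 0 := by rw [← add_mul]; exact mul_ne_zero hs hω'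
  rw [cosTransform_evenFold hfc hf hc₁ hc₂ h₁ h₂, sinTransform_oddFold hfc hf hc₁ hc₂ h₁ h₂,
    mul_waveField_of_integrands (s := Complex.I * Complex.exp ((c₁ * ω : ℝ) * Complex.I) /
      (c₁ + c₂)) (t₁ := -(Complex.I * c₂ / c₁)) (t₂ := -Complex.I) hfc]
  · field_simp
    ring
  · intro y hy hy'
    have e₁ : Complex.exp (Complex.I * (c₁ * ω) * (((1 : ℝ) : ℂ) + y)) =
        Complex.exp ((c₁ * ω : ℝ) * Complex.I) * Complex.exp (ω * (c₁ * y) * Complex.I) := by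
      rw [← Complex.exp_add]; congr 1; push_cast; ring
    have e₂ : Complex.exp (Complex.I * (c₁ * ω) * ((|1 - y| : ℝ) : ℂ)) =
        Complex.exp ((c₁ * ω : ℝ) * Complex.I) * Complex.exp (-(ω * (c₁ * y)) * Complex.I) := by
      rw [← Complex.exp_add, abs_of_nonneg (by linarith)]; congr 1; push_cast; ring
    simp only [greenFn, if_pos hy, zero_lt_one, if_true]
    rw [e₁, e₂, Complex.exp_mul_I (ω * (c₁ * y)), Complex.exp_mul_I (-(ω * (c₁ * y))),
      Complex.cos_neg, Complex.sin_neg]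
    field_simp
    ring
  · intro y hy hy'
    have e₁ : Complex.exp (Complex.I * (-(c₂ * ω) * y + c₁ * ω * ((1 : ℝ) : ℂ))) =
        Complex.exp ((c₁ * ω : ℝ) * Complex.I) * Complex.exp (-(ω * (c₂ * y)) * Complex.I) := by
      rw [← Complex.exp_add]; congr 1; push_cast; ring
    simp only [greenFn, if_neg hy'.not_gt, if_neg (zero_lt_one' ℝ).not_gt]
    rw [e₁, Complex.exp_mul_I (-(ω * (c₂ * y))), Complex.cos_neg, Complex.sin_neg]
    field_simp

lemma mul_waveField_neg_one (hfc : Continuous f) (hf : ∀ y, 1 ≤ |y| → f y = 0)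
    (hc₁ : 0 < c₁) (hc₂ : 0 < c₂) (h₁ : c₁ ≤ b) (h₂ : c₂ ≤ b) (hω : 0 < ω) :
    ω * waveField c₁ c₂ f (-1) ω =
      Complex.I * Complex.exp ((c₂ * ω : ℝ) * Complex.I) / (c₁ + c₂) *
      (cosTransform b (evenFold c₁ c₂ f) ω +
        Complex.I * c₁ * sinTransform b (oddFold c₁ c₂ f) ω) := by
  have hc₁' : (c₁ : ℂ) ≠ 0 := by exact_mod_cast hc₁.ne'
  have hc₂' : (c₂ : ℂ) ≠ 0 := by exact_mod_cast hc₂.ne'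
  have hω' : (ω : ℂ) ≠ 0 := by exact_mod_cast hω.ne'
  have hs : (c₁ : ℂ) + c₂ ≠ 0 := by exact_mod_cast (by positivity : c₁ + c₂ ≠ 0)
  have hsω : (c₁ : ℂ) * ω + c₂ * ω ≠ 0 := by rw [← add_mul]; exact mul_ne_zero hs hω'
  rw [cosTransform_evenFold hfc hf hc₁ hc₂ h₁ h₂, sinTransform_oddFold hfc hf hc₁ hc₂ h₁ h₂,
    mul_waveField_of_integrands (s := Complex.I * Complex.exp ((c₂ * ω : ℝ) * Complex.I) /
      (c₁ + c₂)) (t₁ := Complex.I) (t₂ := Complex.I * c₁ / c₂) hfc]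
  · field_simp
  · intro y hy hy'
    have e₁ : Complex.exp (Complex.I * (c₁ * ω * y - c₂ * ω * ((-1 : ℝ) : ℂ))) =
        Complex.exp ((c₂ * ω : ℝ) * Complex.I) * Complex.exp (ω * (c₁ * y) * Complex.I) := by
      rw [← Complex.exp_add]; congr 1; push_cast; ring
    simp only [greenFn, if_pos hy, if_neg (by norm_num : ¬ (0 : ℝ) < -1)]
    rw [e₁, Complex.exp_mul_I (ω * (c₁ * y))]
    field_simp
  · intro y hy hy'
    have e₁ : Complex.exp (-Complex.I * (c₂ * ω) * (((-1 : ℝ) : ℂ) + y)) =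
        Complex.exp ((c₂ * ω : ℝ) * Complex.I) * Complex.exp (-(ω * (c₂ * y)) * Complex.I) := by
      rw [← Complex.exp_add]; congr 1; push_cast; ring
    have e₂ : Complex.exp (Complex.I * (c₂ * ω) * ((|-1 - y| : ℝ) : ℂ)) =
        Complex.exp ((c₂ * ω : ℝ) * Complex.I) * Complex.exp (ω * (c₂ * y) * Complex.I) := by
      rw [← Complex.exp_add, abs_of_nonpos (by linarith)]; congr 1; push_cast; ring
    simp only [greenFn, if_neg hy'.not_gt, if_pos (by norm_num : (-1 : ℝ) < 0)]
    rw [e₁, e₂, Complex.exp_mul_I (ω * (c₂ * y)), Complex.exp_mul_I (-(ω * (c₂ * y))),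
      Complex.cos_neg, Complex.sin_neg]
    field_simp
    ring

lemma sq_mul_sq_norm_of_eq {t : ℝ} {u s w : ℂ}
    (h : ω * u = Complex.I * Complex.exp (t * Complex.I) / s * w) :
    ω ^ 2 * ‖u‖ ^ 2 = ‖w / s‖ ^ 2 := by
  have h1 : ‖(ω : ℂ) * u‖ = ‖w / s‖ := by
    rw [h, div_mul_eq_mul_div, mul_div_assoc, norm_mul, norm_mul, Complex.norm_I,
      Complex.norm_exp_ofReal_mul_I, one_mul, one_mul]
  rw [← h1, norm_mul, mul_pow, Complex.norm_real, Real.norm_eq_abs, sq_abs]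

lemma sq_norm_transforms_le_waveField (hfc : Continuous f) (hf : ∀ y, 1 ≤ |y| → f y = 0)
    (hc₁ : 0 < c₁) (hc₂ : 0 < c₂) (h₁ : c₁ ≤ b) (h₂ : c₂ ≤ b) (hω : 0 < ω) :
    ‖cosTransform b (evenFold c₁ c₂ f) ω‖ ^ 2 + ‖sinTransform b (oddFold c₁ c₂ f) ω‖ ^ 2 ≤
      2 * (c₁ ^ 2 + c₂ ^ 2 + 1) *
        (ω ^ 2 * (‖waveField c₁ c₂ f (-1) ω‖ ^ 2 + ‖waveField c₁ c₂ f 1 ω‖ ^ 2)) := by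
  have hs : (c₁ : ℂ) + c₂ ≠ 0 := by exact_mod_cast (by positivity : c₁ + c₂ ≠ 0)
  have n₁ := sq_mul_sq_norm_of_eq (mul_waveField_one hfc hf hc₁ hc₂ h₁ h₂ hω)
  have n₂ := sq_mul_sq_norm_of_eq (mul_waveField_neg_one hfc hf hc₁ hc₂ h₁ h₂ hω)
  set C := cosTransform b (evenFold c₁ c₂ f) ω
  set S := sinTransform b (oddFold c₁ c₂ f) ω
  obtain ⟨A, hA⟩ : ∃ A, A = (C - Complex.I * c₂ * S) / (c₁ + c₂) := ⟨_, rfl⟩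
  obtain ⟨B, hB⟩ : ∃ B, B = (C + Complex.I * c₁ * S) / (c₁ + c₂) := ⟨_, rfl⟩
  rw [← hA] at n₁
  rw [← hB] at n₂
  have hC : C = c₁ * A + c₂ * B := by rw [hA, hB]; field_simp; ring
  have hS : S = Complex.I * A + (-Complex.I) * B := by
    rw [hA, hB]; field_simp; ring_nf; rw [Complex.I_sq]; ring
  have m₁ := sq_norm_add_le (c₁ * A) (c₂ * B)
  have m₂ := sq_norm_add_le (Complex.I * A) ((-Complex.I) * B)
  rw [← hC, norm_mul, norm_mul, Complex.norm_real, Complex.norm_real, Real.norm_of_nonneg hc₁.le,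
    Real.norm_of_nonneg hc₂.le, mul_pow, mul_pow] at m₁
  rw [← hS, norm_mul, norm_mul, norm_neg, Complex.norm_I, one_mul, one_mul] at m₂
  rw [mul_add (ω ^ 2), n₁, n₂]
  have p₁ : 0 ≤ c₁ ^ 2 * ‖B‖ ^ 2 := by positivity
  have p₂ : 0 ≤ c₂ ^ 2 * ‖A‖ ^ 2 := by positivity
  linarith

lemma integral_transforms_le_waveField (hfc : Continuous f) (hf : ∀ y, 1 ≤ |y| → f y = 0)
    (hc₁ : 0 < c₁) (hc₂ : 0 < c₂) (h₁ : c₁ ≤ b) (h₂ : c₂ ≤ b) {K : ℝ} (hK : 0 ≤ K) :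
    ∫ ω in (0 : ℝ)..K, (‖cosTransform b (evenFold c₁ c₂ f) ω‖ ^ 2 +
        ‖sinTransform b (oddFold c₁ c₂ f) ω‖ ^ 2) ≤
      2 * (c₁ ^ 2 + c₂ ^ 2 + 1) * ∫ ω in (0 : ℝ)..K,
        ω ^ 2 * (‖waveField c₁ c₂ f (-1) ω‖ ^ 2 + ‖waveField c₁ c₂ f 1 ω‖ ^ 2) := by
  have hE := (differentiable_cosTransform b
    (continuous_fold (c₁ := c₁) (c₂ := c₂) (1 / c₁) (1 / c₂) hfc)).continuous
  have hO := (differentiable_sinTransform b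
    (continuous_fold (c₁ := c₁) (c₂ := c₂) (1 / c₁ ^ 2) (-(1 / c₂ ^ 2)) hfc)).continuous
  change Continuous (cosTransform b (evenFold c₁ c₂ f)) at hE
  change Continuous (sinTransform b (oddFold c₁ c₂ f)) at hO
  have hW : IntervalIntegrable (fun ω => ω ^ 2 * (‖waveField c₁ c₂ f (-1) ω‖ ^ 2 +
      ‖waveField c₁ c₂ f 1 ω‖ ^ 2)) volume 0 K := by
    refine IntervalIntegrable.congr (f := fun ω : ℝ =>
      ‖(cosTransform b (evenFold c₁ c₂ f) ω +
        Complex.I * c₁ * sinTransform b (oddFold c₁ c₂ f) ω) / (c₁ + c₂)‖ ^ 2 +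
      ‖(cosTransform b (evenFold c₁ c₂ f) ω -
        Complex.I * c₂ * sinTransform b (oddFold c₁ c₂ f) ω) / (c₁ + c₂)‖ ^ 2) ?_
      (Continuous.intervalIntegrable (by fun_prop) _ _)
    intro ω hω
    rw [uIoc_of_le hK] at hω
    simp only [mul_add,
      sq_mul_sq_norm_of_eq (mul_waveField_one hfc hf hc₁ hc₂ h₁ h₂ hω.1),
      sq_mul_sq_norm_of_eq (mul_waveField_neg_one hfc hf hc₁ hc₂ h₁ h₂ hω.1)]
  rw [← intervalIntegral.integral_const_mul]
  refine intervalIntegral.integral_mono_on_of_le_Ioo hK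
    (Continuous.intervalIntegrable (by fun_prop) _ _) (hW.const_mul _) fun ω hω => ?_
  exact sq_norm_transforms_le_waveField hfc hf hc₁ hc₂ h₁ h₂ hω.1

end waveField

lemma norm_transform_mul_conj_le {b : ℝ} (hb : 0 ≤ b) {φ : ℝ → ℂ} (hφ : Continuous φ)
    {g : ℂ → ℂ} (hg : ∀ z, ‖g z‖ ≤ Real.exp ‖z‖) (z : ℂ) :
    ‖(∫ τ in (0 : ℝ)..b, φ τ * g (z * τ)) *
        ∫ τ in (0 : ℝ)..b, starRingEnd ℂ (φ τ) * g (z * τ)‖ ≤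
      (b * ∫ τ in (0 : ℝ)..b, ‖φ τ‖ ^ 2) * Real.exp (2 * b * ‖z‖) := by
  have h1 := norm_integral_mul_comp_le hb hφ hg z
  have h2 := norm_integral_mul_comp_le hb (Complex.continuous_conj.comp hφ) hg z
  simp only [Function.comp, RCLike.norm_conj] at h2
  have h3 : (∫ τ in (0 : ℝ)..b, ‖φ τ‖) ^ 2 ≤ b * ∫ τ in (0 : ℝ)..b, ‖φ τ‖ ^ 2 := by
    simpa using sq_integral_mul_le (f := fun _ => 1) continuous_const hφ.norm hb
  have h0 : 0 ≤ ∫ τ in (0 : ℝ)..b, ‖φ τ‖ :=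
    intervalIntegral.integral_nonneg hb fun _ _ => norm_nonneg _
  rw [norm_mul]
  calc _ ≤ ((∫ τ in (0 : ℝ)..b, ‖φ τ‖) * Real.exp (b * ‖z‖)) *
        ((∫ τ in (0 : ℝ)..b, ‖φ τ‖) * Real.exp (b * ‖z‖)) := by gcongr
    _ = (∫ τ in (0 : ℝ)..b, ‖φ τ‖) ^ 2 * Real.exp (2 * b * ‖z‖) := by
      rw [mul_mul_mul_comm, ← Real.exp_add, ← sq]; ring_nf
    _ ≤ _ := by gcongr

/-- The energy of the cosine and sine transforms over `(0, L)` is controlled by the one over the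
smaller interval `(0, K)`. -/
lemma integral_transforms_le_of_lt {b K L η Q : ℝ} {φ ψ : ℝ → ℂ} (hb : 0 ≤ b) (hφ : Continuous φ)
    (hψ : Continuous ψ) (hK : 0 < K) (hKL : K < L)
    (hQ : b * (∫ τ in (0 : ℝ)..b, ‖φ τ‖ ^ 2) + b * ∫ τ in (0 : ℝ)..b, ‖ψ τ‖ ^ 2 ≤ Q)
    (hη : ∫ ω in (0 : ℝ)..K, (‖cosTransform b φ ω‖ ^ 2 + ‖sinTransform b ψ ω‖ ^ 2) ≤ η) :
    ∫ ω in (0 : ℝ)..L, (‖cosTransform b φ ω‖ ^ 2 + ‖sinTransform b ψ ω‖ ^ 2) ≤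
      √η * √(4 * L ^ 2 / K * (Q * Real.exp (2 * b * (4 * L ^ 2 / K)))) := by
  have hφ' : Continuous fun τ => starRingEnd ℂ (φ τ) := Complex.continuous_conj.comp hφ
  have hψ' : Continuous fun τ => starRingEnd ℂ (ψ τ) := Complex.continuous_conj.comp hψ
  refine integral_le_of_entire (h := fun z =>
    cosTransform b φ z * cosTransform b (fun τ => starRingEnd ℂ (φ τ)) z +
      sinTransform b ψ z * sinTransform b (fun τ => starRingEnd ℂ (ψ τ)) z) ?_ ?_
    (fun x => by positivity) hK hKL (by positivity) ?_ hη
  · exact ((differentiable_cosTransform b hφ).mul (differentiable_cosTransform b hφ')).add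
      ((differentiable_sinTransform b hψ).mul (differentiable_sinTransform b hψ'))
  · intro x
    simp only [← conj_cosTransform, ← conj_sinTransform, Complex.mul_conj']
    push_cast
    rfl
  · intro z
    have h1 := norm_transform_mul_conj_le hb hφ norm_cos_le_exp_norm z
    have h2 := norm_transform_mul_conj_le hb hψ norm_sin_le_exp_norm z
    refine (norm_add_le _ _).trans ((add_le_add h1 h2).trans ?_)
    rw [← add_mul]
    gcongr

/-- The source is controlled by its transforms at low frequencies and by its derivative. -/
lemma exists_const_integral_sq_norm_le {c₁ c₂ b : ℝ} (hc₁ : 0 < c₁) (hc₂ : 0 < c₂) (h₁ : c₁ ≤ b)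
    (h₂ : c₂ ≤ b) :
    ∃ D : ℝ, 1 ≤ D ∧ ∀ (f f' : ℝ → ℂ) (L : ℝ), (∀ x, HasDerivAt f (f' x) x) → Continuous f' →
      (∀ y, 1 ≤ |y| → f y = 0) → (∀ y, 1 ≤ |y| → f' y = 0) → 0 < L →
      ∫ y in (-1 : ℝ)..1, ‖f y‖ ^ 2 ≤
        D * ((∫ ω in (0 : ℝ)..L, (‖cosTransform b (evenFold c₁ c₂ f) ω‖ ^ 2 +
            ‖sinTransform b (oddFold c₁ c₂ f) ω‖ ^ 2)) +
          (∫ y in (-1 : ℝ)..1, ‖f' y‖ ^ 2) / L ^ 2 +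
          √((∫ y in (-1 : ℝ)..1, ‖f y‖ ^ 2) * ∫ y in (-1 : ℝ)..1, ‖f' y‖ ^ 2) / L) := by
  have hb : 0 < b := by linarith
  obtain ⟨m₁, hm₁⟩ : ∃ m, m = 2 * (c₁ + c₂) := ⟨_, rfl⟩
  obtain ⟨m₂, hm₂⟩ : ∃ m, m = 2 * (c₁ * c₂ * (c₁ + c₂)) := ⟨_, rfl⟩
  obtain ⟨k₁, hk₁⟩ : ∃ k, k = 2 * ((1 / c₁ / c₁) ^ 2 * c₁ + (-(1 / c₂) / c₂) ^ 2 * c₂) := ⟨_, rfl⟩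
  obtain ⟨k₂, hk₂⟩ : ∃ k, k = 2 * ((1 / c₁ ^ 2 / c₁) ^ 2 * c₁ +
    (-(-(1 / c₂ ^ 2)) / c₂) ^ 2 * c₂) := ⟨_, rfl⟩
  obtain ⟨r, hr⟩ : ∃ r, r = (1 / c₁ ^ 2 - 1 / c₂ ^ 2) ^ 2 := ⟨_, rfl⟩
  have hm₁0 : 0 ≤ m₁ := by rw [hm₁]; positivity
  have hm₂0 : 0 ≤ m₂ := by rw [hm₂]; positivity
  have hk₁0 : 0 ≤ k₁ := by rw [hk₁]; positivity
  have hk₂0 : 0 ≤ k₂ := by rw [hk₂]; positivity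
  have hr0 : 0 ≤ r := by rw [hr]; positivity
  refine ⟨1 + (2 * m₁ + 2 * m₂ + 2 * m₁ * k₁ + 4 * m₂ * k₂ + 8 * m₂ * r),
    le_add_of_nonneg_right (by positivity), ?_⟩
  intro f f' L hd hf'c hf hf' hL
  have hfc : Continuous f := continuous_iff_continuousAt.2 fun x => (hd x).continuousAt
  have hE : Continuous (evenFold c₁ c₂ f) := continuous_fold _ _ hfc
  have hO : Continuous (oddFold c₁ c₂ f) := continuous_fold _ _ hfc
  have hC := (differentiable_cosTransform b hE).continuous
  have hS := (differentiable_sinTransform b hO).continuous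
  have hlow := integral_sq_norm_le_fold hfc hf hc₁ hc₂ h₁ h₂
  have hcos := integral_sq_norm_le_cosTransform hb hL
    (hasDerivAt_fold (c₁ := c₁) (c₂ := c₂) (1 / c₁) (1 / c₂) hd)
    (continuous_fold _ _ hf'c) (fold_eq_zero _ _ hf hc₁ hc₂ h₁ h₂)
  have hsin := integral_sq_norm_le_sinTransform hb hL
    (hasDerivAt_fold (c₁ := c₁) (c₂ := c₂) (1 / c₁ ^ 2) (-(1 / c₂ ^ 2)) hd)
    (continuous_fold _ _ hf'c) (fold_eq_zero _ _ hf hc₁ hc₂ h₁ h₂)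
  have hα := integral_sq_norm_fold_le (1 / c₁ / c₁) (-(1 / c₂) / c₂) hf'c hf' hc₁ hc₂ h₁ h₂
  have hβ := integral_sq_norm_fold_le (1 / c₁ ^ 2 / c₁) (-(-(1 / c₂ ^ 2)) / c₂) hf'c hf'
    hc₁ hc₂ h₁ h₂
  have hzero : ‖fold c₁ c₂ (1 / c₁ ^ 2) (-(1 / c₂ ^ 2)) f 0‖ ^ 2 = r * ‖f 0‖ ^ 2 := by
    have : fold c₁ c₂ (1 / c₁ ^ 2) (-(1 / c₂ ^ 2)) f 0 =
        ((1 / c₁ ^ 2 - 1 / c₂ ^ 2 : ℝ) : ℂ) * f 0 := by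
      simp only [fold, neg_zero, zero_div]
      push_cast
      ring
    rw [this, norm_mul, mul_pow, Complex.norm_real, Real.norm_eq_abs, sq_abs, hr]
  have hf0 := sq_norm_le_sqrt_integral hd hf'c (a := -1) (b := 1) (x := 0) (by norm_num)
    (by norm_num) (hf _ (by norm_num))
  change π * (∫ τ in (0 : ℝ)..b, ‖evenFold c₁ c₂ f τ‖ ^ 2) ≤
    2 * (∫ ω in (0 : ℝ)..L, ‖cosTransform b (evenFold c₁ c₂ f) ω‖ ^ 2) + _ at hcos
  change π * (∫ τ in (0 : ℝ)..b, ‖oddFold c₁ c₂ f τ‖ ^ 2) ≤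
    2 * (∫ ω in (0 : ℝ)..L, ‖sinTransform b (oddFold c₁ c₂ f) ω‖ ^ 2) + _ + _ at hsin
  rw [← hk₁] at hα
  rw [← hk₂] at hβ
  rw [← hm₁, ← hm₂] at hlow
  rw [hzero] at hsin
  rw [intervalIntegral.integral_add (Continuous.intervalIntegrable (by fun_prop) _ _)
    (Continuous.intervalIntegrable (by fun_prop) _ _)]
  have hIc : 0 ≤ ∫ ω in (0 : ℝ)..L, ‖cosTransform b (evenFold c₁ c₂ f) ω‖ ^ 2 :=
    intervalIntegral.integral_nonneg hL.le fun _ _ => by positivity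
  have hIs : 0 ≤ ∫ ω in (0 : ℝ)..L, ‖sinTransform b (oddFold c₁ c₂ f) ω‖ ^ 2 :=
    intervalIntegral.integral_nonneg hL.le fun _ _ => by positivity
  have hX₁ : 0 ≤ ∫ y in (-1 : ℝ)..1, ‖f' y‖ ^ 2 :=
    intervalIntegral.integral_nonneg (by norm_num) fun _ _ => by positivity
  set Ic := ∫ ω in (0 : ℝ)..L, ‖cosTransform b (evenFold c₁ c₂ f) ω‖ ^ 2
  set Is := ∫ ω in (0 : ℝ)..L, ‖sinTransform b (oddFold c₁ c₂ f) ω‖ ^ 2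
  set X₀ := ∫ y in (-1 : ℝ)..1, ‖f y‖ ^ 2
  set X₁ := ∫ y in (-1 : ℝ)..1, ‖f' y‖ ^ 2
  set a := ∫ τ in (0 : ℝ)..b, ‖evenFold c₁ c₂ f τ‖ ^ 2
  set d := ∫ τ in (0 : ℝ)..b, ‖oddFold c₁ c₂ f τ‖ ^ 2
  have hπ : 1 ≤ π := by linarith [Real.pi_gt_three]
  have ha : a ≤ 2 * Ic + 2 * k₁ * (X₁ / L ^ 2) := by
    have h : π * a ≤ π * (2 * Ic + 2 * k₁ * (X₁ / L ^ 2)) := by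
      calc π * a ≤ 2 * Ic + 2 * π / L ^ 2 * (k₁ * X₁) := hcos.trans (by gcongr)
        _ ≤ π * (2 * Ic) + 2 * π / L ^ 2 * (k₁ * X₁) := by
          exact add_le_add (le_mul_of_one_le_left (by positivity) hπ) le_rfl
        _ = _ := by ring
    exact le_of_mul_le_mul_left h (by positivity)
  set s := √(X₀ * X₁)
  have hd' : d ≤ 2 * Is + 8 * r * (s / L) + 4 * k₂ * (X₁ / L ^ 2) := by
    have h : π * d ≤ π * (2 * Is + 8 * r * (s / L) + 4 * k₂ * (X₁ / L ^ 2)) := by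
      calc π * d ≤ 2 * Is + 4 * (r * (2 * s)) / L + 4 * π / L ^ 2 * (k₂ * X₁) :=
            hsin.trans (by gcongr)
        _ = (2 * Is + 4 * (r * (2 * s)) / L) + 4 * π / L ^ 2 * (k₂ * X₁) := by ring
        _ ≤ π * (2 * Is + 4 * (r * (2 * s)) / L) + 4 * π / L ^ 2 * (k₂ * X₁) := by
          exact add_le_add (le_mul_of_one_le_left (by positivity) hπ) le_rfl
        _ = _ := by ring
    exact le_of_mul_le_mul_left h (by positivity)
  set x := X₁ / L ^ 2
  set t := s / L
  have hx : 0 ≤ x := by positivity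
  have ht : 0 ≤ t := by positivity
  have e₁ : 0 ≤ 2 * m₂ * Ic := by positivity
  have e₂ : 0 ≤ 2 * m₁ * Is := by positivity
  set I := Ic + Is
  have e₃ : 0 ≤ (1 + (2 * m₁ * k₁ + 4 * m₂ * k₂ + 8 * m₂ * r)) * I := by positivity
  have e₄ : 0 ≤ (1 + (2 * m₁ + 2 * m₂ + 8 * m₂ * r)) * x := by positivity
  have e₅ : 0 ≤ (1 + (2 * m₁ + 2 * m₂ + 2 * m₁ * k₁ + 4 * m₂ * k₂)) * t := by positivity
  have e₆ : (2 * m₁ + 2 * m₂) * I = 2 * m₁ * Ic + 2 * m₂ * Is + 2 * m₂ * Ic + 2 * m₁ * Is := by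
    ring
  calc X₀ ≤ m₁ * a + m₂ * d := hlow
    _ ≤ m₁ * (2 * Ic + 2 * k₁ * x) + m₂ * (2 * Is + 8 * r * t + 4 * k₂ * x) := by gcongr
    _ ≤ _ := by linarith

/-- Increasing stability for the one-dimensional inverse source problem in a two-layered
medium: for `f ∈ H^n(-1,1)` with `‖f‖_{H^n} ≤ M` and `supp f ⊂ (-1,1)`, with boundary data
`ε = (∫_0^K ω²(|u(-1,ω)|² + |u(1,ω)|²) dω)^{1/2}` satisfying `0 < ε < e^{-1}`, one has
`‖f‖²_{L²} ≤ C (ε² + M² / (K^{2/3}|ln ε|^{1/4}/(6n-3)³)^{2n-1})` with `C` depending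
only on `c₁, c₂`. -/
theorem main_stability (c₁ c₂ : ℝ) (hc₁ : 0 < c₁) (hc₂ : 0 < c₂) :
    ∃ C : ℝ, 0 < C ∧
      ∀ (n : ℕ) (M K : ℝ) (f : ℝ → ℂ) (ε : ℝ),
        1 ≤ n → 1 < M → 1 < K →
        ContDiff ℝ n f → tsupport f ⊆ Set.Ioo (-1:ℝ) 1 →
        sobolevNormSq n (-1) 1 f ≤ M ^ 2 →
        ε = Real.sqrt (∫ ω in (0:ℝ)..K,
          ω ^ 2 * (‖waveField c₁ c₂ f (-1) ω‖ ^ 2 + ‖waveField c₁ c₂ f 1 ω‖ ^ 2)) →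
        0 < ε → ε < Real.exp (-1) →
        (∫ y in (-1:ℝ)..1, ‖f y‖ ^ 2) ≤
          C * (ε ^ 2 +
            M ^ 2 / ((K ^ ((2:ℝ)/3) * |Real.log ε| ^ ((1:ℝ)/4)) / ((6 * n - 3 : ℝ)) ^ 3)
              ^ (2 * n - 1)) := by
  set b := max c₁ c₂ with hb
  have h₁ : c₁ ≤ b := le_max_left _ _
  have h₂ : c₂ ≤ b := le_max_right _ _
  have hb0 : 0 < b := hc₁.trans_le h₁
  obtain ⟨D, hD1, hD⟩ := exists_const_integral_sq_norm_le hc₁ hc₂ h₁ h₂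
  obtain ⟨kα, hkα⟩ : ∃ k, k = 2 * ((1 / c₁) ^ 2 * c₁ + (1 / c₂) ^ 2 * c₂) := ⟨_, rfl⟩
  obtain ⟨kβ, hkβ⟩ : ∃ k, k = 2 * ((1 / c₁ ^ 2) ^ 2 * c₁ + (-(1 / c₂ ^ 2)) ^ 2 * c₂) := ⟨_, rfl⟩
  have hkα0 : 0 ≤ kα := by rw [hkα]; positivity
  have hkβ0 : 0 ≤ kβ := by rw [hkβ]; positivity
  obtain ⟨C, hC, hmain⟩ := exists_const_of_cutoff_bounds (B := 4 * D) (D := 2 * D)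
    (C₁ := 2 * (c₁ ^ 2 + c₂ ^ 2 + 1)) (C₂ := b * kα + b * kβ) hb0 (by linarith) (by linarith)
    (by positivity) (by positivity)
  refine ⟨C, hC, fun n M K f ε hn hM hK hcd hsupp hnorm hε hε0 hε1 => ?_⟩
  obtain ⟨n, rfl⟩ : ∃ m, n = m + 1 := ⟨n - 1, by omega⟩
  have hfc : Continuous f := hcd.continuous
  have hnot : ∀ y : ℝ, 1 ≤ |y| → y ∉ tsupport f := fun y hy h => by
    have := abs_lt.2 ⟨(hsupp h).1, (hsupp h).2⟩
    linarith
  have hf : ∀ y : ℝ, 1 ≤ |y| → f y = 0 := fun y hy =>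
    image_eq_zero_of_notMem_tsupport (hnot y hy)
  have hf' : ∀ y : ℝ, 1 ≤ |y| → deriv f y = 0 := fun y hy => by
    rw [← iteratedDeriv_one]
    exact iteratedDeriv_eq_zero_of_notMem_tsupport (hnot y hy) 1
  have hone : (1 : WithTop ℕ∞) ≤ ((n + 1 : ℕ) : WithTop ℕ∞) := by exact_mod_cast hn
  have hd : ∀ x, HasDerivAt f (deriv f x) x := fun x =>
    (hcd.differentiable (by positivity) x).hasDerivAt
  have hf'c : Continuous (deriv f) := hcd.continuous_deriv hone
  have hterm : ∀ k, 0 ≤ ∫ y in (-1 : ℝ)..1, ‖iteratedDeriv k f y‖ ^ 2 := fun k =>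
    intervalIntegral.integral_nonneg (by norm_num) fun _ _ => by positivity
  have hle : ∀ k, k ≤ n + 1 → ∫ y in (-1 : ℝ)..1, ‖iteratedDeriv k f y‖ ^ 2 ≤ M ^ 2 :=
    fun k hk => (Finset.single_le_sum (f := fun k => ∫ y in (-1 : ℝ)..1, ‖iteratedDeriv k f y‖ ^ 2)
      (fun k _ => hterm k) (Finset.mem_range.2 (by omega))).trans hnorm
  have hX₀ : 0 ≤ ∫ y in (-1 : ℝ)..1, ‖f y‖ ^ 2 := by simpa using hterm 0
  have hX₁ : 0 ≤ ∫ y in (-1 : ℝ)..1, ‖deriv f y‖ ^ 2 := by simpa [iteratedDeriv_one] using hterm 1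
  have hX₀M : ∫ y in (-1 : ℝ)..1, ‖f y‖ ^ 2 ≤ M ^ 2 := by simpa using hle 0 (by omega)
  have hinterp : (∫ y in (-1 : ℝ)..1, ‖deriv f y‖ ^ 2) ^ (n + 1) ≤
      (∫ y in (-1 : ℝ)..1, ‖f y‖ ^ 2) ^ n * M ^ 2 :=
    (integral_sq_norm_deriv_pow_le (by norm_num) hcd hsupp).trans (by
      have := hle (n + 1) le_rfl
      gcongr)
  have hεsq : ε ^ 2 = ∫ ω in (0:ℝ)..K,
      ω ^ 2 * (‖waveField c₁ c₂ f (-1) ω‖ ^ 2 + ‖waveField c₁ c₂ f 1 ω‖ ^ 2) := by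
    rw [hε, Real.sq_sqrt]
    exact intervalIntegral.integral_nonneg (by linarith) fun _ _ => by positivity
  have hIK : ∫ ω in (0 : ℝ)..K, (‖cosTransform b (evenFold c₁ c₂ f) ω‖ ^ 2 +
      ‖sinTransform b (oddFold c₁ c₂ f) ω‖ ^ 2) ≤ 2 * (c₁ ^ 2 + c₂ ^ 2 + 1) * ε ^ 2 := by
    rw [hεsq]
    exact integral_transforms_le_waveField hfc hf hc₁ hc₂ h₁ h₂ (by linarith)
  refine hmain (n + 1) M K ε _ (fun L => ∫ ω in (0 : ℝ)..L,
    (‖cosTransform b (evenFold c₁ c₂ f) ω‖ ^ 2 + ‖sinTransform b (oddFold c₁ c₂ f) ω‖ ^ 2))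
    hn hM hK hε0 hε1 (fun L hL => ?_) hIK (fun L hL => ?_)
  · exact le_add_of_tail_bound hX₀ hX₁
      (intervalIntegral.integral_nonneg hL.le fun _ _ => by positivity) hL hD1
      (hD f (deriv f) L hd hf'c hf hf' hL) hinterp
  · refine integral_transforms_le_of_lt hb0.le (continuous_fold _ _ hfc) (continuous_fold _ _ hfc)
      (by linarith) hL ?_ hIK
    have hα := integral_sq_norm_fold_le (1 / c₁) (1 / c₂) hfc hf hc₁ hc₂ h₁ h₂
    have hβ := integral_sq_norm_fold_le (1 / c₁ ^ 2) (-(1 / c₂ ^ 2)) hfc hf hc₁ hc₂ h₁ h₂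
    rw [← hkα] at hα
    rw [← hkβ] at hβ
    have hα' := hα.trans (mul_le_mul_of_nonneg_left hX₀M hkα0)
    have hβ' := hβ.trans (mul_le_mul_of_nonneg_left hX₀M hkβ0)
    rw [add_mul, mul_assoc, mul_assoc]
    exact add_le_add (mul_le_mul_of_nonneg_left hα' hb0.le)
      (mul_le_mul_of_nonneg_left hβ' hb0.le)
end

section
/- Let n ≥ 1 be an integer, M > 1, K > 1, and let f ∈ H^n(−1,1) with ‖f‖_{H^n(−1,1)} ≤ M and supp f ⊂ (−1,1). Let u be the wave field generated by f, set ε = (∫_0^K ω² (|u(−1,ω)|² + |u(1,ω)|²) dω)^{1/2}, assume ε > 0, and set a = max{5 c_max, 3}. Then there exist a constant C > 0 depending only on c₁ and c₂, and a function μ on (K, ∞) satisfying μ(s) ≥ 1/2 for s ∈ (K, 2^{1/4} K) and μ(s) ≥ (1/π) ((s/K)^4 − 1)^{−1/2} for s ∈ (2^{1/4} K, ∞), such that for every s ∈ (K, ∞), ∫_0^s ω² ( |u(−1,ω)|² + |u(1,ω)|² ) dω ≤ C M² e^{a s} ε^{2 μ(s)}. -/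
open MeasureTheory Real Set

section TwoConstants

open Filter Topology Complex

/-- The map `ζ ↦ (ζ + i)^{1/4} (ζ - i)^{1/4}` sends the closed right half-plane onto the closed
sector `|arg z| ≤ π / 4`, and the segment `[-i, i]` onto `[0, 1]`. -/
noncomputable def halfPlaneToSector (ζ : ℂ) : ℂ :=
  (ζ + I) ^ (1 / 4 : ℂ) * (ζ - I) ^ (1 / 4 : ℂ)

lemma halfPlaneToSector_eq_exp {ζ : ℂ} (h₁ : ζ + I ≠ 0) (h₂ : ζ - I ≠ 0) :
    halfPlaneToSector ζ = exp ((log (ζ + I) + log (ζ - I)) / 4) := by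
  rw [halfPlaneToSector, cpow_def_of_ne_zero h₁, cpow_def_of_ne_zero h₂, ← Complex.exp_add]
  congr 1
  ring

lemma continuousAt_halfPlaneToSector {ζ : ℂ} (hζ : 0 ≤ ζ.re) :
    ContinuousAt halfPlaneToSector ζ := by
  have h4 : 0 < (1 / 4 : ℂ).re := by norm_num
  refine ContinuousAt.mul ?_ ?_
  · exact (continuousAt_cpow_const_of_re_pos (Or.inl (by simpa using hζ)) h4).comp
      (f := fun z => z + I) (by fun_prop)
  · exact (continuousAt_cpow_const_of_re_pos (Or.inl (by simpa using hζ)) h4).comp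
      (f := fun z => z - I) (by fun_prop)

lemma differentiableAt_halfPlaneToSector {ζ : ℂ} (hζ : 0 < ζ.re) :
    DifferentiableAt ℂ halfPlaneToSector ζ := by
  refine DifferentiableAt.mul ?_ ?_
  · exact DifferentiableAt.cpow (by fun_prop) (by fun_prop) (Or.inl (by simpa using hζ))
  · exact DifferentiableAt.cpow (by fun_prop) (by fun_prop) (Or.inl (by simpa using hζ))

lemma abs_im_halfPlaneToSector_le_re {ζ : ℂ} (hζ : 0 ≤ ζ.re) :
    |(halfPlaneToSector ζ).im| ≤ (halfPlaneToSector ζ).re := by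
  by_cases h₁ : ζ + I = 0
  · simp [halfPlaneToSector, h₁]
  by_cases h₂ : ζ - I = 0
  · simp [halfPlaneToSector, h₂]
  rw [halfPlaneToSector_eq_exp h₁ h₂]
  have a₁ := abs_le.1 (abs_arg_le_pi_div_two_iff.2 (show 0 ≤ (ζ + I).re by simpa using hζ))
  have a₂ := abs_le.1 (abs_arg_le_pi_div_two_iff.2 (show 0 ≤ (ζ - I).re by simpa using hζ))
  set θ : ℝ := ((log (ζ + I) + log (ζ - I)) / 4).im with hθ
  have hθ' : θ = (arg (ζ + I) + arg (ζ - I)) / 4 := by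
    rw [hθ, show (4 : ℂ) = ((4 : ℝ) : ℂ) by norm_num, div_ofReal_im]
    simp [log_im]
  rw [exp_im, exp_re, ← hθ, abs_mul, abs_of_pos (Real.exp_pos _)]
  gcongr
  have hθ4 : |θ| ≤ π / 4 := by rw [hθ', abs_le]; constructor <;> linarith
  have hπ := Real.pi_pos
  calc |Real.sin θ| = Real.sin |θ| :=
        Real.abs_sin_eq_sin_abs_of_abs_le_pi (by linarith)
    _ ≤ Real.sin (π / 4) := Real.sin_le_sin_of_le_of_le_pi_div_two
        (by linarith [abs_nonneg θ]) (by linarith) hθ4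
    _ = Real.cos (π / 4) := by rw [Real.sin_pi_div_four, Real.cos_pi_div_four]
    _ ≤ Real.cos |θ| := Real.cos_le_cos_of_nonneg_of_le_pi (abs_nonneg θ) (by linarith) hθ4
    _ = Real.cos θ := Real.cos_abs θ

lemma arg_ofReal_add_I {t : ℝ} (ht : 0 < t) : arg ((t : ℂ) + I) = Real.arctan (1 / t) := by
  have h := abs_lt.1 (abs_arg_lt_pi_div_two_iff.2 (show 0 < ((t : ℂ) + I).re ∨ (t : ℂ) + I = 0 by
    simp [ht]))
  rw [← Real.arctan_tan h.1 h.2, tan_arg]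
  simp

lemma arg_ofReal_sub_I {t : ℝ} (ht : 0 < t) : arg ((t : ℂ) - I) = -Real.arctan (1 / t) := by
  have h := abs_lt.1 (abs_arg_lt_pi_div_two_iff.2 (show 0 < ((t : ℂ) - I).re ∨ (t : ℂ) - I = 0 by
    simp [ht]))
  rw [← Real.arctan_tan h.1 h.2, tan_arg, ← Real.arctan_neg]
  simp [neg_div]

lemma arg_mul_I_add_I {η : ℝ} (hη : -1 < η) : arg (η * I + I) = π / 2 :=
  arg_eq_pi_div_two_iff.2 (by simpa using neg_lt_iff_pos_add.1 hη)

lemma arg_mul_I_sub_I {η : ℝ} (hη : η < 1) : arg (η * I - I) = -(π / 2) :=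
  arg_eq_neg_pi_div_two_iff.2 (by simpa using hη)

lemma arg_mul_I_add_I_of_lt {η : ℝ} (hη : η < -1) : arg (η * I + I) = -(π / 2) :=
  arg_eq_neg_pi_div_two_iff.2 ⟨by simp, by simpa using by linarith⟩

lemma arg_mul_I_sub_I_of_lt {η : ℝ} (hη : 1 < η) : arg (η * I - I) = π / 2 :=
  arg_eq_pi_div_two_iff.2 (by simpa using hη)

lemma halfPlaneToSector_of_arg_add_eq_zero {ζ : ℂ} (h : arg (ζ + I) + arg (ζ - I) = 0)
    {r : ℝ} (hr : 0 ≤ r) (hζ : ζ ^ 2 + 1 = r) :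
    halfPlaneToSector ζ = ((r ^ (1 / 4 : ℝ) : ℝ) : ℂ) := by
  have hmul : (ζ + I) * (ζ - I) = r := by rw [← hζ]; linear_combination -I_sq
  by_cases h₁ : ζ + I = 0
  · obtain rfl : r = 0 := by simpa [h₁, eq_comm] using hmul
    simp [halfPlaneToSector, h₁]
  by_cases h₂ : ζ - I = 0
  · obtain rfl : r = 0 := by simpa [h₂, eq_comm] using hmul
    simp [halfPlaneToSector, h₂]
  have hr0 : (r : ℂ) ≠ 0 := hmul ▸ mul_ne_zero h₁ h₂
  rw [halfPlaneToSector_eq_exp h₁ h₂, ← (log_mul_eq_add_log_iff h₁ h₂).2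
    (by rw [h]; exact ⟨by linarith [Real.pi_pos], Real.pi_pos.le⟩), hmul, ofReal_cpow hr,
    cpow_def_of_ne_zero hr0]
  push_cast
  ring_nf

lemma halfPlaneToSector_mul_I {η : ℝ} (hη : |η| < 1) :
    halfPlaneToSector (η * I) = (((1 - η ^ 2) ^ (1 / 4 : ℝ) : ℝ) : ℂ) := by
  have hη' := abs_lt.1 hη
  refine halfPlaneToSector_of_arg_add_eq_zero ?_ (by nlinarith) ?_
  · rw [arg_mul_I_add_I hη'.1, arg_mul_I_sub_I hη'.2, add_neg_cancel]
  · rw [mul_pow, I_sq]; push_cast; ring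

lemma halfPlaneToSector_ofReal {t : ℝ} (ht : 0 < t) :
    halfPlaneToSector t = (((t ^ 2 + 1) ^ (1 / 4 : ℝ) : ℝ) : ℂ) := by
  refine halfPlaneToSector_of_arg_add_eq_zero ?_ (by positivity) (by push_cast; ring)
  rw [arg_ofReal_add_I ht, arg_ofReal_sub_I ht, add_neg_cancel]

/-- `arg (ζ + i) - arg (ζ - i)` is `π` times the harmonic measure of the segment `[-i, i]` in the
right half-plane. Given a function which is at most `1` on the sector `|arg z| ≤ π / 4` and at most
`exp (-L)` on the segment `[0, K]`, this is the resulting two-constants estimate. -/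
lemma norm_le_exp_neg_of_sector {h : ℂ → ℂ} (hd : Differentiable ℂ h) (h0 : h 0 = 0)
    (hb : ∀ z : ℂ, |z.im| ≤ z.re → ‖h z‖ ≤ 1) {K L : ℝ} (hK : 0 < K) (hL : 0 ≤ L)
    (hs : ∀ x ∈ Set.Icc 0 K, ‖h x‖ ≤ Real.exp (-L)) {t : ℝ} (ht : 0 < t) :
    ‖h ((K * (t ^ 2 + 1) ^ (1 / 4 : ℝ) : ℝ))‖ ≤
      Real.exp (-(L * (2 / π * Real.arctan (1 / t)))) := by
  have hπ := Real.pi_pos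
  let W : ℂ → ℂ := fun ζ => L / π * (-I * (log (ζ + I) - log (ζ - I)))
  let g : ℂ → ℂ := fun ζ => h (K * halfPlaneToSector ζ)
  have hW : ∀ ζ, (W ζ).re = L / π * (arg (ζ + I) - arg (ζ - I)) := by
    intro ζ
    have : W ζ = ((L / π : ℝ) : ℂ) * (-I * (log (ζ + I) - log (ζ - I))) := by
      simp [W]
    rw [this, re_ofReal_mul]
    simp [log_im]
  have hWn : ∀ ζ, ‖exp (W ζ)‖ ≤ Real.exp (2 * L) := by
    intro ζ
    rw [Complex.norm_exp, hW]
    refine Real.exp_le_exp.2 ?_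
    calc L / π * (arg (ζ + I) - arg (ζ - I)) ≤ L / π * (2 * π) := by
          gcongr
          linarith [arg_le_pi (ζ + I), neg_pi_lt_arg (ζ - I)]
      _ = 2 * L := by field_simp
  have hg : ∀ ζ : ℂ, 0 ≤ ζ.re → ‖g ζ‖ ≤ 1 := by
    intro ζ hζ
    refine hb _ ?_
    rw [im_ofReal_mul, re_ofReal_mul, abs_mul, abs_of_pos hK]
    gcongr
    exact abs_im_halfPlaneToSector_le_re hζ
  have hgc : ∀ ζ : ℂ, 0 ≤ ζ.re → ContinuousAt g ζ := fun ζ hζ =>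
    hd.continuous.continuousAt.comp
      (continuousAt_const.mul (continuousAt_halfPlaneToSector hζ))
  have hgz : ∀ ζ : ℂ, ζ + I = 0 ∨ ζ - I = 0 → g ζ = 0 := by
    rintro ζ (h | h) <;> simp [g, halfPlaneToSector, h, h0]
  have hlim : ∀ ζ : ℂ, 0 ≤ ζ.re → g ζ = 0 → ContinuousAt (fun ζ => g ζ * exp (W ζ)) ζ := by
    intro ζ hζ hz
    have h1 : Tendsto (fun z => ‖g z‖ * Real.exp (2 * L)) (𝓝 ζ) (𝓝 0) := by
      have := ((hgc ζ hζ).norm.tendsto).mul_const (Real.exp (2 * L))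
      simpa [hz] using this
    rw [ContinuousAt, hz, zero_mul]
    refine squeeze_zero_norm (fun z => ?_) h1
    rw [norm_mul]
    gcongr
    exact hWn z
  have hcont : ∀ ζ : ℂ, 0 ≤ ζ.re → ContinuousAt (fun ζ => g ζ * exp (W ζ)) ζ := by
    intro ζ hζ
    by_cases hz : ζ + I = 0 ∨ ζ - I = 0
    · exact hlim ζ hζ (hgz ζ hz)
    push Not at hz
    have hslit : ∀ w : ℂ, 0 ≤ w.re → w ≠ 0 → w ∈ slitPlane := by
      intro w hw hw0
      rw [mem_slitPlane_iff]
      by_contra! hc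
      exact hw0 (Complex.ext (le_antisymm hc.1 hw) hc.2)
    have h1 : ContinuousAt (fun ζ => log (ζ + I)) ζ :=
      ContinuousAt.clog (by fun_prop) (hslit _ (by simpa using hζ) hz.1)
    have h2 : ContinuousAt (fun ζ => log (ζ - I)) ζ :=
      ContinuousAt.clog (by fun_prop) (hslit _ (by simpa using hζ) hz.2)
    exact (hgc ζ hζ).mul (continuousAt_const.mul (continuousAt_const.mul (h1.sub h2))).cexp
  have hdiff : ∀ ζ : ℂ, 0 < ζ.re → DifferentiableAt ℂ (fun ζ => g ζ * exp (W ζ)) ζ := by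
    intro ζ hζ
    have h1 : DifferentiableAt ℂ (fun ζ => log (ζ + I)) ζ :=
      DifferentiableAt.clog (by fun_prop) (Or.inl (by simpa using hζ))
    have h2 : DifferentiableAt ℂ (fun ζ => log (ζ - I)) ζ :=
      DifferentiableAt.clog (by fun_prop) (Or.inl (by simpa using hζ))
    have h3 : DifferentiableAt ℂ g ζ :=
      (hd _).comp ζ ((differentiableAt_const _).mul (differentiableAt_halfPlaneToSector hζ))
    exact h3.mul ((differentiableAt_const _).mul
      ((differentiableAt_const _).mul (h1.sub h2))).cexp
  have hbound : ∀ ζ : ℂ, 0 ≤ ζ.re → ‖g ζ * exp (W ζ)‖ ≤ Real.exp (2 * L) := by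
    intro ζ hζ
    rw [norm_mul]
    exact (mul_le_mul (hg ζ hζ) (hWn ζ) (norm_nonneg _) zero_le_one).trans_eq (one_mul _)
  have hmain : ‖g t * exp (W t)‖ ≤ 1 := by
    refine PhragmenLindelof.right_half_plane_of_bounded_on_real
      (f := fun ζ => g ζ * exp (W ζ)) ⟨?_, ?_⟩ ?_ ?_ ?_ (by simpa using ht.le)
    · exact fun ζ hζ => (hdiff ζ hζ).differentiableWithinAt
    · rw [closure_setOfPred_lt_re]
      exact fun ζ hζ => (hcont ζ hζ).continuousWithinAt
    · refine ⟨1, by norm_num, 0, ?_⟩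
      refine Asymptotics.IsBigO.of_bound (Real.exp (2 * L)) ?_
      refine Filter.Eventually.filter_mono inf_le_right ?_
      rw [eventually_principal]
      intro ζ hζ
      simpa using hbound ζ (le_of_lt hζ)
    · refine isBoundedUnder_of_eventually_le (a := Real.exp (2 * L)) ?_
      filter_upwards [eventually_ge_atTop 0] with x hx
      exact hbound x (by simpa using hx)
    · intro η
      have hre : 0 ≤ ((η : ℂ) * I).re := by simp
      rw [norm_mul, Complex.norm_exp, hW]
      rcases lt_trichotomy |η| 1 with hη | hη | hη
      · have hη' := abs_lt.1 hη
        rw [arg_mul_I_add_I hη'.1, arg_mul_I_sub_I hη'.2]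
        have h1 : ‖g (η * I)‖ ≤ Real.exp (-L) := by
          simp only [g]
          rw [halfPlaneToSector_mul_I hη, ← ofReal_mul]
          have h2 : (1 - η ^ 2) ^ (1 / 4 : ℝ) ≤ 1 :=
            Real.rpow_le_one (by nlinarith) (by nlinarith) (by norm_num)
          have h3 : 0 ≤ (1 - η ^ 2) ^ (1 / 4 : ℝ) := Real.rpow_nonneg (by nlinarith) _
          exact hs _ ⟨by positivity, by nlinarith⟩
        calc ‖g (η * I)‖ * Real.exp (L / π * (π / 2 - -(π / 2)))
            ≤ Real.exp (-L) * Real.exp (L / π * (π / 2 - -(π / 2))) := by gcongr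
          _ = 1 := by
            rw [← Real.exp_add, Real.exp_eq_one_iff]
            field_simp
            ring
      · have : g (η * I) = 0 := by
          refine hgz _ ?_
          rcases eq_or_eq_neg_of_abs_eq hη with rfl | rfl <;> simp
        simp [this]
      · have : arg (η * I + I) - arg (η * I - I) = 0 := by
          rcases lt_abs.1 hη with h | h
          · rw [arg_mul_I_add_I (by linarith), arg_mul_I_sub_I_of_lt h, sub_self]
          · rw [arg_mul_I_add_I_of_lt (by linarith), arg_mul_I_sub_I (by linarith), sub_self]
        rw [this]
        simpa using hg _ hre
  rw [norm_mul, Complex.norm_exp, hW, arg_ofReal_add_I ht, arg_ofReal_sub_I ht] at hmain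
  simp only [g] at hmain
  rw [halfPlaneToSector_ofReal ht, ← ofReal_mul] at hmain
  rw [Real.exp_neg, ← one_div, le_div_iff₀ (Real.exp_pos _)]
  have hL2 : L * (2 / π * Real.arctan (1 / t)) =
      L / π * (Real.arctan (1 / t) - -Real.arctan (1 / t)) := by ring
  rwa [hL2]

end TwoConstants

section OscillatoryIntegral

open Complex
open scoped Interval

lemma norm_cexp_I_mul_mul_ofReal_le {z : ℂ} {x R : ℝ} (hx : |x| ≤ R) :
    ‖cexp (I * z * x)‖ ≤ Real.exp (R * |z.im|) := by
  rw [Complex.norm_exp]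
  refine Real.exp_le_exp.2 ?_
  have : (I * z * x).re = x * -z.im := by simp; ring
  rw [this]
  calc x * -z.im ≤ |x * -z.im| := le_abs_self _
    _ = |x| * |z.im| := by rw [abs_mul, abs_neg]
    _ ≤ R * |z.im| := by gcongr

variable {a b R : ℝ} {φ : ℝ → ℝ} {m : ℝ → ℂ}

lemma intervalIntegrable_cexp_mul (hφ : Measurable φ) (hR : ∀ y ∈ Ι a b, |φ y| ≤ R)
    (hm : IntervalIntegrable m volume a b) (z : ℂ) :
    IntervalIntegrable (fun y => cexp (I * z * φ y) * m y) volume a b := by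
  refine (hm.norm.const_mul (Real.exp (R * |z.im|))).mono_fun ?_ ?_
  · exact (Measurable.aestronglyMeasurable (by fun_prop)).mul hm.aestronglyMeasurable_restrict_uIoc
  · refine (ae_restrict_mem measurableSet_uIoc).mono fun y hy => ?_
    simp only [norm_mul, norm_norm, Real.norm_of_nonneg (Real.exp_pos _).le]
    gcongr
    exact norm_cexp_I_mul_mul_ofReal_le (hR y hy)

lemma differentiable_integral_cexp_mul (hφ : Measurable φ) (hR : ∀ y ∈ Ι a b, |φ y| ≤ R)
    (hm : IntervalIntegrable m volume a b) :
    Differentiable ℂ fun z : ℂ => ∫ y in a..b, cexp (I * z * φ y) * m y := by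
  intro z₀
  have hmeas : ∀ z : ℂ, AEStronglyMeasurable (fun y => cexp (I * z * φ y) * m y)
      (volume.restrict (Ι a b)) := fun z =>
    (intervalIntegrable_cexp_mul hφ hR hm z).aestronglyMeasurable_restrict_uIoc
  refine (intervalIntegral.hasDerivAt_integral_of_dominated_loc_of_deriv_le
    (F' := fun z y => I * φ y * (cexp (I * z * φ y) * m y))
    (bound := fun y => |R| * Real.exp (|R| * (|z₀.im| + 1)) * ‖m y‖)
    (Metric.ball_mem_nhds z₀ one_pos) (Filter.Eventually.of_forall hmeas)
    (intervalIntegrable_cexp_mul hφ hR hm z₀) ?_ ?_ ?_ ?_).2.differentiableAt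
  · exact (Measurable.aestronglyMeasurable (by fun_prop)).mul (hmeas z₀)
  · refine Filter.Eventually.of_forall fun y hy z hz => ?_
    have hφ' : |φ y| ≤ |R| := (hR y hy).trans (le_abs_self R)
    have hz' : |z.im| ≤ |z₀.im| + 1 := by
      have h1 : |z.im - z₀.im| ≤ ‖z - z₀‖ := by simpa using abs_im_le_norm (z - z₀)
      have h2 : ‖z - z₀‖ < 1 := by simpa [dist_eq_norm] using hz
      linarith [abs_sub_abs_le_abs_sub z.im z₀.im]
    rw [norm_mul, norm_mul, norm_mul, norm_I, one_mul, norm_real, Real.norm_eq_abs, ← mul_assoc]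
    gcongr
    exact (norm_cexp_I_mul_mul_ofReal_le hφ').trans (by gcongr)
  · exact hm.norm.const_mul _
  · refine Filter.Eventually.of_forall fun y _ z _ => ?_
    have h1 : HasDerivAt (fun z : ℂ => I * z * φ y) (I * φ y) z := by
      simpa using ((hasDerivAt_id z).const_mul I).mul_const (φ y : ℂ)
    exact (h1.cexp.mul_const (m y)).congr_deriv (by ring)

lemma norm_integral_cexp_mul_le (hab : a ≤ b) (hR : ∀ y ∈ Ι a b, |φ y| ≤ R)
    (hm : IntervalIntegrable m volume a b) (z : ℂ) :
    ‖∫ y in a..b, cexp (I * z * φ y) * m y‖ ≤ Real.exp (R * |z.im|) * ∫ y in a..b, ‖m y‖ := by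
  rw [← intervalIntegral.integral_const_mul]
  refine intervalIntegral.norm_integral_le_of_norm_le hab ?_ (hm.norm.const_mul _)
  refine Filter.Eventually.of_forall fun y hy => ?_
  rw [norm_mul]
  gcongr
  exact norm_cexp_I_mul_mul_ofReal_le (hR y (by rwa [uIoc_of_le hab]))

end OscillatoryIntegral

section WaveField

open Complex

/-- If `ω g(ω, y)` is a sum of two oscillatory terms with phases bounded by `R` and amplitudes
bounded by `A`, then `ω ∫ g(ω, y) f(y) dy` extends to an entire function of exponential type. -/
lemma exists_entire_extension {g : ℝ → ℝ → ℂ} {α β f : ℝ → ℂ} {φ ψ : ℝ → ℝ} {A R a b : ℝ}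
    (hab : a ≤ b) (hα : Measurable α) (hβ : Measurable β) (hφ : Measurable φ) (hψ : Measurable ψ)
    (hf : IntervalIntegrable f volume a b)
    (hαA : ∀ y, ‖α y‖ ≤ A) (hβA : ∀ y, ‖β y‖ ≤ A)
    (hφR : ∀ y ∈ Ioc a b, |φ y| ≤ R) (hψR : ∀ y ∈ Ioc a b, |ψ y| ≤ R)
    (hg : ∀ ω : ℝ, ω ≠ 0 → ∀ y ∈ Ioc a b, ω * g ω y =
      α y * cexp (I * ω * φ y) + β y * cexp (I * ω * ψ y)) :
    ∃ F : ℂ → ℂ, Differentiable ℂ F ∧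
      (∀ z, ‖F z‖ ≤ 2 * A * (∫ y in a..b, ‖f y‖) * Real.exp (R * |z.im|)) ∧
      ∀ ω : ℝ, ω ≠ 0 → ω * (∫ y in a..b, g ω y * f y) = F ω := by
  rw [← uIoc_of_le hab] at hφR hψR hg
  have hint : ∀ γ : ℝ → ℂ, Measurable γ → (∀ y, ‖γ y‖ ≤ A) →
      IntervalIntegrable (fun y => γ y * f y) volume a b := by
    intro γ hγ hγA
    refine (hf.norm.const_mul A).mono_fun
      (hγ.aestronglyMeasurable.mul hf.aestronglyMeasurable_restrict_uIoc) ?_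
    refine Filter.Eventually.of_forall fun y => ?_
    have hA : 0 ≤ A := (norm_nonneg _).trans (hγA y)
    simp only [norm_mul, norm_norm, Real.norm_of_nonneg hA]
    gcongr
    exact hγA y
  have hle : ∀ γ : ℝ → ℂ, Measurable γ → (∀ y, ‖γ y‖ ≤ A) →
      ∫ y in a..b, ‖γ y * f y‖ ≤ A * ∫ y in a..b, ‖f y‖ := by
    intro γ hγ hγA
    rw [← intervalIntegral.integral_const_mul]
    refine intervalIntegral.integral_mono_on hab (hint γ hγ hγA).norm (hf.norm.const_mul A) ?_
    intro y _
    rw [norm_mul]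
    gcongr
    exact hγA y
  have iα := hint α hα hαA
  have iβ := hint β hβ hβA
  refine ⟨fun z => (∫ y in a..b, cexp (I * z * φ y) * (α y * f y)) +
    ∫ y in a..b, cexp (I * z * ψ y) * (β y * f y),
    (differentiable_integral_cexp_mul hφ hφR iα).add (differentiable_integral_cexp_mul hψ hψR iβ),
    fun z => ?_, fun ω hω => ?_⟩
  · refine (norm_add_le _ _).trans ?_
    have h1 := norm_integral_cexp_mul_le hab hφR iα z
    have h2 := norm_integral_cexp_mul_le hab hψR iβ z
    have h3 := mul_le_mul_of_nonneg_left (hle α hα hαA) (Real.exp_pos (R * |z.im|)).le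
    have h4 := mul_le_mul_of_nonneg_left (hle β hβ hβA) (Real.exp_pos (R * |z.im|)).le
    linarith
  · dsimp only
    rw [← intervalIntegral.integral_add (intervalIntegrable_cexp_mul hφ hφR iα ω)
      (intervalIntegrable_cexp_mul hψ hψR iβ ω), ← intervalIntegral.integral_const_mul]
    refine intervalIntegral.integral_congr_ae (Filter.Eventually.of_forall fun y hy => ?_)
    rw [← mul_assoc, hg ω hω y hy]
    ring

lemma exists_entire_waveField_one {c₁ c₂ : ℝ} (hc₁ : 0 < c₁) (hc₂ : 0 < c₂) {f : ℝ → ℂ}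
    (hf : IntervalIntegrable f volume (-1) 1) :
    ∃ F : ℂ → ℂ, Differentiable ℂ F ∧
      (∀ z, ‖F z‖ ≤ 2 * (1 / c₁ + 1 / c₂) * (∫ y in (-1:ℝ)..1, ‖f y‖) *
        Real.exp (2 * max c₁ c₂ * |z.im|)) ∧
      ∀ ω : ℝ, ω ≠ 0 → ω * waveField c₁ c₂ f 1 ω = F ω := by
  have hm₁ := le_max_left c₁ c₂
  have hm₂ := le_max_right c₁ c₂
  have hsum : ‖(c₁ + c₂ : ℂ)‖ = c₁ + c₂ := by
    rw [← ofReal_add, norm_real, Real.norm_of_nonneg (by positivity)]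
  have hp₁ : 0 < 1 / c₁ := by positivity
  have hp₂ : 0 < 1 / c₂ := by positivity
  have h1 : (c₁ : ℂ) ≠ 0 := by exact_mod_cast hc₁.ne'
  have h2 : (c₁ + c₂ : ℂ) ≠ 0 := by exact_mod_cast (add_pos hc₁ hc₂).ne'
  refine exists_entire_extension (g := fun ω y => greenFn c₁ c₂ ω 1 y)
    (α := fun y => if 0 < y then I * (c₁ - c₂) / (2 * c₁ * (c₁ + c₂)) else I / (c₁ + c₂))
    (β := fun y => if 0 < y then I / (2 * c₁) else 0)
    (φ := fun y => if 0 < y then c₁ * (1 + y) else c₁ - c₂ * y)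
    (ψ := fun y => c₁ * (1 - y)) (by norm_num)
    (Measurable.ite measurableSet_Ioi measurable_const measurable_const)
    (Measurable.ite measurableSet_Ioi measurable_const measurable_const)
    (Measurable.ite measurableSet_Ioi (by fun_prop) (by fun_prop)) (by fun_prop) hf ?_ ?_ ?_ ?_ ?_
  · intro y
    split_ifs
    · rw [norm_div, norm_mul, norm_mul, norm_mul, norm_I, hsum, ← ofReal_sub, norm_real, norm_real,
        Real.norm_eq_abs, Real.norm_of_nonneg hc₁.le, one_mul, RCLike.norm_ofNat]
      calc |c₁ - c₂| / (2 * c₁ * (c₁ + c₂)) ≤ (c₁ + c₂) / (2 * c₁ * (c₁ + c₂)) := by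
            gcongr
            rw [abs_le]
            constructor <;> linarith
        _ = 1 / c₁ / 2 := by field_simp
        _ ≤ 1 / c₁ + 1 / c₂ := by linarith
    · rw [norm_div, norm_I, hsum]
      have : 1 / (c₁ + c₂) ≤ 1 / c₁ := by gcongr; linarith
      linarith
  · intro y
    split_ifs
    · rw [norm_div, norm_mul, norm_I, norm_real, Real.norm_of_nonneg hc₁.le, RCLike.norm_ofNat]
      have : 1 / (2 * c₁) = 1 / c₁ / 2 := by field_simp
      linarith
    · rw [norm_zero]
      positivity
  · intro y hy
    split_ifs with h <;> rw [abs_le] <;> constructor <;> nlinarith [hy.1, hy.2]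
  · intro y hy
    rw [abs_le]
    constructor <;> nlinarith [hy.1, hy.2]
  · intro ω hω y hy
    have h3 : (ω : ℂ) ≠ 0 := by exact_mod_cast hω
    by_cases h : 0 < y
    · simp only [greenFn, h, if_true, zero_lt_one]
      rw [abs_of_nonneg (by linarith [hy.2]),
        show I * (c₁ * ω) * (((1 : ℝ) : ℂ) + y) = I * ω * ((c₁ * (1 + y) : ℝ) : ℂ) by
          push_cast; ring,
        show I * (c₁ * ω) * ((1 - y : ℝ) : ℂ) = I * ω * ((c₁ * (1 - y) : ℝ) : ℂ) by
          push_cast; ring]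
      field_simp
    · simp only [greenFn, h, if_false, show ¬ ((1 : ℝ) < 0) by norm_num]
      rw [show I * (-(c₂ * ω) * y + c₁ * ω * ((1 : ℝ) : ℂ)) = I * ω * ((c₁ - c₂ * y : ℝ) : ℂ) by
          push_cast; ring]
      field_simp
      ring

lemma exists_entire_waveField_neg_one {c₁ c₂ : ℝ} (hc₁ : 0 < c₁) (hc₂ : 0 < c₂) {f : ℝ → ℂ}
    (hf : IntervalIntegrable f volume (-1) 1) :
    ∃ F : ℂ → ℂ, Differentiable ℂ F ∧
      (∀ z, ‖F z‖ ≤ 2 * (1 / c₁ + 1 / c₂) * (∫ y in (-1:ℝ)..1, ‖f y‖) *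
        Real.exp (2 * max c₁ c₂ * |z.im|)) ∧
      ∀ ω : ℝ, ω ≠ 0 → ω * waveField c₁ c₂ f (-1) ω = F ω := by
  have hm₁ := le_max_left c₁ c₂
  have hm₂ := le_max_right c₁ c₂
  have hsum : ‖(c₁ + c₂ : ℂ)‖ = c₁ + c₂ := by
    rw [← ofReal_add, norm_real, Real.norm_of_nonneg (by positivity)]
  have hp₁ : 0 < 1 / c₁ := by positivity
  have hp₂ : 0 < 1 / c₂ := by positivity
  have h1 : (c₂ : ℂ) ≠ 0 := by exact_mod_cast hc₂.ne'
  have h2 : (c₁ + c₂ : ℂ) ≠ 0 := by exact_mod_cast (add_pos hc₁ hc₂).ne'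
  refine exists_entire_extension (g := fun ω y => greenFn c₁ c₂ ω (-1) y)
    (α := fun y => if 0 < y then I / (c₁ + c₂) else I * (c₂ - c₁) / (2 * c₂ * (c₁ + c₂)))
    (β := fun y => if 0 < y then 0 else I / (2 * c₂))
    (φ := fun y => if 0 < y then c₁ * y + c₂ else c₂ * (1 - y))
    (ψ := fun y => c₂ * (1 + y)) (by norm_num)
    (Measurable.ite measurableSet_Ioi measurable_const measurable_const)
    (Measurable.ite measurableSet_Ioi measurable_const measurable_const)
    (Measurable.ite measurableSet_Ioi (by fun_prop) (by fun_prop)) (by fun_prop) hf ?_ ?_ ?_ ?_ ?_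
  · intro y
    split_ifs
    · rw [norm_div, norm_I, hsum]
      have : 1 / (c₁ + c₂) ≤ 1 / c₁ := by gcongr; linarith
      linarith
    · rw [norm_div, norm_mul, norm_mul, norm_mul, norm_I, hsum, ← ofReal_sub, norm_real, norm_real,
        Real.norm_eq_abs, Real.norm_of_nonneg hc₂.le, one_mul, RCLike.norm_ofNat]
      calc |c₂ - c₁| / (2 * c₂ * (c₁ + c₂)) ≤ (c₁ + c₂) / (2 * c₂ * (c₁ + c₂)) := by
            gcongr
            rw [abs_le]
            constructor <;> linarith
        _ = 1 / c₂ / 2 := by field_simp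
        _ ≤ 1 / c₁ + 1 / c₂ := by linarith
  · intro y
    split_ifs
    · rw [norm_zero]
      positivity
    · rw [norm_div, norm_mul, norm_I, norm_real, Real.norm_of_nonneg hc₂.le, RCLike.norm_ofNat]
      have : 1 / (2 * c₂) = 1 / c₂ / 2 := by field_simp
      linarith
  · intro y hy
    split_ifs with h <;> rw [abs_le] <;> constructor <;> nlinarith [hy.1, hy.2]
  · intro y hy
    rw [abs_le]
    constructor <;> nlinarith [hy.1, hy.2]
  · intro ω hω y hy
    have h3 : (ω : ℂ) ≠ 0 := by exact_mod_cast hω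
    by_cases h : 0 < y
    · simp only [greenFn, h, if_true, if_false, show ¬ ((0 : ℝ) < -1) by norm_num]
      rw [show I * (c₁ * ω * y - c₂ * ω * ((-1 : ℝ) : ℂ)) = I * ω * ((c₁ * y + c₂ : ℝ) : ℂ) by
          push_cast; ring]
      field_simp
      ring
    · simp only [greenFn, h, if_false, if_true, show (-1 : ℝ) < 0 by norm_num]
      rw [abs_of_nonpos (by linarith [hy.1]),
        show -I * (c₂ * ω) * (((-1 : ℝ) : ℂ) + y) = I * ω * ((c₂ * (1 - y) : ℝ) : ℂ) by
          push_cast; ring,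
        show I * (c₂ * ω) * ((-(-1 - y) : ℝ) : ℂ) = I * ω * ((c₂ * (1 + y) : ℝ) : ℂ) by
          push_cast; ring]
      field_simp

end WaveField

section Continuation

open Complex ComplexConjugate

/-- The energy `∫₀ˢ |F₁|² + |F₂|²` of two entire functions of exponential type `2 c` extends to an
entire function which is `O(e^{5 c Re z})` in the sector `|arg z| ≤ π / 4`. -/
lemma exists_entire_energy {F₁ F₂ : ℂ → ℂ} {N c : ℝ} (hc : 0 < c)
    (d₁ : Differentiable ℂ F₁) (d₂ : Differentiable ℂ F₂)
    (b₁ : ∀ z, ‖F₁ z‖ ≤ N * Real.exp (2 * c * |z.im|))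
    (b₂ : ∀ z, ‖F₂ z‖ ≤ N * Real.exp (2 * c * |z.im|)) :
    ∃ H : ℂ → ℂ, Differentiable ℂ H ∧ H 0 = 0 ∧
      (∀ s : ℝ, H s = ((∫ ω in (0:ℝ)..s, (‖F₁ ω‖ ^ 2 + ‖F₂ ω‖ ^ 2) : ℝ) : ℂ)) ∧
      ∀ z : ℂ, |z.im| ≤ z.re → ‖H z‖ ≤ 4 * N ^ 2 / c * Real.exp (5 * c * z.re) := by
  let P : ℂ → ℂ := fun z => F₁ z * conj (F₁ (conj z)) + F₂ z * conj (F₂ (conj z))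
  have hP : Differentiable ℂ P := by
    have h : ∀ F : ℂ → ℂ, Differentiable ℂ F → Differentiable ℂ fun z => conj (F (conj z)) :=
      fun F hF z => differentiableAt_conj_conj_iff.2 (hF _)
    exact (d₁.mul (h F₁ d₁)).add (d₂.mul (h F₂ d₂))
  have hPb : ∀ z, ‖P z‖ ≤ 2 * N ^ 2 * Real.exp (4 * c * |z.im|) := by
    intro z
    have hexp : Real.exp (4 * c * |z.im|) =
        Real.exp (2 * c * |z.im|) * Real.exp (2 * c * |z.im|) := by
      rw [← Real.exp_add]; ring_nf
    have hF : ∀ F : ℂ → ℂ, (∀ z, ‖F z‖ ≤ N * Real.exp (2 * c * |z.im|)) →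
        ‖F z * conj (F (conj z))‖ ≤ N ^ 2 * Real.exp (4 * c * |z.im|) := by
      intro F hF
      have h1 := hF z
      have h2 := hF (conj z)
      rw [conj_im, abs_neg] at h2
      rw [norm_mul, RCLike.norm_conj, hexp]
      calc ‖F z‖ * ‖F (conj z)‖ ≤ N * Real.exp (2 * c * |z.im|) * (N * Real.exp (2 * c * |z.im|)) :=
            mul_le_mul h1 h2 (norm_nonneg _) ((norm_nonneg _).trans h1)
        _ = _ := by ring
    refine (norm_add_le _ _).trans ?_
    linarith [hF F₁ b₁, hF F₂ b₂]
  have hPr : ∀ ω : ℝ, P ω = ((‖F₁ ω‖ ^ 2 + ‖F₂ ω‖ ^ 2 : ℝ) : ℂ) := by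
    intro ω
    simp [P, mul_conj, normSq_eq_norm_sq]
  obtain ⟨G, hG⟩ := hP.isExactOn_univ
  replace hG : ∀ z, HasDerivAt G (P z) z := fun z => hG z trivial
  have hH : ∀ z, HasDerivAt (fun z => G z - G 0) (P z) z := fun z => (hG z).sub_const _
  refine ⟨fun z => G z - G 0, fun z => (hH z).differentiableAt, sub_self _, fun s => ?_,
    fun z hz => ?_⟩
  · rw [← intervalIntegral.integral_ofReal]
    simp_rw [← hPr]
    symm
    have := intervalIntegral.integral_eq_sub_of_hasDerivAt (a := 0) (b := s)
      (f := fun x : ℝ => G x) (f' := fun x : ℝ => P x)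
      (fun x _ => (hG x).comp_ofReal)
      ((hP.continuous.comp continuous_ofReal).intervalIntegrable _ _)
    simpa using this
  · have hre : 0 ≤ z.re := (abs_nonneg _).trans hz
    have hseg : ‖G z - G 0‖ ≤ 2 * N ^ 2 * Real.exp (4 * c * z.re) * ‖z - 0‖ := by
      refine Convex.norm_image_sub_le_of_norm_hasDerivWithin_le
        (s := {w : ℂ | |w.im| ≤ z.re}) (fun w _ => (hG w).hasDerivWithinAt)
        (fun w hw => (hPb w).trans ?_) ?_ (by simpa using hre) hz
      · gcongr
        exact hw
      · have : {w : ℂ | |w.im| ≤ z.re} = imLm ⁻¹' (Icc (-z.re) z.re) := by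
          ext w; simp [abs_le]
        rw [this]
        exact (convex_Icc _ _).linear_preimage imLm
    have hz' : ‖z - 0‖ ≤ 2 * z.re := by
      rw [sub_zero]
      refine (norm_le_abs_re_add_abs_im z).trans ?_
      rw [abs_of_nonneg hre]
      linarith
    have hlin : z.re ≤ 1 / c * Real.exp (c * z.re) := by
      rw [one_div, inv_mul_eq_div, le_div_iff₀ hc]
      linarith [Real.add_one_le_exp (c * z.re)]
    calc ‖G z - G 0‖ ≤ 2 * N ^ 2 * Real.exp (4 * c * z.re) * ‖z - 0‖ := hseg
      _ ≤ 2 * N ^ 2 * Real.exp (4 * c * z.re) * (2 * (1 / c * Real.exp (c * z.re))) := by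
          gcongr
          linarith
      _ = 4 * N ^ 2 / c * (Real.exp (4 * c * z.re) * Real.exp (c * z.re)) := by ring
      _ = 4 * N ^ 2 / c * Real.exp (5 * c * z.re) := by
          rw [← Real.exp_add]; ring_nf

end Continuation

section HarmonicMeasure

/-- The harmonic measure of `(0, K)` at the point `s > K` of the sector `|arg z| < π / 4` slit along
`[0, K]`. -/
noncomputable def slitHarmonicMeasure (K s : ℝ) : ℝ :=
  2 / π * arctan (1 / √((s / K) ^ 4 - 1))

lemma slitHarmonicMeasure_nonneg (K s : ℝ) : 0 ≤ slitHarmonicMeasure K s := by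
  have : 0 ≤ arctan (1 / √((s / K) ^ 4 - 1)) := arctan_nonneg.2 (by positivity)
  unfold slitHarmonicMeasure
  positivity

lemma div_pow_four_sub_one_pos {K s : ℝ} (hK : 0 < K) (hs : K < s) : 0 < (s / K) ^ 4 - 1 :=
  sub_pos.2 (one_lt_pow₀ ((one_lt_div hK).2 hs) (by norm_num))

lemma half_le_arctan {x : ℝ} (h0 : 0 ≤ x) (h1 : x ≤ 1) : x / 2 ≤ arctan x := by
  have hπ := pi_gt_three
  rw [← arctan_tan (x := x / 2) (by linarith) (by linarith)]
  refine arctan_mono ?_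
  have hcos : 1 / 2 ≤ cos (x / 2) := by nlinarith [one_sub_sq_div_two_le_cos (x := x / 2)]
  rw [tan_eq_sin_div_cos, div_le_iff₀ (by linarith)]
  nlinarith [sin_le (show 0 ≤ x / 2 by linarith)]

lemma two_rpow_quarter_pow_four : ((2 : ℝ) ^ ((1 : ℝ) / 4)) ^ 4 = 2 := by
  rw [← rpow_natCast, ← rpow_mul (by norm_num)]
  norm_num

lemma half_le_slitHarmonicMeasure {K s : ℝ} (hK : 0 < K) (hs : K < s)
    (hs' : s < (2 : ℝ) ^ ((1 : ℝ) / 4) * K) : 1 / 2 ≤ slitHarmonicMeasure K s := by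
  have hπ := pi_pos
  have hpos := div_pow_four_sub_one_pos hK hs
  have h2 : (s / K) ^ 4 ≤ 2 := by
    rw [← two_rpow_quarter_pow_four]
    have : 0 ≤ s / K := div_nonneg (hK.trans hs).le hK.le
    gcongr
    exact ((div_lt_iff₀ hK).2 hs').le
  have h3 : 1 ≤ 1 / √((s / K) ^ 4 - 1) := by
    rw [le_div_iff₀ (sqrt_pos.2 hpos), one_mul, sqrt_le_iff]
    constructor <;> linarith
  have h4 : π / 4 ≤ arctan (1 / √((s / K) ^ 4 - 1)) := arctan_one ▸ arctan_mono h3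
  calc (1 : ℝ) / 2 = 2 / π * (π / 4) := by field_simp; norm_num
    _ ≤ slitHarmonicMeasure K s := by unfold slitHarmonicMeasure; gcongr

lemma le_slitHarmonicMeasure {K s : ℝ} (hK : 0 < K) (hs : (2 : ℝ) ^ ((1 : ℝ) / 4) * K < s) :
    1 / π * ((s / K) ^ 4 - 1) ^ (-(1 : ℝ) / 2) ≤ slitHarmonicMeasure K s := by
  have hπ := pi_pos
  have h2 : 2 ≤ (s / K) ^ 4 := by
    rw [← two_rpow_quarter_pow_four]
    gcongr
    exact ((lt_div_iff₀ hK).2 hs).le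
  have h3 : 1 / √((s / K) ^ 4 - 1) ≤ 1 := by
    rw [div_le_one (sqrt_pos.2 (by linarith)), one_le_sqrt]
    linarith
  have h4 := half_le_arctan (by positivity) h3
  have h5 : ((s / K) ^ 4 - 1) ^ (-(1 : ℝ) / 2) = 1 / √((s / K) ^ 4 - 1) := by
    rw [neg_div, rpow_neg (by linarith), ← sqrt_eq_rpow, one_div]
  rw [h5]
  calc 1 / π * (1 / √((s / K) ^ 4 - 1)) = 2 / π * (1 / √((s / K) ^ 4 - 1) / 2) := by ring
    _ ≤ slitHarmonicMeasure K s := by unfold slitHarmonicMeasure; gcongr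

/-- Two-constants estimate for an entire function in the sector `|arg z| ≤ π / 4` slit along
`[0, K]`. -/
lemma norm_le_rpow_slitHarmonicMeasure {h : ℂ → ℂ} (hd : Differentiable ℂ h) (h0 : h 0 = 0)
    (hb : ∀ z : ℂ, |z.im| ≤ z.re → ‖h z‖ ≤ 1) {K ε : ℝ} (hK : 0 < K) (hε : 0 < ε)
    (hs : ∀ x ∈ Set.Icc 0 K, ‖h x‖ ≤ ε ^ 2) {s : ℝ} (hKs : K < s) :
    ‖h s‖ ≤ ε ^ (2 * slitHarmonicMeasure K s) := by
  have hs0 : 0 < s := hK.trans hKs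
  rcases le_total 1 ε with h1 | h1
  · exact (hb s (by simpa using hs0.le)).trans
      (one_le_rpow h1 (mul_nonneg zero_le_two (slitHarmonicMeasure_nonneg K s)))
  have hpos := div_pow_four_sub_one_pos hK hKs
  have hexp : Real.exp (-(-(2 * log ε))) = ε ^ 2 := by
    rw [neg_neg, two_mul, exp_add, exp_log hε, sq]
  have key := norm_le_exp_neg_of_sector hd h0 hb hK (L := -(2 * log ε))
    (by linarith [log_nonpos hε.le h1]) (by rwa [hexp]) (sqrt_pos.2 hpos)
  have hpt : K * (√((s / K) ^ 4 - 1) ^ 2 + 1) ^ (1 / 4 : ℝ) = s := by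
    rw [sq_sqrt hpos.le, sub_add_cancel, ← rpow_natCast, ← rpow_mul (by positivity)]
    norm_num
    field_simp
  rw [hpt] at key
  rw [rpow_def_of_pos hε]
  convert key using 2
  unfold slitHarmonicMeasure
  ring

end HarmonicMeasure

lemma integral_norm_le_of_sobolevNormSq_le {n : ℕ} {f : ℝ → ℂ} {M : ℝ} (hM : 0 < M)
    (hf : Continuous f) (h : sobolevNormSq n (-1) 1 f ≤ M ^ 2) :
    ∫ y in (-1:ℝ)..1, ‖f y‖ ≤ 3 / 2 * M := by
  have hL2 : ∫ y in (-1:ℝ)..1, ‖f y‖ ^ 2 ≤ M ^ 2 := by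
    refine le_trans ?_ h
    have := Finset.single_le_sum (f := fun k => ∫ y in (-1:ℝ)..1, ‖iteratedDeriv k f y‖ ^ 2)
      (fun k _ => intervalIntegral.integral_nonneg (by norm_num) fun y _ => by positivity)
      (Finset.mem_range.2 n.succ_pos)
    simpa [sobolevNormSq] using this
  have hint : ∀ g : ℝ → ℝ, Continuous g → IntervalIntegrable g volume (-1) 1 :=
    fun g hg => hg.intervalIntegrable _ _
  calc ∫ y in (-1:ℝ)..1, ‖f y‖ ≤ ∫ y in (-1:ℝ)..1, (M / 2 + 1 / (2 * M) * ‖f y‖ ^ 2) := by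
        refine intervalIntegral.integral_mono_on (by norm_num) (hint _ (by fun_prop))
          (hint _ (by fun_prop)) fun y _ => ?_
        have h1 : M / 2 + 1 / (2 * M) * ‖f y‖ ^ 2 - ‖f y‖ = (M - ‖f y‖) ^ 2 / (2 * M) := by
          field_simp
          ring
        have h2 : 0 ≤ (M - ‖f y‖) ^ 2 / (2 * M) := by positivity
        linarith
    _ = M + 1 / (2 * M) * ∫ y in (-1:ℝ)..1, ‖f y‖ ^ 2 := by
        rw [intervalIntegral.integral_add (hint _ (by fun_prop)) (hint _ (by fun_prop)),
          intervalIntegral.integral_const_mul, intervalIntegral.integral_const, smul_eq_mul]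
        ring
    _ ≤ M + 1 / (2 * M) * M ^ 2 := by gcongr
    _ = 3 / 2 * M := by field_simp; ring

/-- The data integral of a layered medium is the restriction of an entire function with
controlled growth in the sector `|arg z| ≤ π / 4`. -/
lemma exists_entire_data {c₁ c₂ : ℝ} (hc₁ : 0 < c₁) (hc₂ : 0 < c₂) {n : ℕ} {f : ℝ → ℂ} {M : ℝ}
    (hM : 0 < M) (hf : Continuous f) (h : sobolevNormSq n (-1) 1 f ≤ M ^ 2) :
    ∃ H : ℂ → ℂ, Differentiable ℂ H ∧ H 0 = 0 ∧
      (∀ s : ℝ, H s = ((∫ ω in (0:ℝ)..s, ω ^ 2 *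
        (‖waveField c₁ c₂ f (-1) ω‖ ^ 2 + ‖waveField c₁ c₂ f 1 ω‖ ^ 2) : ℝ) : ℂ)) ∧
      (∀ s t : ℝ, 0 ≤ s → s ≤ t → ‖H s‖ ≤ ‖H t‖) ∧
      ∀ z : ℂ, |z.im| ≤ z.re → ‖H z‖ ≤ 36 * (1 / c₁ + 1 / c₂) ^ 2 / max c₁ c₂ * M ^ 2 *
        Real.exp (5 * max c₁ c₂ * z.re) := by
  have hfi : IntervalIntegrable f volume (-1) 1 := hf.intervalIntegrable _ _
  have hN := integral_norm_le_of_sobolevNormSq_le hM hf h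
  obtain ⟨F₁, d₁, b₁, e₁⟩ := exists_entire_waveField_neg_one hc₁ hc₂ hfi
  obtain ⟨F₂, d₂, b₂, e₂⟩ := exists_entire_waveField_one hc₁ hc₂ hfi
  have hb : ∀ z : ℂ, 2 * (1 / c₁ + 1 / c₂) * (∫ y in (-1:ℝ)..1, ‖f y‖) *
      Real.exp (2 * max c₁ c₂ * |z.im|) ≤
      (3 * (1 / c₁ + 1 / c₂) * M) * Real.exp (2 * max c₁ c₂ * |z.im|) := by
    intro z
    refine mul_le_mul_of_nonneg_right ?_ (Real.exp_pos _).le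
    calc 2 * (1 / c₁ + 1 / c₂) * (∫ y in (-1:ℝ)..1, ‖f y‖)
        ≤ 2 * (1 / c₁ + 1 / c₂) * (3 / 2 * M) := by gcongr
      _ = 3 * (1 / c₁ + 1 / c₂) * M := by ring
  obtain ⟨H, hd, h0, hs, hg⟩ := exists_entire_energy (lt_max_of_lt_left hc₁) d₁ d₂
    (fun z => (b₁ z).trans (hb z)) (fun z => (b₂ z).trans (hb z))
  refine ⟨H, hd, h0, fun s => ?_, fun s t hs0 hst => ?_, fun z hz => (hg z hz).trans_eq (by ring)⟩
  · rw [hs]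
    congr 1
    refine intervalIntegral.integral_congr_ae ?_
    have hne : ∀ᵐ ω : ℝ, ω ≠ 0 := by simp [ae_iff]
    filter_upwards [hne] with ω hω _
    rw [← e₁ ω hω, ← e₂ ω hω]
    simp only [norm_mul, Complex.norm_real, mul_pow, Real.norm_eq_abs, sq_abs]
    ring
  · have hcont : Continuous fun ω : ℝ => ‖F₁ ω‖ ^ 2 + ‖F₂ ω‖ ^ 2 := by
      have := d₁.continuous
      have := d₂.continuous
      fun_prop
    have hnn : ∀ ω : ℝ, 0 ≤ ‖F₁ ω‖ ^ 2 + ‖F₂ ω‖ ^ 2 := fun ω => by positivity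
    rw [hs, hs, Complex.norm_real, Complex.norm_real,
      Real.norm_of_nonneg (intervalIntegral.integral_nonneg hs0 fun ω _ => hnn ω),
      Real.norm_of_nonneg (intervalIntegral.integral_nonneg (hs0.trans hst) fun ω _ => hnn ω)]
    exact intervalIntegral.integral_mono_interval le_rfl hs0 hst
      (Filter.Eventually.of_forall hnn) (hcont.intervalIntegrable _ _)

/-- The analytic-continuation estimate for the truncated data integral
`I(s) = ∫_0^s ω²(|u(-1,ω)|² + |u(1,ω)|²) dω`: with `a = max{5 c_max, 3}` and
`ε` the measured data, there are `C = C(c₁, c₂) > 0` and `μ` with `μ ≥ 1/2` on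
`(K, 2^{1/4}K)` and `μ(s) ≥ (1/π)((s/K)^4 - 1)^{-1/2}` on `(2^{1/4}K, ∞)` such that
`I(s) ≤ C M² e^{as} ε^{2μ(s)}` for all `s > K`. -/
theorem truncated_data_bound (c₁ c₂ : ℝ) (hc₁ : 0 < c₁) (hc₂ : 0 < c₂) :
    ∃ C : ℝ, 0 < C ∧
      ∀ (n : ℕ) (M K : ℝ) (f : ℝ → ℂ) (ε a : ℝ),
        1 ≤ n → 1 < M → 1 < K →
        ContDiff ℝ n f → tsupport f ⊆ Set.Ioo (-1:ℝ) 1 →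
        sobolevNormSq n (-1) 1 f ≤ M ^ 2 →
        ε = Real.sqrt (∫ ω in (0:ℝ)..K,
          ω ^ 2 * (‖waveField c₁ c₂ f (-1) ω‖ ^ 2 + ‖waveField c₁ c₂ f 1 ω‖ ^ 2)) →
        0 < ε →
        a = max (5 * max c₁ c₂) 3 →
        ∃ μ : ℝ → ℝ,
          (∀ s ∈ Set.Ioo K ((2:ℝ) ^ ((1:ℝ)/4) * K), (1:ℝ)/2 ≤ μ s) ∧
          (∀ s ∈ Set.Ioi ((2:ℝ) ^ ((1:ℝ)/4) * K),
            (1/π) * ((s/K) ^ 4 - 1) ^ (-(1:ℝ)/2) ≤ μ s) ∧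
          (∀ s ∈ Set.Ioi K,
            (∫ ω in (0:ℝ)..s,
              ω ^ 2 * (‖waveField c₁ c₂ f (-1) ω‖ ^ 2 + ‖waveField c₁ c₂ f 1 ω‖ ^ 2)) ≤
              C * M ^ 2 * Real.exp (a * s) * ε ^ (2 * μ s)) := by
  have hc : 0 < max c₁ c₂ := lt_max_of_lt_left hc₁
  set C := 36 * (1 / c₁ + 1 / c₂) ^ 2 / max c₁ c₂
  have hC0 : 0 ≤ C := by positivity
  refine ⟨C + 1, by positivity, ?_⟩
  intro n M K f ε a _ hM hK hf _ hsob hεdef hε ha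
  have hK0 : 0 < K := zero_lt_one.trans hK
  obtain ⟨H, hd, h0, hs, hmono, hg⟩ :=
    exists_entire_data hc₁ hc₂ (zero_lt_one.trans hM) hf.continuous hsob
  refine ⟨slitHarmonicMeasure K, fun s hs => half_le_slitHarmonicMeasure hK0 hs.1 hs.2,
    fun s hs => le_slitHarmonicMeasure hK0 hs, fun s hKs => ?_⟩
  rw [Set.mem_Ioi] at hKs
  have hM2 : 1 ≤ M ^ 2 := one_le_pow₀ hM.le
  have hD1 : 1 ≤ (C + 1) * M ^ 2 := one_le_mul_of_one_le_of_one_le (by linarith) hM2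
  have hD : 0 < (C + 1) * M ^ 2 := zero_lt_one.trans_le hD1
  let h : ℂ → ℂ := fun z => H z * Complex.exp (-a * z) / (((C + 1) * M ^ 2 : ℝ) : ℂ)
  have hnorm : ∀ z, ‖h z‖ = ‖H z‖ * Real.exp (-a * z.re) / ((C + 1) * M ^ 2) := by
    intro z
    simp only [h]
    rw [norm_div, norm_mul, Complex.norm_exp, Complex.norm_real, Real.norm_of_nonneg hD.le,
      ← Complex.ofReal_neg, Complex.re_ofReal_mul]
  have hεK : ‖H K‖ = ε ^ 2 := by
    rw [hs, Complex.norm_real, hεdef, Real.sq_sqrt, Real.norm_of_nonneg] <;>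
    exact intervalIntegral.integral_nonneg hK0.le fun ω _ => by positivity
  have ha5 : 5 * max c₁ c₂ ≤ a := ha ▸ le_max_left _ _
  have key : ‖h s‖ ≤ ε ^ (2 * slitHarmonicMeasure K s) := by
    refine norm_le_rpow_slitHarmonicMeasure ?_ (by simp [h, h0]) (fun z hz => ?_) hK0 hε
      (fun x hx => ?_) hKs
    · exact (hd.mul (by fun_prop)).div_const _
    · have hre : 0 ≤ z.re := (abs_nonneg _).trans hz
      rw [hnorm, div_le_one hD]
      calc ‖H z‖ * Real.exp (-a * z.re)
          ≤ C * M ^ 2 * Real.exp (5 * max c₁ c₂ * z.re) * Real.exp (-a * z.re) := by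
            gcongr
            exact hg z hz
        _ = C * M ^ 2 * Real.exp ((5 * max c₁ c₂ - a) * z.re) := by
            rw [mul_assoc, ← Real.exp_add]
            ring_nf
        _ ≤ C * M ^ 2 * 1 := by
            gcongr
            exact Real.exp_le_one_iff.2 (mul_nonpos_of_nonpos_of_nonneg (by linarith) hre)
        _ ≤ (C + 1) * M ^ 2 := by nlinarith
    · rw [hnorm, div_le_iff₀ hD, ← hεK]
      calc ‖H x‖ * Real.exp (-a * (x : ℂ).re) ≤ ‖H K‖ * 1 := by
            gcongr
            · exact hmono x K hx.1 hx.2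
            · exact Real.exp_le_one_iff.2 (by
                rw [Complex.ofReal_re]
                nlinarith [hx.1])
        _ ≤ ‖H K‖ * ((C + 1) * M ^ 2) := by gcongr
  calc (∫ ω in (0:ℝ)..s,
        ω ^ 2 * (‖waveField c₁ c₂ f (-1) ω‖ ^ 2 + ‖waveField c₁ c₂ f 1 ω‖ ^ 2)) ≤ ‖H s‖ := by
        rw [hs, Complex.norm_real]
        exact le_abs_self _
    _ = (C + 1) * M ^ 2 * Real.exp (a * s) * ‖h s‖ := by
        rw [hnorm, Complex.ofReal_re, neg_mul, Real.exp_neg]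
        field_simp
    _ ≤ (C + 1) * M ^ 2 * Real.exp (a * s) * ε ^ (2 * slitHarmonicMeasure K s) := by gcongr
end

section
/- Fix κ₁, κ₂ > 0 and y > 0, and define G : ℝ → ℂ by G(x) = i(κ₁−κ₂)/(2κ₁(κ₁+κ₂)) e^{iκ₁(x+y)} + (i/(2κ₁)) e^{iκ₁|x−y|} for x > 0 and G(x) = (i/(κ₁+κ₂)) e^{i(κ₁ y − κ₂ x)} for x ≤ 0. Then: (i) G is continuous on ℝ; (ii) G is continuously differentiable on ℝ \ {y} (in particular G and G' are continuous across x = 0); (iii) the one-sided derivatives at x = y satisfy G'(y⁺) − G'(y⁻) = −1; and (iv) G'' + κ₁² G = 0 on (0,y) and on (y,∞), and G'' + κ₂² G = 0 on (−∞,0). -/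
open Real Set

/-- The superposition `A e^{ikx} + B e^{-ikx}` of two plane waves. -/
noncomputable def planeWaves (k A B : ℂ) (x : ℝ) : ℂ :=
  A * Complex.exp (Complex.I * k * x) + B * Complex.exp (-(Complex.I * k * x))

theorem hasDerivAt_planeWaves (k A B : ℂ) (x : ℝ) :
    HasDerivAt (planeWaves k A B)
      (planeWaves k (Complex.I * k * A) (-(Complex.I * k * B)) x) x := by
  have h : HasDerivAt (fun t : ℝ => Complex.I * k * (t : ℂ)) (Complex.I * k) x := by
    simpa using (Complex.ofRealCLM.hasDerivAt (x := x)).const_mul (Complex.I * k)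
  have := (h.cexp.const_mul A).add (h.neg.cexp.const_mul B)
  refine this.congr_deriv ?_
  simp only [planeWaves, Pi.neg_apply]
  ring

theorem exists_hasDerivAt_add_sq_mul_planeWaves {f g : ℝ → ℂ} {k A B : ℂ} {s : Set ℝ} {x : ℝ}
    (hs : s ∈ nhds x) (hf : EqOn f (planeWaves k A B) s)
    (hg : EqOn g (planeWaves k (Complex.I * k * A) (-(Complex.I * k * B))) s) :
    HasDerivAt f (g x) x ∧ ∃ d : ℂ, HasDerivAt g d x ∧ d + k ^ 2 * f x = 0 := by
  have hx := mem_of_mem_nhds hs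
  refine ⟨?_, _, (hasDerivAt_planeWaves _ _ _ x).congr_of_eventuallyEq
    (hg.eventuallyEq_of_mem hs), ?_⟩
  · rw [hg hx]
    exact (hasDerivAt_planeWaves _ _ _ x).congr_of_eventuallyEq (hf.eventuallyEq_of_mem hs)
  · rw [hf hx]
    simp only [planeWaves]
    linear_combination (k ^ 2 * A * Complex.exp (Complex.I * k * x)
      + k ^ 2 * B * Complex.exp (-(Complex.I * k * x))) * Complex.I_sq

/-- The explicit formula (source point `y > 0`) is the outgoing Green function of the
two-layered one-dimensional Helmholtz operator: it is continuous, continuously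
differentiable away from `y` (in particular `G` and `G'` are continuous across `0`),
its one-sided derivatives at `y` jump by `-1`, and it satisfies `G'' + κ₁² G = 0` on
`(0,y) ∪ (y,∞)` and `G'' + κ₂² G = 0` on `(-∞,0)`. -/
theorem green_function_right_source (κ₁ κ₂ y : ℝ) (hκ₁ : 0 < κ₁) (hκ₂ : 0 < κ₂) (hy : 0 < y)
    (G : ℝ → ℂ)
    (hG : ∀ x : ℝ, G x =
      if 0 < x then
        Complex.I * ((κ₁ : ℂ) - (κ₂ : ℂ)) / (2 * (κ₁ : ℂ) * ((κ₁ : ℂ) + (κ₂ : ℂ))) *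
            Complex.exp (Complex.I * (κ₁ : ℂ) * ((x + y : ℝ) : ℂ))
          + Complex.I / (2 * (κ₁ : ℂ)) * Complex.exp (Complex.I * (κ₁ : ℂ) * ((|x - y| : ℝ) : ℂ))
      else
        Complex.I / ((κ₁ : ℂ) + (κ₂ : ℂ)) *
          Complex.exp (Complex.I * ((κ₁ * y - κ₂ * x : ℝ) : ℂ))) :
    Continuous G ∧
    ∃ G' : ℝ → ℂ,
      (∀ x : ℝ, x ≠ y → HasDerivAt G (G' x) x) ∧
      ContinuousOn G' {x : ℝ | x ≠ y} ∧
      (∃ dp dm : ℂ,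
        HasDerivWithinAt G dp (Set.Ici y) y ∧
        HasDerivWithinAt G dm (Set.Iic y) y ∧
        dp - dm = -1) ∧
      (∀ x ∈ Set.Ioo 0 y ∪ Set.Ioi y,
        ∃ d₂ : ℂ, HasDerivAt G' d₂ x ∧ d₂ + ((κ₁ : ℂ)) ^ 2 * G x = 0) ∧
      (∀ x ∈ Set.Iio (0:ℝ),
        ∃ d₂ : ℂ, HasDerivAt G' d₂ x ∧ d₂ + ((κ₂ : ℂ)) ^ 2 * G x = 0) := by
  have hsum : (κ₁ : ℂ) + κ₂ ≠ 0 := by exact_mod_cast (add_pos hκ₁ hκ₂).ne'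
  have hk : (κ₁ : ℂ) ≠ 0 := by exact_mod_cast hκ₁.ne'
  set E : ℂ := Complex.exp (Complex.I * κ₁ * y) with hE
  have hE0 : E ≠ 0 := Complex.exp_ne_zero _
  have hEneg : Complex.exp (-(Complex.I * κ₁ * y)) = E⁻¹ := Complex.exp_neg _
  set R : ℂ := Complex.I * ((κ₁ : ℂ) - κ₂) / (2 * κ₁ * ((κ₁ : ℂ) + κ₂)) with hR
  set S : ℂ := Complex.I / (2 * (κ₁ : ℂ)) with hS
  set T : ℂ := Complex.I / ((κ₁ : ℂ) + κ₂) with hT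
  have hRST : R + S = T := by
    rw [hR, hS, hT]; field_simp; ring
  have hRST' : κ₁ * (R - S) = -(κ₂ * T) := by
    rw [hR, hS, hT]; field_simp; ring
  have hSI : 2 * Complex.I * κ₁ * S = -1 := by
    rw [hS]; field_simp; simp
  -- `G` on the three intervals
  have hG₀ : EqOn G (planeWaves κ₂ 0 (T * E)) (Iic 0) := by
    intro x hx
    rw [hG, if_neg (not_lt.2 hx)]
    simp only [planeWaves, hE, zero_mul, zero_add, mul_assoc T, ← Complex.exp_add]
    congr 2
    push_cast
    ring
  have hG₁ : EqOn G (planeWaves κ₁ (R * E) (S * E)) (Icc 0 y) := by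
    intro x hx
    rcases hx.1.eq_or_lt with rfl | h0
    · rw [hG₀ self_mem_Iic]
      simp only [planeWaves, Complex.ofReal_zero, mul_zero, neg_zero, Complex.exp_zero]
      linear_combination -E * hRST
    · rw [hG, if_pos h0, abs_of_nonpos (sub_nonpos.2 hx.2)]
      simp only [planeWaves, hE, mul_assoc R, mul_assoc S, ← Complex.exp_add]
      congr 3 <;> push_cast <;> ring
  have hG₂ : EqOn G (planeWaves κ₁ (R * E + S * E⁻¹) 0) (Ici y) := by
    intro x hx
    rw [hG, if_pos (hy.trans_le hx), abs_of_nonneg (sub_nonneg.2 hx)]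
    simp only [planeWaves, hE, ← Complex.exp_neg, zero_mul, add_zero, add_mul, mul_assoc R,
      mul_assoc S, ← Complex.exp_add]
    congr 3 <;> push_cast <;> ring
  -- the derivative on the three intervals
  let D₀ := planeWaves κ₂ (Complex.I * κ₂ * 0) (-(Complex.I * κ₂ * (T * E)))
  let D₁ := planeWaves κ₁ (Complex.I * κ₁ * (R * E)) (-(Complex.I * κ₁ * (S * E)))
  let D₂ := planeWaves κ₁ (Complex.I * κ₁ * (R * E + S * E⁻¹)) (-(Complex.I * κ₁ * 0))
  let G' : ℝ → ℂ := fun x => if x ≤ 0 then D₀ x else if x < y then D₁ x else D₂ x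
  have hD : D₀ 0 = D₁ 0 := by
    simp only [D₀, D₁, planeWaves, Complex.ofReal_zero, mul_zero, neg_zero, Complex.exp_zero]
    linear_combination -Complex.I * E * hRST'
  have hG'₀ : EqOn G' D₀ (Iic 0) := fun x hx => if_pos hx
  have hG'₁ : EqOn G' D₁ (Ico 0 y) := by
    intro x hx
    rcases hx.1.eq_or_lt with rfl | h0
    · rw [hG'₀ self_mem_Iic, hD]
    · simp only [G', if_neg h0.not_ge, if_pos hx.2]
  have hG'₂ : EqOn G' D₂ (Ici y) := by
    intro x hx
    simp only [G', if_neg (hy.trans_le hx).not_ge, if_neg (not_lt.2 (mem_Ici.1 hx))]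
  have main₀ : ∀ x < 0, HasDerivAt G (G' x) x ∧
      ∃ d : ℂ, HasDerivAt G' d x ∧ d + (κ₂ : ℂ) ^ 2 * G x = 0 := fun x hx =>
    exists_hasDerivAt_add_sq_mul_planeWaves (Iic_mem_nhds hx) hG₀ hG'₀
  have main₁ : ∀ x ∈ Ioo 0 y, HasDerivAt G (G' x) x ∧
      ∃ d : ℂ, HasDerivAt G' d x ∧ d + (κ₁ : ℂ) ^ 2 * G x = 0 := fun x hx =>
    exists_hasDerivAt_add_sq_mul_planeWaves (Ico_mem_nhds hx.1 hx.2)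
      (hG₁.mono Ico_subset_Icc_self) hG'₁
  have main₂ : ∀ x > y, HasDerivAt G (G' x) x ∧
      ∃ d : ℂ, HasDerivAt G' d x ∧ d + (κ₁ : ℂ) ^ 2 * G x = 0 := fun x hx =>
    exists_hasDerivAt_add_sq_mul_planeWaves (Ici_mem_nhds hx) hG₂ hG'₂
  have hunion : Iic 0 ∪ Ico 0 y ∈ nhds (0 : ℝ) := by
    rw [Iic_union_Ico_eq_Iio hy]
    exact Iio_mem_nhds hy
  have hzero : HasDerivAt G (G' 0) 0 := by
    have hl : HasDerivWithinAt G (G' 0) (Iic 0) 0 := by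
      rw [hG'₀ self_mem_Iic]
      exact (hasDerivAt_planeWaves _ _ _ 0).hasDerivWithinAt.congr hG₀ (hG₀ self_mem_Iic)
    have hr : HasDerivWithinAt G (G' 0) (Ico 0 y) 0 := by
      rw [hG'₁ (left_mem_Ico.2 hy)]
      exact (hasDerivAt_planeWaves _ _ _ 0).hasDerivWithinAt.congr
        (hG₁.mono Ico_subset_Icc_self) (hG₁ (left_mem_Icc.2 hy.le))
    exact (hl.union hr).hasDerivAt hunion
  have hzero' : ContinuousAt G' 0 := by
    have hl : ContinuousWithinAt G' (Iic 0) 0 :=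
      (hasDerivAt_planeWaves _ _ _ 0).continuousAt.continuousWithinAt.congr hG'₀
        (hG'₀ self_mem_Iic)
    have hr : ContinuousWithinAt G' (Ico 0 y) 0 :=
      (hasDerivAt_planeWaves _ _ _ 0).continuousAt.continuousWithinAt.congr hG'₁
        (hG'₁ (left_mem_Ico.2 hy))
    exact (hl.union hr).continuousAt hunion
  have hderiv : ∀ x, x ≠ y → HasDerivAt G (G' x) x ∧ ContinuousAt G' x := by
    intro x hxy
    rcases lt_trichotomy x 0 with h | rfl | h
    · obtain ⟨h₁, d, h₂, -⟩ := main₀ x h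
      exact ⟨h₁, h₂.continuousAt⟩
    · exact ⟨hzero, hzero'⟩
    · rcases hxy.lt_or_gt with h' | h'
      · obtain ⟨h₁, d, h₂, -⟩ := main₁ x ⟨h, h'⟩
        exact ⟨h₁, h₂.continuousAt⟩
      · obtain ⟨h₁, d, h₂, -⟩ := main₂ x h'
        exact ⟨h₁, h₂.continuousAt⟩
  have hp : HasDerivWithinAt G (D₂ y) (Ici y) y :=
    (hasDerivAt_planeWaves _ _ _ y).hasDerivWithinAt.congr hG₂ (hG₂ self_mem_Ici)
  have hm : HasDerivWithinAt G (D₁ y) (Iic y) y := by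
    have h : HasDerivWithinAt G (D₁ y) (Icc 0 y) y :=
      (hasDerivAt_planeWaves _ _ _ y).hasDerivWithinAt.congr hG₁ (hG₁ (right_mem_Icc.2 hy.le))
    exact h.mono_of_mem_nhdsWithin (Icc_mem_nhdsLE hy)
  refine ⟨continuous_iff_continuousAt.2 fun x => ?_, G', fun x hx => (hderiv x hx).1,
    fun x hx => (hderiv x hx).2.continuousWithinAt, ⟨D₂ y, D₁ y, hp, hm, ?_⟩, ?_,
    fun x hx => (main₀ x hx).2⟩
  · rcases eq_or_ne x y with rfl | hxy
    · exact continuousAt_iff_continuous_left_right.2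
        ⟨hm.continuousWithinAt, hp.continuousWithinAt⟩
    · exact (hderiv x hxy).1.continuousAt
  · simp only [D₁, D₂, planeWaves, hEneg, ← hE]
    linear_combination hSI + 2 * Complex.I * κ₁ * S * mul_inv_cancel₀ hE0
  · rintro x (hx | hx)
    · exact (main₁ x hx).2
    · exact (main₂ x hx).2
end

section
/- Fix κ₁, κ₂ > 0 and y < 0, and define G : ℝ → ℂ by G(x) = i(κ₂−κ₁)/(2κ₂(κ₁+κ₂)) e^{−iκ₂(x+y)} + (i/(2κ₂)) e^{iκ₂|x−y|} for x < 0 and G(x) = (i/(κ₁+κ₂)) e^{i(−κ₂ y + κ₁ x)} for x ≥ 0. Then: (i) G is continuous on ℝ; (ii) G is continuously differentiable on ℝ \ {y} (in particular G and G' are continuous across x = 0); (iii) the one-sided derivatives at x = y satisfy G'(y⁺) − G'(y⁻) = −1; and (iv) G'' + κ₂² G = 0 on (−∞,y) and on (y,0), and G'' + κ₁² G = 0 on (0,∞). -/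
open Real Set

/-- The plane wave `c * exp (k * x + m)` on the real line. -/
noncomputable def planeWave (c k m : ℂ) (x : ℝ) : ℂ :=
  c * Complex.exp (k * x + m)

theorem hasDerivAt_planeWave (c k m : ℂ) (x : ℝ) :
    HasDerivAt (planeWave c k m) (planeWave (c * k) k m x) x := by
  have h : HasDerivAt (fun z : ℂ => c * Complex.exp (k * z + m))
      (c * (Complex.exp (k * x + m) * (k * 1))) (x : ℂ) :=
    ((((hasDerivAt_id (x : ℂ)).const_mul k).add_const m).cexp).const_mul c
  have e : planeWave (c * k) k m x = c * (Complex.exp (k * x + m) * (k * 1)) := by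
    rw [planeWave]
    ring
  rw [e]
  exact h.comp_ofReal

theorem continuous_planeWave (c k m : ℂ) : Continuous (planeWave c k m) := by
  unfold planeWave
  fun_prop

/-- The explicit formula (source point `y < 0`) is the outgoing Green function of the
two-layered one-dimensional Helmholtz operator: it is continuous, continuously
differentiable away from `y` (in particular `G` and `G'` are continuous across `0`),
its one-sided derivatives at `y` jump by `-1`, and it satisfies `G'' + κ₂² G = 0` on
`(-∞,y) ∪ (y,0)` and `G'' + κ₁² G = 0` on `(0,∞)`. -/
theorem green_function_left_source (κ₁ κ₂ y : ℝ) (hκ₁ : 0 < κ₁) (hκ₂ : 0 < κ₂) (hy : y < 0)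
    (G : ℝ → ℂ)
    (hG : ∀ x : ℝ, G x =
      if x < 0 then
        Complex.I * ((κ₂ : ℂ) - (κ₁ : ℂ)) / (2 * (κ₂ : ℂ) * ((κ₁ : ℂ) + (κ₂ : ℂ))) *
            Complex.exp (-Complex.I * (κ₂ : ℂ) * ((x + y : ℝ) : ℂ))
          + Complex.I / (2 * (κ₂ : ℂ)) * Complex.exp (Complex.I * (κ₂ : ℂ) * ((|x - y| : ℝ) : ℂ))
      else
        Complex.I / ((κ₁ : ℂ) + (κ₂ : ℂ)) *
          Complex.exp (Complex.I * ((-(κ₂ * y) + κ₁ * x : ℝ) : ℂ))) :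
    Continuous G ∧
    ∃ G' : ℝ → ℂ,
      (∀ x : ℝ, x ≠ y → HasDerivAt G (G' x) x) ∧
      ContinuousOn G' {x : ℝ | x ≠ y} ∧
      (∃ dp dm : ℂ,
        HasDerivWithinAt G dp (Set.Ici y) y ∧
        HasDerivWithinAt G dm (Set.Iic y) y ∧
        dp - dm = -1) ∧
      (∀ x ∈ Set.Iio y ∪ Set.Ioo y 0,
        ∃ d₂ : ℂ, HasDerivAt G' d₂ x ∧ d₂ + ((κ₂ : ℂ)) ^ 2 * G x = 0) ∧
      (∀ x ∈ Set.Ioi (0:ℝ),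
        ∃ d₂ : ℂ, HasDerivAt G' d₂ x ∧ d₂ + ((κ₁ : ℂ)) ^ 2 * G x = 0) := by
  have hs : (κ₁ : ℂ) + κ₂ ≠ 0 := by exact_mod_cast (add_pos hκ₁ hκ₂).ne'
  have h2 : (κ₂ : ℂ) ≠ 0 := by exact_mod_cast hκ₂.ne'
  obtain ⟨R, hR⟩ : ∃ R : ℂ, R = Complex.I * ((κ₂ : ℂ) - (κ₁ : ℂ)) /
      (2 * (κ₂ : ℂ) * ((κ₁ : ℂ) + (κ₂ : ℂ))) := ⟨_, rfl⟩
  obtain ⟨T, hT⟩ : ∃ T : ℂ, T = Complex.I / (2 * (κ₂ : ℂ)) := ⟨_, rfl⟩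
  obtain ⟨S, hS⟩ : ∃ S : ℂ, S = Complex.I / ((κ₁ : ℂ) + (κ₂ : ℂ)) := ⟨_, rfl⟩
  have hRTS : R + T = S := by
    rw [hR, hT, hS]
    field_simp
    ring
  have hRTS' : (T - R) * κ₂ = S * κ₁ := by
    rw [hR, hT, hS]
    field_simp
    ring
  have hTk : 2 * T * κ₂ = Complex.I := by
    rw [hT]
    field_simp
  rw [← hR, ← hT, ← hS] at hG
  clear hR hT hS
  set a : ℂ := Complex.I * κ₂ with ha
  set b : ℂ := Complex.I * κ₁ with hb
  -- The three branches: left of the source, between source and interface, right of the interface.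
  set L : ℂ → ℂ → ℝ → ℂ := fun r t x =>
    planeWave r (-a) (-a * y) x + planeWave t (-a) (a * y) x with hL
  set M : ℂ → ℂ → ℝ → ℂ := fun r t x =>
    planeWave r (-a) (-a * y) x + planeWave t a (-a * y) x with hM
  have dL (r t : ℂ) (x : ℝ) : HasDerivAt (L r t) (L (r * -a) (t * -a) x) x :=
    (hasDerivAt_planeWave _ _ _ x).add (hasDerivAt_planeWave _ _ _ x)
  have dM (r t : ℂ) (x : ℝ) : HasDerivAt (M r t) (M (r * -a) (t * a) x) x :=
    (hasDerivAt_planeWave _ _ _ x).add (hasDerivAt_planeWave _ _ _ x)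
  have dN (s : ℂ) (x : ℝ) :
      HasDerivAt (planeWave s b (-a * y)) (planeWave (s * b) b (-a * y) x) x :=
    hasDerivAt_planeWave _ _ _ x
  have M_zero (r t : ℂ) : M r t 0 = (r + t) * Complex.exp (-a * y) := by
    simp [hM, planeWave, add_mul]
  have N_zero (s : ℂ) : planeWave s b (-a * y) 0 = s * Complex.exp (-a * y) := by
    simp [planeWave]
  have match_deriv : R * -a + T * a = S * b := by
    rw [ha, hb]
    linear_combination Complex.I * hRTS'
  have eqL (x : ℝ) (hx : x ≤ y) : G x = L R T x := by
    rw [hG, if_pos (hx.trans_lt hy), abs_of_nonpos (by linarith)]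
    simp only [hL, planeWave, ha]
    push_cast
    ring_nf
  have eqM (x : ℝ) (hx : y ≤ x) (hx0 : x < 0) : G x = M R T x := by
    rw [hG, if_pos hx0, abs_of_nonneg (by linarith)]
    simp only [hM, planeWave, ha]
    push_cast
    ring_nf
  have eqN (x : ℝ) (hx : 0 ≤ x) : G x = planeWave S b (-a * y) x := by
    rw [hG, if_neg (not_lt.2 hx)]
    simp only [planeWave, ha, hb]
    push_cast
    ring_nf
  have eqM' (x : ℝ) (hx : y ≤ x) (hx0 : x ≤ 0) : G x = M R T x := by
    rcases hx0.lt_or_eq with h | rfl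
    · exact eqM x hx h
    · rw [eqN 0 le_rfl, M_zero, N_zero, hRTS]
  have dp : HasDerivWithinAt G (M (R * -a) (T * a) y) (Ici y) y :=
    (dM R T y).hasDerivWithinAt.congr_of_eventuallyEq
      (by
        filter_upwards [self_mem_nhdsWithin, mem_nhdsWithin_of_mem_nhds (Iio_mem_nhds hy)]
          with z hz hz0 using eqM z hz hz0) (eqM y le_rfl hy)
  have dm : HasDerivWithinAt G (L (R * -a) (T * -a) y) (Iic y) y :=
    (dL R T y).hasDerivWithinAt.congr (fun z hz => eqL z hz) (eqL y le_rfl)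
  set K : ℝ → ℂ := fun x =>
    if x ≤ 0 then M (R * -a) (T * a) x else planeWave (S * b) b (-a * y) x with hK
  have cK : Continuous K := by
    refine Continuous.if_le ?_ (continuous_planeWave _ _ _) continuous_id continuous_const ?_
    · exact (continuous_planeWave _ _ _).add (continuous_planeWave _ _ _)
    · rintro x (rfl : x = 0)
      rw [M_zero, N_zero, match_deriv]
  set G' : ℝ → ℂ := fun x => if x < y then L (R * -a) (T * -a) x else K x with hG'
  have G'L {x : ℝ} (hx : x < y) : G' =ᶠ[nhds x] L (R * -a) (T * -a) := by
    filter_upwards [Iio_mem_nhds hx] with z hz using if_pos hz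
  have G'K {x : ℝ} (hx : y < x) : G' =ᶠ[nhds x] K := by
    filter_upwards [Ioi_mem_nhds hx] with z hz using if_neg (not_lt.2 (le_of_lt hz))
  have KM {x : ℝ} (hx : x < 0) : K =ᶠ[nhds x] M (R * -a) (T * a) := by
    filter_upwards [Iio_mem_nhds hx] with z hz using if_pos (le_of_lt hz)
  have KN {x : ℝ} (hx : 0 < x) : K =ᶠ[nhds x] planeWave (S * b) b (-a * y) := by
    filter_upwards [Ioi_mem_nhds hx] with z hz using if_neg (not_le.2 hz)
  have dG (x : ℝ) (hx : x ≠ y) : HasDerivAt G (G' x) x := by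
    rcases hx.lt_or_gt with h | h
    · rw [(G'L h).eq_of_nhds]
      refine (dL R T x).congr_of_eventuallyEq ?_
      filter_upwards [Iio_mem_nhds h] with z hz using eqL z (le_of_lt hz)
    rw [(G'K h).eq_of_nhds]
    rcases lt_trichotomy x 0 with h0 | rfl | h0
    · rw [(KM h0).eq_of_nhds]
      refine (dM R T x).congr_of_eventuallyEq ?_
      filter_upwards [Ioo_mem_nhds h h0] with z hz using eqM z hz.1.le hz.2
    · have left : HasDerivWithinAt G (K 0) (Iic 0) 0 := by
        have := (dM R T 0).hasDerivWithinAt (s := Iic 0)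
        rw [show K 0 = M (R * -a) (T * a) 0 from if_pos le_rfl]
        refine this.congr_of_eventuallyEq ?_ (eqM' 0 hy.le le_rfl)
        filter_upwards [self_mem_nhdsWithin, mem_nhdsWithin_of_mem_nhds (Ioi_mem_nhds hy)]
          with z hz hzy using eqM' z (le_of_lt hzy) hz
      have right : HasDerivWithinAt G (K 0) (Ici 0) 0 := by
        rw [show K 0 = planeWave (S * b) b (-a * y) 0 by
          rw [N_zero, ← match_deriv, ← M_zero]
          exact if_pos le_rfl]
        exact (dN S 0).hasDerivWithinAt.congr (fun z hz => eqN z hz) (eqN 0 le_rfl)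
      simpa [Iic_union_Ici] using left.union right
    · rw [(KN h0).eq_of_nhds]
      refine (dN S x).congr_of_eventuallyEq ?_
      filter_upwards [Ioi_mem_nhds h0] with z hz using eqN z (le_of_lt hz)
  refine ⟨continuous_iff_continuousAt.2 fun x => ?_, G', dG, fun x hx => ?_,
    ⟨_, _, dp, dm, ?_⟩, ?_, fun x hx => ?_⟩
  · by_cases hx : x = y
    · subst hx
      exact continuousAt_iff_continuous_left_right.2
        ⟨dm.continuousWithinAt, dp.continuousWithinAt⟩
    · exact (dG x hx).continuousAt
  · refine ContinuousAt.continuousWithinAt ?_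
    rcases lt_or_gt_of_ne hx with h | h
    · exact (dL _ _ x).continuousAt.congr (G'L h).symm
    · exact cK.continuousAt.congr (G'K h).symm
  · simp only [hL, hM, planeWave]
    rw [show a * (y : ℂ) + -a * y = 0 by ring, show -a * (y : ℂ) + a * y = 0 by ring,
      Complex.exp_zero, ha]
    linear_combination Complex.I * hTk + Complex.I_mul_I
  · rintro x (hx | hx)
    · refine ⟨_, (dL _ _ x).congr_of_eventuallyEq (G'L hx), ?_⟩
      rw [eqL x (le_of_lt hx)]
      simp only [hL, planeWave, ha]
      ring_nf
      simp only [Complex.I_sq]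
      ring
    · refine ⟨_, (dM _ _ x).congr_of_eventuallyEq ((G'K hx.1).trans (KM hx.2)), ?_⟩
      rw [eqM x hx.1.le hx.2]
      simp only [hM, planeWave, ha]
      ring_nf
      simp only [Complex.I_sq]
      ring
  · refine ⟨_, (dN _ x).congr_of_eventuallyEq ((G'K (hy.trans hx)).trans (KN hx)), ?_⟩
    rw [eqN x (le_of_lt hx)]
    simp only [planeWave, hb]
    ring_nf
    simp only [Complex.I_sq]
    ring
end
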